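/- arXiv:2411.14268 — 2 statements merged into one kernel-verified Lean document; each statement's English description precedes it below -/
import Mathlib

section
/- There exists ε > 0 such that for all sufficiently large n and every integer w ≥ 2, every resolution refutation of the 3-CNF formula ExBracket_n of width at most w has depth at least n^{ε·(log n)/(log w)}. -/
namespace Paper


/-! ### Bracket symbols, partial states, and the bracket axioms (A1)-(A4) -/

inductive BType : Type
  | trivR | trivB | openR | openB | closeR | closeB
  deriving DecidableEq

structure Sym (n : ℕ) where
  b : BType
  p : Fin n
  deriving DecidableEq

/-- Partial assignment of bracket symbols to positions (`none` = `*`). -/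
abbrev PState (n : ℕ) := Fin n → Option (Sym n)

/-- Positions `i` and `j` are paired (pointers point at each other). -/
def Paired {n : ℕ} (ρ : PState n) (i j : Fin n) : Prop :=
  ∃ σ τ : Sym n, ρ i = some σ ∧ ρ j = some τ ∧ σ.p = j ∧ τ.p = i

/-- Axiom (A1) is falsified: start/end of string condition fails on assigned entries. -/
def ViolA1 {n : ℕ} (ρ : PState n) : Prop :=
  (∃ i : Fin n, (i : ℕ) = 0 ∧ ∃ σ, ρ i = some σ ∧ ¬(σ.b = BType.trivR ∨ σ.b = BType.openR)) ∨
  (∃ i : Fin n, (i : ℕ) = n - 1 ∧ ∃ σ, ρ i = some σ ∧ ¬(σ.b = BType.trivB ∨ σ.b = BType.closeB))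

/-- Axiom (A2) is falsified: pointers fail to define colour-matched bracket pairs. -/
def ViolA2 {n : ℕ} (ρ : PState n) : Prop :=
  (∃ i j : Fin n, ∃ σ τ : Sym n, ρ i = some σ ∧ ρ j = some τ ∧ σ.p = j ∧ τ.p ≠ i) ∨
  (∃ i : Fin n, ∃ σ : Sym n, ρ i = some σ ∧ σ.p = i ∧
    ¬(σ.b = BType.trivR ∨ σ.b = BType.trivB)) ∨
  (∃ i j : Fin n, ∃ σ τ : Sym n, i < j ∧ ρ i = some σ ∧ ρ j = some τ ∧ σ.p = j ∧ τ.p = i ∧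
    ¬((σ.b = BType.openR ∧ τ.b = BType.closeR) ∨ (σ.b = BType.openB ∧ τ.b = BType.closeB)))

/-- Axiom (A3) is falsified: two pairs are incorrectly nested. -/
def ViolA3 {n : ℕ} (ρ : PState n) : Prop :=
  ∃ i i' j j' : Fin n, Paired ρ i j ∧ Paired ρ i' j' ∧ i < i' ∧ i' < j ∧ j < j'

/-- Axiom (A4) is falsified: a red-to-blue transition occurs at consecutive indices. -/
def ViolA4 {n : ℕ} (ρ : PState n) : Prop :=
  ∃ i j : Fin n, (j : ℕ) = (i : ℕ) + 1 ∧ ∃ σ τ : Sym n, ρ i = some σ ∧ ρ j = some τ ∧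
    (σ.b = BType.closeR ∨ σ.b = BType.trivR) ∧ (τ.b = BType.openB ∨ τ.b = BType.trivB)

/-- The partial state falsifies one of the axioms (A1)-(A4). -/
def Falsifies {n : ℕ} (ρ : PState n) : Prop := ViolA1 ρ ∨ ViolA2 ρ ∨ ViolA3 ρ ∨ ViolA4 ρ

/-- A partial assignment is consistent if it falsifies no axiom. -/
def ConsistentPS {n : ℕ} (ρ : PState n) : Prop := ¬ Falsifies ρ


/-! ### Clauses, CNFs and resolution refutations -/

/-- A clause: a finite set of literals (variable, polarity), read as a disjunction. -/
abbrev Clause (V : Type) := Finset (V × Bool)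

/-- An assignment satisfies a clause if it satisfies some literal of it. -/
def SatC {V : Type} (α : V → Bool) (C : Clause V) : Prop := ∃ l ∈ C, α l.1 = l.2

/-- A set of clauses is unsatisfiable. -/
def Unsat {V : Type} (F : Set (Clause V)) : Prop := ∀ α : V → Bool, ∃ C ∈ F, ¬ SatC α C

/-- A resolution refutation of `F`: a sequence of clauses ending in the empty clause,
each clause either in `F` or obtained from two earlier clauses by the resolution rule
(the premises being recorded in `prem`). -/
structure Refutation (V : Type) [DecidableEq V] (F : Set (Clause V)) where
  size : ℕ
  size_pos : 0 < size
  clause : Fin size → Clause V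
  prem : Fin size → Option (Fin size × Fin size × V)
  ok : ∀ i : Fin size,
    match prem i with
    | none => clause i ∈ F
    | some (j, k, x) =>
        j < i ∧ k < i ∧ (x, true) ∈ clause j ∧ (x, false) ∈ clause k ∧
          clause i = (clause j).erase (x, true) ∪ (clause k).erase (x, false)
  last_empty : clause ⟨size - 1, Nat.sub_lt size_pos Nat.one_pos⟩ = ∅

/-- The refutation has width at most `w`. -/
def WidthLE {V : Type} [DecidableEq V] {F : Set (Clause V)}
    (R : Refutation V F) (w : ℕ) : Prop :=
  ∀ i, (R.clause i).card ≤ w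

/-- The refutation has depth (longest path in the derivation DAG) at most `d`,
witnessed by a height function. -/
def DepthLE {V : Type} [DecidableEq V] {F : Set (Clause V)}
    (R : Refutation V F) (d : ℕ) : Prop :=
  ∃ h : Fin R.size → ℕ, (∀ i, h i ≤ d) ∧
    ∀ i j k x, R.prem i = some (j, k, x) → h j < h i ∧ h k < h i


/-! ### Index-width and the extension-variable 3-CNF encoding -/

/-- Index-width of a clause: number of blocks (w.r.t. the block map `blk`) it mentions. -/
def iw {V : Type} {nB : ℕ} [DecidableEq V] (blk : V → Fin nB) (C : Clause V) : ℕ :=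
  (C.image fun l => blk l.1).card

/-- The refutation has index-width at most `w`. -/
def IndexWidthLE {V : Type} [DecidableEq V] {nB : ℕ} {F : Set (Clause V)}
    (blk : V → Fin nB) (R : Refutation V F) (w : ℕ) : Prop :=
  ∀ i, iw blk (R.clause i) ≤ w

theorem iw_mono {V : Type} {nB : ℕ} [DecidableEq V] (blk : V → Fin nB)
    {A B : Clause V} (h : A ⊆ B) : iw blk A ≤ iw blk B :=
  Finset.card_le_card (Finset.image_subset_image h)

/-- Extension variables: one variable `y_D` for every clause `D` of index-width at most `k`. -/
abbrev ExtVar {V : Type} {nB : ℕ} [DecidableEq V] (blk : V → Fin nB) (k : ℕ) : Type :=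
  {D : Clause V // iw blk D ≤ k}

/-- The extension-variable 3-CNF encoding `F'` of a CNF `F` of index-width `k`:
unit clauses `y_D` for `D ∈ F`; clauses forcing `y_{¬x} = ¬ y_x`; and clauses forcing
`y_{A ∨ B} ↔ (y_A ∨ y_B)` for all clauses of index-width at most `k`. -/
def ExtEnc {V : Type} {nB : ℕ} [DecidableEq V] (blk : V → Fin nB) (k : ℕ)
    (F : Set (Clause V)) : Set (Clause (ExtVar blk k)) :=
  { C | (∃ D ∈ F, ∃ h : iw blk D ≤ k, C = {((⟨D, h⟩ : ExtVar blk k), true)}) ∨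
        (∃ x : V, ∃ hp : iw blk ({(x, true)} : Clause V) ≤ k,
            ∃ hn : iw blk ({(x, false)} : Clause V) ≤ k,
          C = {((⟨{(x, true)}, hp⟩ : ExtVar blk k), true), (⟨{(x, false)}, hn⟩, true)} ∨
          C = {((⟨{(x, true)}, hp⟩ : ExtVar blk k), false), (⟨{(x, false)}, hn⟩, false)}) ∨
        (∃ A B : Clause V, ∃ hA : iw blk A ≤ k, ∃ hB : iw blk B ≤ k,
            ∃ hD : iw blk (A ∪ B) ≤ k,
          C = {((⟨A ∪ B, hD⟩ : ExtVar blk k), false), (⟨A, hA⟩, true), (⟨B, hB⟩, true)} ∨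
          C = {((⟨A ∪ B, hD⟩ : ExtVar blk k), true), (⟨A, hA⟩, false)} ∨
          C = {((⟨A ∪ B, hD⟩ : ExtVar blk k), true), (⟨B, hB⟩, false)}) }


/-! ### The bracket formula and its 3-CNF version -/

/-- Number of bits per block: `⌈log₂ |Σ|⌉` with `|Σ| = 6n`. -/
def mBits (n : ℕ) : ℕ := Nat.clog 2 (6 * n)

/-- Boolean variables of the bracket formula: `mBits n` variables per index. -/
abbrev BVar (n : ℕ) := Fin n × Fin (mBits n)

/-- The partial assignment equal to `s` on `S` and `*` elsewhere. -/
def partialOn {n : ℕ} (S : Finset (Fin n)) (s : Fin n → Sym n) : PState n :=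
  fun i => if i ∈ S then some (s i) else none

/-- The CNF formula `Bracket_n` (w.r.t. an encoding `π` of symbols by `mBits n` bits):
all clauses mentioning at most 4 blocks that are implied by the bracket constraint on
those blocks. -/
def BracketCNF (n : ℕ) (π : Sym n → Fin (mBits n) → Bool) : Set (Clause (BVar n)) :=
  { C | ∃ S : Finset (Fin n), S.card ≤ 4 ∧ (∀ l ∈ C, l.1.1 ∈ S) ∧
      ∀ α : BVar n → Bool,
        (∃ s : Fin n → Sym n, (∀ i ∈ S, ∀ j, α (i, j) = π (s i) j) ∧
          ConsistentPS (partialOn S s)) →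
        SatC α C }

/-- The 3-CNF formula `ExBracket_n`: the extension-variable encoding of `Bracket_n`
(whose index-width is 4). -/
def ExBracketCNF (n : ℕ) (π : Sym n → Fin (mBits n) → Bool) :
    Set (Clause (ExtVar (Prod.fst : BVar n → Fin n) 4)) :=
  ExtEnc Prod.fst 4 (BracketCNF n π)


/-! ### States of the game on the line -/

/-- The positions between `i` and its partner `p i`. -/
def seg (p : ℤ → ℤ) (i : ℤ) : Finset ℤ := Finset.uIcc i (p i)

/-- The positions lying between some `i ∈ K` and its partner. -/
def cov (p : ℤ → ℤ) (K : Finset ℤ) : Finset ℤ := K.biUnion (seg p)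

theorem mem_seg {p : ℤ → ℤ} {i j : ℤ} :
    j ∈ seg p i ↔ (i ≤ j ∧ j ≤ p i) ∨ (p i ≤ j ∧ j ≤ i) := by
  unfold seg
  rw [Finset.mem_uIcc, inf_le_iff, le_sup_iff]
  omega

theorem mem_cov {p : ℤ → ℤ} {K : Finset ℤ} {j : ℤ} :
    j ∈ cov p K ↔ ∃ i ∈ K, j ∈ seg p i := by
  simp [cov]

theorem self_mem_seg (p : ℤ → ℤ) (i : ℤ) : i ∈ seg p i := by
  rw [mem_seg]; omega

theorem partner_mem_seg (p : ℤ → ℤ) (i : ℤ) : p i ∈ seg p i := by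
  rw [mem_seg]; omega

theorem subset_cov (p : ℤ → ℤ) (K : Finset ℤ) : K ⊆ cov p K :=
  fun i hi => mem_cov.2 ⟨i, hi, self_mem_seg p i⟩

theorem seg_congr {p p' : ℤ → ℤ} {i : ℤ} (h : p' i = p i) : seg p' i = seg p i := by
  simp [seg, h]

theorem cov_congr {p p' : ℤ → ℤ} {K : Finset ℤ} (h : ∀ i ∈ K, p' i = p i) :
    cov p' K = cov p K := by
  unfold cov
  exact Finset.biUnion_congr rfl fun i hi => seg_congr (h i hi)

/-- The colouring `c` (`true` is red) and the partner map `p` describe, on the set `X` of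
positions in `[a, b)`, a family of well-nested monochromatic pairs, closed under taking
positions between partners, without red-to-blue transitions, and compatible with a red
boundary before `a` and a blue boundary after `b - 1`. -/
structure Good (a b : ℤ) (X : Finset ℤ) (c : ℤ → Bool) (p : ℤ → ℤ) : Prop where
  sub : ∀ i ∈ X, a ≤ i ∧ i < b
  inv : ∀ i ∈ X, p (p i) = i
  col : ∀ i ∈ X, c (p i) = c i
  closed : ∀ i ∈ X, ∀ j ∈ seg p i, j ∈ X ∧ p j ∈ seg p i
  trans : ∀ i ∈ X, i + 1 ∈ X → ¬ (c i = true ∧ p i ≤ i ∧ c (i + 1) = false ∧ i + 1 ≤ p (i + 1))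
  left : a ∈ X → c a = true
  right : b - 1 ∈ X → c (b - 1) = false

/-- The adversary survives `t` more rounds of the game on `[a, b)` from the state `(X, c, p)`:
in each round the prover keeps what is determined by at most `k` positions and queries one
further position. -/
def Surv (a b : ℤ) (k : ℕ) : ℕ → Finset ℤ → (ℤ → Bool) → (ℤ → ℤ) → Prop
  | 0, X, c, p => Good a b X c p
  | t + 1, X, c, p => Good a b X c p ∧ ∀ K ⊆ X, K.card ≤ k → ∀ q, a ≤ q → q < b →
      ∃ (c' : ℤ → Bool) (p' : ℤ → ℤ), (∀ i ∈ cov p K, c' i = c i ∧ p' i = p i) ∧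
        Surv a b k t (cov p K ∪ seg p' q) c' p'

theorem Good.cov_subset {a b : ℤ} {X c p} (h : Good a b X c p) {K : Finset ℤ} (hK : K ⊆ X) :
    cov p K ⊆ X := by
  intro j hj
  obtain ⟨i, hi, hij⟩ := mem_cov.1 hj
  exact (h.closed i (hK hi) j hij).1

theorem Good.partner_mem {a b : ℤ} {X c p} (h : Good a b X c p) {i : ℤ} (hi : i ∈ X) :
    p i ∈ X := (h.closed i hi _ (partner_mem_seg p i)).1

theorem Good.subset {a b : ℤ} {X Y c p} (h : Good a b X c p) (hY : Y ⊆ X)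
    (hc : ∀ i ∈ Y, seg p i ⊆ Y) : Good a b Y c p where
  sub i hi := h.sub i (hY hi)
  inv i hi := h.inv i (hY hi)
  col i hi := h.col i (hY hi)
  closed i hi j hj := ⟨hc i hi hj, (h.closed i (hY hi) j hj).2⟩
  trans i hi hi' := h.trans i (hY hi) (hY hi')
  left ha := h.left (hY ha)
  right hb := h.right (hY hb)

theorem Good.seg_subset {a b : ℤ} {X c p} (h : Good a b X c p) {i j : ℤ} (hi : i ∈ X)
    (hj : j ∈ seg p i) : seg p j ⊆ seg p i := by
  intro x hx
  have h1 := (h.closed i hi j hj).2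
  rw [mem_seg] at *
  omega

theorem Good.seg_subset_cov {a b : ℤ} {X c p} (h : Good a b X c p) {K : Finset ℤ} (hK : K ⊆ X)
    {i : ℤ} (hi : i ∈ cov p K) : seg p i ⊆ cov p K := by
  obtain ⟨l, hl, hil⟩ := mem_cov.1 hi
  exact fun x hx => mem_cov.2 ⟨l, hl, h.seg_subset (hK hl) hil hx⟩

theorem Good.cov {a b : ℤ} {X c p} (h : Good a b X c p) {K : Finset ℤ} (hK : K ⊆ X) :
    Good a b (cov p K) c p :=
  h.subset (h.cov_subset hK) fun _ hi => h.seg_subset_cov hK hi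

theorem Good.congr {a b : ℤ} {X c p c' p'} (h : Good a b X c p)
    (hc : ∀ i ∈ X, c' i = c i ∧ p' i = p i) : Good a b X c' p' where
  sub := h.sub
  inv i hi := by rw [(hc i hi).2, (hc _ (h.partner_mem hi)).2, h.inv i hi]
  col i hi := by rw [(hc i hi).2, (hc _ (h.partner_mem hi)).1, (hc i hi).1, h.col i hi]
  closed i hi j hj := by
    rw [seg_congr (hc i hi).2] at hj ⊢
    have := h.closed i hi j hj
    rw [(hc j this.1).2]
    exact this
  trans i hi hi' := by
    rw [(hc i hi).1, (hc i hi).2, (hc _ hi').1, (hc _ hi').2]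
    exact h.trans i hi hi'
  left ha := by rw [(hc _ ha).1, h.left ha]
  right hb := by rw [(hc _ hb).1, h.right hb]

theorem Surv.good {a b : ℤ} {k t : ℕ} {X c p} (h : Surv a b k t X c p) : Good a b X c p := by
  cases t with
  | zero => exact h
  | succ t => exact h.1

theorem Surv.pred {a b : ℤ} {k : ℕ} : ∀ {t : ℕ} {X c p}, Surv a b k (t + 1) X c p →
    Surv a b k t X c p
  | 0, _, _, _, h => h.1
  | t + 1, _, _, _, h => ⟨h.1, fun K hK hk q h1 h2 => by
      obtain ⟨c', p', h3, h4⟩ := h.2 K hK hk q h1 h2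
      exact ⟨c', p', h3, h4.pred⟩⟩

theorem Surv.mono {a b : ℤ} {k s t : ℕ} {X c p} (h : Surv a b k t X c p) (hs : s ≤ t) :
    Surv a b k s X c p := by
  induction t, hs using Nat.le_induction with
  | base => exact h
  | succ t _ ih => exact ih h.pred

theorem Surv.congr {a b : ℤ} {k t : ℕ} {X c p c' p'} (h : Surv a b k t X c p)
    (hc : ∀ i ∈ X, c' i = c i ∧ p' i = p i) : Surv a b k t X c' p' := by
  cases t with
  | zero => exact Good.congr h hc
  | succ t =>
    refine ⟨h.1.congr hc, fun K hK hk q h1 h2 => ?_⟩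
    have e : Paper.cov p' K = Paper.cov p K := cov_congr fun i hi => (hc i (hK hi)).2
    obtain ⟨c1, p1, h3, h4⟩ := h.2 K hK hk q h1 h2
    refine ⟨c1, p1, fun i hi => ?_, by rwa [e]⟩
    rw [e] at hi
    have hX := hc i (h.1.cov_subset hK hi)
    rw [hX.1, hX.2]
    exact h3 i hi

theorem Surv.cov {a b : ℤ} {k t : ℕ} {X c p} (h : Surv a b k t X c p) {K : Finset ℤ}
    (hK : K ⊆ X) : Surv a b k t (cov p K) c p := by
  cases t with
  | zero => exact Good.cov h hK
  | succ t =>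
    exact ⟨h.1.cov hK, fun K' hK' => h.2 K' (hK'.trans (h.1.cov_subset hK))⟩

/-- Reversing the line exchanges the two colours. -/
theorem Good.reflect {a b : ℤ} {X c p} (h : Good a b X c p) :
    Good (1 - b) (1 - a) (X.image Neg.neg) (fun x => !c (-x)) (fun x => -p (-x)) := by
  have hm : ∀ x, x ∈ X.image Neg.neg ↔ -x ∈ X := by
    intro x
    simp only [Finset.mem_image]
    exact ⟨by rintro ⟨y, hy, rfl⟩; simpa using hy, fun hx => ⟨-x, hx, by simp⟩⟩
  refine ⟨?_, ?_, ?_, ?_, ?_, ?_, ?_⟩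
  · intro i hi
    have := h.sub _ ((hm i).1 hi)
    omega
  · intro i hi
    simp [h.inv _ ((hm i).1 hi)]
  · intro i hi
    simp [h.col _ ((hm i).1 hi)]
  · intro i hi j hj
    have hj' : -j ∈ seg p (-i) := by
      rw [mem_seg] at *
      omega
    have := h.closed _ ((hm i).1 hi) _ hj'
    refine ⟨(hm j).2 this.1, ?_⟩
    have h2 := this.2
    rw [mem_seg] at *
    omega
  · intro i hi hi' hcon
    have h1 := (hm _).1 hi
    have h2 := (hm _).1 hi'
    have e : -(i + 1) + 1 = -i := by ring
    refine h.trans (-(i + 1)) h2 (by rw [e]; exact h1) ?_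
    rw [e]
    simp only [Bool.not_eq_true', Bool.not_eq_false'] at hcon
    refine ⟨hcon.2.2.1, ?_, hcon.1, ?_⟩ <;> omega
  · intro ha
    have h1 := (hm _).1 ha
    have e : -(1 - b) = b - 1 := by ring
    rw [e] at h1
    simp [h.right h1]
  · intro hb
    have h1 := (hm _).1 hb
    have e : -(1 - a - 1) = a := by ring
    rw [e] at h1
    simp only [e]
    simp [h.left h1]

/-! ### Filling the free positions -/

theorem Good.insert_pair {a b : ℤ} {X c p} (h : Good a b X c p) {o f : ℤ} (hof : o < f)
    (hao : a < o) (hfb : f < b) (ho : o ∉ X) (hf : f ∉ X) (hmid : ∀ j, o < j → j < f → j ∈ X)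
    (hred : o - 1 ∈ X → c (o - 1) = false) :
    Good a b (insert o (insert f X)) (fun i => if i = o ∨ i = f then false else c i)
      (fun i => if i = o then f else if i = f then o else p i) := by
  have hne : ∀ i ∈ X, i ≠ o ∧ i ≠ f := fun i hi =>
    ⟨fun e => ho (e ▸ hi), fun e => hf (e ▸ hi)⟩
  have hpne : ∀ i ∈ X, p i ≠ o ∧ p i ≠ f := fun i hi => hne _ (h.partner_mem hi)
  have hin : ∀ j, o < j → j < f → o < p j ∧ p j < f := by
    intro j h1 h2
    have hj := hmid j h1 h2
    have h3 : o ∉ seg p j := fun hx => ho (h.closed j hj o hx).1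
    have h4 : f ∉ seg p j := fun hx => hf (h.closed j hj f hx).1
    rw [mem_seg] at h3 h4
    omega
  have hfo : f ≠ o := by omega
  refine ⟨?_, ?_, ?_, ?_, ?_, ?_, ?_⟩
  · intro i hi
    rcases Finset.mem_insert.1 hi with rfl | hi
    · omega
    rcases Finset.mem_insert.1 hi with rfl | hi
    · omega
    exact h.sub i hi
  · intro i hi
    rcases Finset.mem_insert.1 hi with rfl | hi
    · simp [hfo]
    rcases Finset.mem_insert.1 hi with rfl | hi
    · simp [hfo]
    simp [hne i hi, hpne i hi, h.inv i hi]
  · intro i hi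
    rcases Finset.mem_insert.1 hi with rfl | hi
    · simp
    rcases Finset.mem_insert.1 hi with rfl | hi
    · simp [hfo]
    simp [hne i hi, hpne i hi, h.col i hi]
  · have key : ∀ j, o ≤ j → j ≤ f → j ∈ insert o (insert f X) ∧
        o ≤ (if j = o then f else if j = f then o else p j) ∧
        (if j = o then f else if j = f then o else p j) ≤ f := by
      intro j h1 h2
      by_cases e1 : j = o
      · subst e1; simp; omega
      by_cases e2 : j = f
      · subst e2; simp [e1]; omega
      have h3 : o < j := by omega
      have h4 : j < f := by omega
      have := hin j h3 h4
      simp [e1, e2, hmid j h3 h4]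
      omega
    intro i hi j hj
    rcases Finset.mem_insert.1 hi with rfl | hi
    · rw [mem_seg] at hj ⊢
      simp only [if_true] at hj ⊢
      have := key j (by omega) (by omega)
      exact ⟨this.1, by omega⟩
    rcases Finset.mem_insert.1 hi with rfl | hi
    · rw [mem_seg] at hj ⊢
      simp only [if_true, if_neg hfo] at hj ⊢
      have := key j (by omega) (by omega)
      exact ⟨this.1, by omega⟩
    have e : (fun i => if i = o then f else if i = f then o else p i) i = p i := by
      simp [hne i hi]
    rw [seg_congr e] at hj ⊢
    have h1 := h.closed i hi j hj
    simp only [hne j h1.1, if_false]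
    exact ⟨by simp [h1.1], h1.2⟩
  · rintro i hi hi' ⟨h1, h2, h3, h4⟩
    have hio : i ≠ o := by rintro rfl; simp at h1
    have hif : i ≠ f := by rintro rfl; simp at h1
    have hiX : i ∈ X := by simpa [hio, hif] using hi
    rw [if_neg (by tauto)] at h1
    simp only [hio, hif, if_false] at h2
    rcases Finset.mem_insert.1 hi' with e | hi'
    · have e' : o - 1 = i := by omega
      rw [e'] at hred
      simp [hred hiX] at h1
    rcases Finset.mem_insert.1 hi' with e | hi'
    · rw [e] at h4
      simp only [hfo, if_true, if_false] at h4
      omega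
    rw [if_neg (by have := hne _ hi'; tauto)] at h3
    simp only [hne _ hi', if_false] at h4
    exact h.trans i hiX hi' ⟨h1, h2, h3, h4⟩
  · intro ha
    have h1 : a ≠ o := by omega
    have h2 : a ≠ f := by omega
    have hX : a ∈ X := by simpa [h1, h2] using ha
    simp [h1, h2, h.left hX]
  · intro hb
    by_cases h1 : b - 1 = o ∨ b - 1 = f
    · simp only [h1, if_true]
    · have h1' := h1
      push Not at h1'
      have hX : b - 1 ∈ X := by simpa [h1'] using hb
      simp only [h1, if_false, h.right hX]

theorem Good.fill_trivial {a b v : ℤ} {X c p} (h : Good a b X c p) (hav : a < v)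
    (hC : ∀ f, v ≤ f → f < b → f ∉ X → f - 1 ∈ X → c (f - 1) = false) :
    Good a b (X ∪ Finset.Ico v b) (fun i => if i ∈ X then c i else false)
      (fun i => if i ∈ X then p i else i) := by
  refine ⟨?_, ?_, ?_, ?_, ?_, ?_, ?_⟩
  · intro i hi
    rcases Finset.mem_union.1 hi with hi | hi
    · exact h.sub i hi
    · rw [Finset.mem_Ico] at hi; omega
  · intro i hi
    by_cases hX : i ∈ X
    · simp [hX, h.partner_mem hX, h.inv i hX]
    · simp [hX]
  · intro i hi
    by_cases hX : i ∈ X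
    · simp [hX, h.partner_mem hX, h.col i hX]
    · simp [hX]
  · intro i hi j hj
    by_cases hX : i ∈ X
    · rw [seg_congr (p := p) (by simp [hX])] at hj ⊢
      have h1 := h.closed i hX j hj
      simp only [h1.1, if_true]
      exact ⟨by simp [h1.1], h1.2⟩
    · have e : j = i := by
        rw [mem_seg] at hj
        simp only [hX, if_false] at hj
        omega
      subst e
      exact ⟨hi, by simp only [hX, if_false]; exact self_mem_seg _ _⟩
  · rintro i hi hi' ⟨h1, h2, h3, h4⟩
    have hX : i ∈ X := by by_contra hX; simp [hX] at h1
    simp only [hX, if_true] at h1 h2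
    by_cases hX' : i + 1 ∈ X
    · simp only [hX', if_true] at h3 h4
      exact h.trans i hX hX' ⟨h1, h2, h3, h4⟩
    · have hm : i + 1 ∈ Finset.Ico v b := by simpa [hX'] using hi'
      rw [Finset.mem_Ico] at hm
      have := hC (i + 1) hm.1 hm.2 hX' (by simpa using hX)
      simp [h1] at this
  · intro ha
    have hX : a ∈ X := by
      rcases Finset.mem_union.1 ha with hi | hi
      · exact hi
      · rw [Finset.mem_Ico] at hi; omega
    simp [hX, h.left hX]
  · intro hb
    by_cases hX : b - 1 ∈ X
    · simp [hX, h.right hX]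
    · simp [hX]

/-- If enough positions are free before each free position that follows a red one, the free
positions in `[v, b)` can be coloured blue, with few of them in nontrivial pairs. -/
theorem Good.fill_right {a b v : ℤ} (hav : a < v) (n : ℕ) : ∀ {X c p}, Good a b X c p →
    ((Finset.Ico v b).filter fun f => f ∉ X ∧ f - 1 ∈ X ∧ c (f - 1) = true).card ≤ n →
    (∀ f, v ≤ f → f < b → f ∉ X → f - 1 ∈ X → c (f - 1) = true →
      2 * n ≤ (Finset.Ico v f \ X).card) →
    ∃ (c' : ℤ → Bool) (p' : ℤ → ℤ) (U : Finset ℤ), (∀ i ∈ X, c' i = c i ∧ p' i = p i) ∧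
      Good a b (X ∪ Finset.Ico v b) c' p' ∧ U.card ≤ 2 * n ∧
      ∀ i ∈ Finset.Ico v b, i ∉ X → p' i = i ∨ seg p' i ⊆ X ∪ U := by
  have triv : ∀ {n : ℕ} {X c p}, Good a b X c p →
      (∀ f, v ≤ f → f < b → f ∉ X → f - 1 ∈ X → c (f - 1) = false) →
      ∃ (c' : ℤ → Bool) (p' : ℤ → ℤ) (U : Finset ℤ), (∀ i ∈ X, c' i = c i ∧ p' i = p i) ∧
      Good a b (X ∪ Finset.Ico v b) c' p' ∧ U.card ≤ 2 * n ∧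
      ∀ i ∈ Finset.Ico v b, i ∉ X → p' i = i ∨ seg p' i ⊆ X ∪ U := by
    intro n X c p h hC
    exact ⟨_, _, ∅, fun i hi => by simp [hi], h.fill_trivial hav hC, by simp,
      fun i _ hX => Or.inl (by simp [hX])⟩
  induction n with
  | zero =>
    intro X c p h hn _
    refine triv h fun f h1 h2 h3 h4 => ?_
    rw [Nat.le_zero, Finset.card_eq_zero, Finset.filter_eq_empty_iff] at hn
    have := hn (Finset.mem_Ico.2 ⟨h1, h2⟩)
    simpa [h3, h4] using this
  | succ n ih =>
    intro X c p h hn hfree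
    set C := (Finset.Ico v b).filter fun f => f ∉ X ∧ f - 1 ∈ X ∧ c (f - 1) = true with hCdef
    have hmC : ∀ f, f ∈ C ↔ (v ≤ f ∧ f < b) ∧ f ∉ X ∧ f - 1 ∈ X ∧ c (f - 1) = true := by
      intro f; simp [hCdef]
    rcases C.eq_empty_or_nonempty with hC0 | hCne
    · refine triv h fun f h1 h2 h3 h4 => ?_
      by_contra h5
      have : f ∈ C := (hmC f).2 ⟨⟨h1, h2⟩, h3, h4, by simpa using h5⟩
      simp [hC0] at this
    obtain ⟨f, hfC, hfmin⟩ : ∃ f ∈ C, ∀ g ∈ C, f ≤ g :=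
      ⟨C.min' hCne, C.min'_mem hCne, fun g hg => C.min'_le g hg⟩
    obtain ⟨⟨f1, f2⟩, f3, f4, f5⟩ := (hmC f).1 hfC
    have hcard := hfree f f1 f2 f3 f4 f5
    have hne : (Finset.Ico v f \ X).Nonempty := by
      rw [← Finset.card_pos]; omega
    obtain ⟨o, hoX, homax⟩ : ∃ o ∈ Finset.Ico v f \ X, ∀ g ∈ Finset.Ico v f \ X, g ≤ o :=
      ⟨_, Finset.max'_mem _ hne, fun g hg => Finset.le_max' _ g hg⟩
    rw [Finset.mem_sdiff, Finset.mem_Ico] at hoX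
    obtain ⟨⟨o1, o2⟩, o3⟩ := hoX
    have hred : o - 1 ∈ X → c (o - 1) = false := by
      intro h1
      by_contra h2
      have := hfmin o ((hmC o).2 ⟨⟨o1, by omega⟩, o3, h1, by simpa using h2⟩)
      omega
    have hmid : ∀ j, o < j → j < f → j ∈ X := by
      intro j h1 h2
      by_contra h3
      have := homax j (Finset.mem_sdiff.2 ⟨Finset.mem_Ico.2 ⟨by omega, h2⟩, h3⟩)
      omega
    have hne' : ∀ i ∈ X, i ≠ o ∧ i ≠ f := fun i hi =>
      ⟨fun e => o3 (e ▸ hi), fun e => f3 (e ▸ hi)⟩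
    have hC' : ∀ g, g ∉ insert o (insert f X) → g - 1 ∈ insert o (insert f X) →
        (if g - 1 = o ∨ g - 1 = f then false else c (g - 1)) = true →
        g ∉ X ∧ g - 1 ∈ X ∧ c (g - 1) = true ∧ g ≠ f := by
      intro g h1 h2 h3
      simp only [Finset.mem_insert, not_or] at h1 h2
      split_ifs at h3 with h4
      push Not at h4
      refine ⟨h1.2.2, ?_, h3, h1.2.1⟩
      simpa [h4] using h2
    obtain ⟨c', p', U, g1, g2, g3, g4⟩ := ih (h.insert_pair o2 (by omega) f2 o3 f3 hmid hred) (by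
        refine (Finset.card_le_card (t := C.erase f) ?_).trans ?_
        · intro g hg
          rw [Finset.mem_filter, Finset.mem_Ico] at hg
          obtain ⟨k1, k2, k3, k4⟩ := hg
          have := hC' g k2 k3 k4
          exact Finset.mem_erase.2 ⟨this.2.2.2, (hmC g).2 ⟨k1, this.1, this.2.1, this.2.2.1⟩⟩
        · rw [Finset.card_erase_of_mem hfC]; omega) (by
        intro g k0 k1 k2 k3 k4
        have hg := hC' g k2 k3 k4
        have h1 := hfree g k0 k1 hg.1 hg.2.1 hg.2.2.1
        have h2 : Finset.Ico v g \ X ⊆ insert o (insert f (Finset.Ico v g \ insert o (insert f X))) := by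
          intro x hx
          simp only [Finset.mem_sdiff, Finset.mem_insert] at hx ⊢
          tauto
        have h3 := Finset.card_le_card h2
        have h4 := Finset.card_insert_le o (insert f (Finset.Ico v g \ insert o (insert f X)))
        have h5 := Finset.card_insert_le f (Finset.Ico v g \ insert o (insert f X))
        omega)
    refine ⟨c', p', insert o (insert f U), ?_, ?_, ?_, ?_⟩
    · intro i hi
      have h1 := g1 i (by simp [hi])
      simpa [hne' i hi] using h1
    · convert g2 using 1
      ext x
      simp only [Finset.mem_union, Finset.mem_insert, Finset.mem_Ico]
      constructor
      · tauto
      · rintro ((rfl | rfl | h1) | h1)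
        · right; omega
        · right; omega
        · tauto
        · tauto
    · have h4 := Finset.card_insert_le o (insert f U)
      have h5 := Finset.card_insert_le f U
      omega
    · intro i hi hiX
      have hpair : ∀ x, o ≤ x → x ≤ f → x ∈ X ∪ insert o (insert f U) := by
        intro x h1 h2
        simp only [Finset.mem_union, Finset.mem_insert]
        rcases eq_or_ne x o with e | e
        · tauto
        rcases eq_or_ne x f with e' | e'
        · tauto
        left
        exact hmid x (by omega) (by omega)
      have hfo : f ≠ o := by omega
      by_cases e1 : i = o
      · right
        have h1 := (g1 o (by simp)).2
        simp only [if_true] at h1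
        subst e1
        intro x hx
        rw [mem_seg, h1] at hx
        exact hpair x (by omega) (by omega)
      by_cases e2 : i = f
      · right
        have h1 := (g1 f (by simp)).2
        simp only [if_true, hfo, if_false] at h1
        subst e2
        intro x hx
        rw [mem_seg, h1] at hx
        exact hpair x (by omega) (by omega)
      rcases g4 i hi (by simp [e1, e2, hiX]) with h1 | h1
      · exact Or.inl h1
      · right
        intro x hx
        have := h1 hx
        simp only [Finset.mem_union, Finset.mem_insert] at this ⊢
        tauto

theorem mem_image_neg {X : Finset ℤ} {x : ℤ} : x ∈ X.image Neg.neg ↔ -x ∈ X := by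
  simp only [Finset.mem_image]
  exact ⟨by rintro ⟨y, hy, rfl⟩; simpa using hy, fun hx => ⟨-x, hx, by simp⟩⟩

theorem Good.fill_left {a b u : ℤ} (hub : u < b) (n : ℕ) {X c p} (h : Good a b X c p)
    (hn : ((Finset.Ico a u).filter fun f => f ∉ X ∧ f + 1 ∈ X ∧ c (f + 1) = false).card ≤ n)
    (hfree : ∀ f, a ≤ f → f < u → f ∉ X → f + 1 ∈ X → c (f + 1) = false →
      2 * n ≤ (Finset.Ico (f + 1) u \ X).card) :
    ∃ (c' : ℤ → Bool) (p' : ℤ → ℤ) (U : Finset ℤ), (∀ i ∈ X, c' i = c i ∧ p' i = p i) ∧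
      Good a b (X ∪ Finset.Ico a u) c' p' ∧ U.card ≤ 2 * n ∧
      ∀ i ∈ Finset.Ico a u, i ∉ X → p' i = i ∨ seg p' i ⊆ X ∪ U := by
  obtain ⟨c', p', U, g1, g2, g3, g4⟩ := Good.fill_right (a := 1 - b) (b := 1 - a) (v := 1 - u)
    (by omega) n h.reflect (by
      refine le_trans ?_ hn
      refine Finset.card_le_card_of_injOn Neg.neg ?_ (neg_injective.injOn)
      intro f hf
      simp only [Finset.coe_filter, Finset.mem_Ico, mem_image_neg, Set.mem_ofPred_eq] at hf ⊢
      have e : -(f - 1) = -f + 1 := by ring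
      rw [e] at hf
      exact ⟨by omega, hf.2.1, hf.2.2.1, by simpa using hf.2.2.2⟩) (by
      intro f h1 h2 h3 h4 h5
      rw [mem_image_neg] at h3 h4
      have e : -(f - 1) = -f + 1 := by ring
      rw [e] at h4 h5
      have := hfree (-f) (by omega) (by omega) h3 h4 (by simpa using h5)
      refine this.trans ?_
      refine Finset.card_le_card_of_injOn Neg.neg ?_ (neg_injective.injOn)
      intro x hx
      simp only [Finset.coe_sdiff, Finset.coe_Ico, Set.mem_sdiff, Set.mem_Ico, Finset.mem_coe,
        mem_image_neg, neg_neg] at hx ⊢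
      exact ⟨by omega, hx.2⟩)
  refine ⟨fun x => !c' (-x), fun x => -p' (-x), U.image Neg.neg, ?_, ?_, ?_, ?_⟩
  · intro i hi
    have := g1 (-i) (mem_image_neg.2 (by simpa using hi))
    simp [this.1, this.2]
  · have := g2.reflect
    rw [sub_sub_cancel, sub_sub_cancel] at this
    convert this using 1
    ext x
    simp only [Finset.mem_union, Finset.mem_Ico, mem_image_neg, neg_neg]
    refine or_congr Iff.rfl ?_
    omega
  · exact Finset.card_image_le.trans g3
  · intro i hi hX
    rw [Finset.mem_Ico] at hi
    rcases g4 (-i) (Finset.mem_Ico.2 (by omega)) (by rw [mem_image_neg]; simpa using hX) with h1 | h1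
    · left
      simp [h1]
    · right
      intro x hx
      have h2 := @h1 (-x) (by rw [mem_seg] at *; omega)
      rw [Finset.mem_union, mem_image_neg] at h2 ⊢
      simpa using h2

/-- A state that is far from `[u, v)` extends to a total assignment outside `[u, v)` with few
new nontrivial pairs. -/
theorem Good.fill {a b u v : ℤ} {k : ℕ} {K : Finset ℤ} {c p} (h : Good a b (Paper.cov p K) c p)
    (hk : K.card ≤ k) (hau : a ≤ u) (huv : u < v) (hvb : v ≤ b)
    (hfar : ∀ i ∈ Paper.cov p K, i < u - 2 * k - 1 ∨ v + 2 * k < i) :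
    ∃ (c' : ℤ → Bool) (p' : ℤ → ℤ) (U : Finset ℤ),
      (∀ i ∈ Paper.cov p K, c' i = c i ∧ p' i = p i) ∧
      Good a b (Finset.Ico a b \ Finset.Ico u v) c' p' ∧ U.card ≤ 4 * k ∧
      ∀ i ∈ Finset.Ico a b \ Finset.Ico u v, i ∉ Paper.cov p K →
        p' i = i ∨ seg p' i ⊆ Paper.cov p K ∪ U := by
  set X := Paper.cov p K with hX
  obtain ⟨c1, p1, U1, g1, g2, g3, g4⟩ := h.fill_right (v := v) (by omega) k (by
      refine (Finset.card_le_card (t := K.image fun i => max i (p i) + 1) ?_).trans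
        (Finset.card_image_le.trans hk)
      intro f hf
      rw [Finset.mem_filter] at hf
      obtain ⟨i, hi, hfi⟩ := mem_cov.1 hf.2.2.1
      have hf' : f ∉ seg p i := fun hx => hf.2.1 (mem_cov.2 ⟨i, hi, hx⟩)
      refine Finset.mem_image.2 ⟨i, hi, ?_⟩
      rw [mem_seg] at hfi hf'
      omega) (by
      intro f h1 h2 h3 h4 h5
      have := hfar _ h4
      have hs : Finset.Ico v (v + 2 * k) ⊆ Finset.Ico v f \ X := by
        intro x hx
        rw [Finset.mem_Ico] at hx
        rw [Finset.mem_sdiff, Finset.mem_Ico]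
        refine ⟨by omega, fun hx' => ?_⟩
        have := hfar x hx'
        omega
      have := Finset.card_le_card hs
      rw [Int.card_Ico] at this
      omega)
  obtain ⟨c2, p2, U2, e1, e2, e3, e4⟩ := g2.fill_left (u := u) (by omega) k (by
      refine (Finset.card_le_card (t := K.image fun i => min i (p i) - 1) ?_).trans
        (Finset.card_image_le.trans hk)
      intro f hf
      rw [Finset.mem_filter, Finset.mem_Ico] at hf
      obtain ⟨f0, f1, f2, _⟩ := hf
      have f3 : f ∉ X := fun hx => f1 (Finset.mem_union_left _ hx)
      have f4 : f + 1 ∈ X := by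
        rcases Finset.mem_union.1 f2 with hx | hx
        · exact hx
        · rw [Finset.mem_Ico] at hx; omega
      obtain ⟨i, hi, hfi⟩ := mem_cov.1 f4
      have hf' : f ∉ seg p i := fun hx => f3 (mem_cov.2 ⟨i, hi, hx⟩)
      refine Finset.mem_image.2 ⟨i, hi, ?_⟩
      rw [mem_seg] at hfi hf'
      omega) (by
      intro f f0 f0' f1 f2 _
      have f4 : f + 1 ∈ X := by
        rcases Finset.mem_union.1 f2 with hx | hx
        · exact hx
        · rw [Finset.mem_Ico] at hx; omega
      have := hfar _ f4
      have hs : Finset.Ico (u - 2 * k) u ⊆ Finset.Ico (f + 1) u \ (X ∪ Finset.Ico v b) := by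
        intro x hx
        rw [Finset.mem_Ico] at hx
        rw [Finset.mem_sdiff, Finset.mem_union, Finset.mem_Ico, Finset.mem_Ico]
        refine ⟨by omega, ?_⟩
        rintro (hx' | hx')
        · have := hfar x hx'
          omega
        · omega
      have := Finset.card_le_card hs
      rw [Int.card_Ico] at this
      omega)
  have hset : X ∪ Finset.Ico v b ∪ Finset.Ico a u = Finset.Ico a b \ Finset.Ico u v := by
    ext x
    simp only [Finset.mem_union, Finset.mem_sdiff, Finset.mem_Ico]
    constructor
    · rintro ((hx | hx) | hx)
      · have := hfar x hx
        have := h.sub x hx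
        omega
      · omega
      · omega
    · intro hx
      by_cases hv : v ≤ x
      · exact Or.inl (Or.inr (by omega))
      · exact Or.inr (by omega)
  rw [hset] at e2
  refine ⟨c2, p2, U1 ∪ U2, ?_, e2, ?_, ?_⟩
  · intro i hi
    rw [(e1 i (Finset.mem_union_left _ hi)).1, (e1 i (Finset.mem_union_left _ hi)).2]
    exact g1 i hi
  · have := Finset.card_union_le U1 U2
    omega
  · intro i hi hiX
    rw [← hset] at hi
    by_cases hv : i ∈ Finset.Ico v b
    · have h1 := e1 i (Finset.mem_union_right _ hv)
      rw [h1.2, seg_congr h1.2]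
      rcases g4 i hv hiX with h2 | h2
      · exact Or.inl h2
      · right
        intro x hx
        have := h2 hx
        simp only [Finset.mem_union] at this ⊢
        tauto
    · have hi' : i ∈ Finset.Ico a u := by
        simp only [Finset.mem_union] at hi; tauto
      rcases e4 i hi' (by simp only [Finset.mem_union]; tauto) with h2 | h2
      · exact Or.inl h2
      · right
        have hiu := (Finset.mem_Ico.1 hi').2
        have hun : u ∉ seg p2 i := by
          intro hu
          have hm : i ∈ Finset.Ico a b \ Finset.Ico u v := by rw [← hset]; exact hi
          have := (e2.closed i hm u hu).1
          rw [Finset.mem_sdiff, Finset.mem_Ico, Finset.mem_Ico] at this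
          omega
        intro x hx
        have h3 := h2 hx
        have hxv : x ∉ Finset.Ico v b := by
          rw [Finset.mem_Ico]
          rw [mem_seg] at hx hun
          omega
        simp only [Finset.mem_union] at h3 ⊢
        tauto

/-! ### The recursive adversary -/

/-- Invariant of the recursive adversary on `[a, b)`. The game inside the active interval
`[u, u + J)` can go on for `t` rounds; outside of it everything is already fixed, and all
nontrivial pairs lie in the small set `E` together with the former active intervals, whose
starting points form the well-separated set `S`. The active interval can still be moved
`r` times. -/
structure Inv (a b : ℤ) (k J L r t : ℕ) (X : Finset ℤ) (c : ℤ → Bool) (p : ℤ → ℤ)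
    (u : ℤ) (S E : Finset ℤ) : Prop where
  le_left : a ≤ u
  le_right : u + J ≤ b
  outer : Good a b (Finset.Ico a b \ Finset.Ico u (u + J)) c p
  sub : X ⊆ Finset.Ico a b
  closed : ∀ i ∈ X, seg p i ⊆ X
  inner : Surv u (u + J) k t (X ∩ Finset.Ico u (u + J)) c p
  mem : u ∈ S
  sep : ∀ s ∈ S, ∀ s' ∈ S, s < s' → s + J + L < s'
  card : E.card + 5 * k * r ≤ L
  supp : ∀ i ∈ Finset.Ico a b \ Finset.Ico u (u + J),
    p i = i ∨ seg p i ⊆ E ∪ S.biUnion fun s => Finset.Ico s (s + J)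

section

variable {a b : ℤ} {k J L r t : ℕ} {X : Finset ℤ} {c : ℤ → Bool} {p : ℤ → ℤ} {u : ℤ}
  {S E : Finset ℤ}

theorem Inv.mem_outer (h : Inv a b k J L r t X c p u S E) {i : ℤ} (hi : i ∈ X)
    (hI : i ∉ Finset.Ico u (u + J)) : i ∈ Finset.Ico a b \ Finset.Ico u (u + J) :=
  Finset.mem_sdiff.2 ⟨h.sub hi, hI⟩

theorem Inv.mem_inner {i : ℤ} (hi : i ∈ X) (hI : i ∈ Finset.Ico u (u + J)) :
    i ∈ X ∩ Finset.Ico u (u + J) :=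
  Finset.mem_inter.2 ⟨hi, hI⟩

theorem Inv.good (h : Inv a b k J L r t X c p u S E) : Good a b X c p := by
  have hin := h.inner.good
  have hu := h.le_left
  have hv := h.le_right
  refine ⟨?_, ?_, ?_, ?_, ?_, ?_, ?_⟩
  · intro i hi
    simpa using h.sub hi
  · intro i hi
    by_cases hI : i ∈ Finset.Ico u (u + J)
    · exact hin.inv i (mem_inner hi hI)
    · exact h.outer.inv i (h.mem_outer hi hI)
  · intro i hi
    by_cases hI : i ∈ Finset.Ico u (u + J)
    · exact hin.col i (mem_inner hi hI)
    · exact h.outer.col i (h.mem_outer hi hI)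
  · intro i hi j hj
    refine ⟨h.closed i hi hj, ?_⟩
    by_cases hI : i ∈ Finset.Ico u (u + J)
    · exact (hin.closed i (mem_inner hi hI) j hj).2
    · exact (h.outer.closed i (h.mem_outer hi hI) j hj).2
  · intro i hi hi' hcon
    by_cases hI : i ∈ Finset.Ico u (u + J)
    · by_cases hI' : i + 1 ∈ Finset.Ico u (u + J)
      · exact hin.trans i (mem_inner hi hI) (mem_inner hi' hI') hcon
      · rw [Finset.mem_Ico] at hI hI'
        have e : i = u + J - 1 := by omega
        have := hin.right (e ▸ mem_inner hi (Finset.mem_Ico.2 hI))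
        rw [← e] at this
        simp [this] at hcon
    · by_cases hI' : i + 1 ∈ Finset.Ico u (u + J)
      · rw [Finset.mem_Ico] at hI hI'
        have e : i + 1 = u := by omega
        have hm := mem_inner hi' (Finset.mem_Ico.2 hI')
        rw [e] at hm hcon
        simp [hin.left hm] at hcon
      · exact h.outer.trans i (h.mem_outer hi hI) (h.mem_outer hi' hI') hcon
  · intro hi
    by_cases hI : a ∈ Finset.Ico u (u + J)
    · have e : a = u := by rw [Finset.mem_Ico] at hI; omega
      have hm := mem_inner hi hI
      rw [e] at hm ⊢
      exact hin.left hm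
    · exact h.outer.left (h.mem_outer hi hI)
  · intro hi
    by_cases hI : b - 1 ∈ Finset.Ico u (u + J)
    · have e : b - 1 = u + J - 1 := by rw [Finset.mem_Ico] at hI; omega
      have := hin.right (e ▸ mem_inner hi hI)
      rwa [← e] at this
    · exact h.outer.right (h.mem_outer hi hI)

theorem Inv.seg_inner (h : Inv a b k J L r t X c p u S E) {i : ℤ} (hi : i ∈ X)
    (hI : i ∈ Finset.Ico u (u + J)) : seg p i ⊆ Finset.Ico u (u + J) := fun j hj =>
  (Finset.mem_inter.1 (h.inner.good.closed i (mem_inner hi hI) j hj).1).2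

theorem Inv.seg_outer (h : Inv a b k J L r t X c p u S E) {i j : ℤ}
    (hi : i ∈ Finset.Ico a b \ Finset.Ico u (u + J)) (hj : j ∈ seg p i) :
    j ∉ Finset.Ico u (u + J) :=
  (Finset.mem_sdiff.1 (h.outer.closed i hi j hj).1).2

theorem Inv.cov_inter (h : Inv a b k J L r t X c p u S E) {K : Finset ℤ} (hK : K ⊆ X) :
    cov p K ∩ Finset.Ico u (u + J) = cov p (K ∩ Finset.Ico u (u + J)) := by
  ext j
  rw [Finset.mem_inter, mem_cov, mem_cov]
  constructor
  · rintro ⟨⟨i, hi, hj⟩, hI⟩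
    by_cases hI' : i ∈ Finset.Ico u (u + J)
    · exact ⟨i, Finset.mem_inter.2 ⟨hi, hI'⟩, hj⟩
    · exact absurd hI (h.seg_outer (h.mem_outer (hK hi) hI') hj)
  · rintro ⟨i, hi, hj⟩
    rw [Finset.mem_inter] at hi
    exact ⟨⟨i, hi.1, hj⟩, h.seg_inner (hK hi.1) hi.2 hj⟩

theorem Inv.answer (h : Inv a b k J L r (t + 1) X c p u S E) {K : Finset ℤ} (hK : K ⊆ X)
    (hk : K.card ≤ k) {q : ℤ} (haq : a ≤ q) (hqb : q < b) :
    ∃ (c' : ℤ → Bool) (p' : ℤ → ℤ), (∀ i ∈ cov p K, c' i = c i ∧ p' i = p i) ∧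
      Inv a b k J L r t (cov p K ∪ seg p' q) c' p' u S E := by
  have hg := h.good
  have hKI : K ∩ Finset.Ico u (u + J) ⊆ X ∩ Finset.Ico u (u + J) :=
    Finset.inter_subset_inter_right hK
  by_cases hq : q ∈ Finset.Ico u (u + J)
  · obtain ⟨c1, p1, h1, h2⟩ := h.inner.2 _ hKI
      ((Finset.card_le_card Finset.inter_subset_left).trans hk) q
      (Finset.mem_Ico.1 hq).1 (Finset.mem_Ico.1 hq).2
    have hg2 := h2.good
    have hqI : seg p1 q ⊆ Finset.Ico u (u + J) := fun j hj =>
      Finset.mem_Ico.2 (hg2.sub j (Finset.mem_union_right _ hj))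
    have hagree : ∀ i ∈ cov p K,
        (if i ∈ Finset.Ico u (u + J) then c1 i else c i) = c i ∧
        (if i ∈ Finset.Ico u (u + J) then p1 i else p i) = p i := by
      intro i hi
      by_cases hI : i ∈ Finset.Ico u (u + J)
      · rw [if_pos hI, if_pos hI]
        exact h1 i (h.cov_inter hK ▸ Finset.mem_inter.2 ⟨hi, hI⟩)
      · rw [if_neg hI, if_neg hI]; exact ⟨rfl, rfl⟩
    have hseg : seg (fun i => if i ∈ Finset.Ico u (u + J) then p1 i else p i) q = seg p1 q :=
      seg_congr (if_pos hq)
    refine ⟨fun i => if i ∈ Finset.Ico u (u + J) then c1 i else c i,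
      fun i => if i ∈ Finset.Ico u (u + J) then p1 i else p i, hagree, h.le_left, h.le_right,
      ?_, ?_, ?_, ?_, h.mem, h.sep, h.card, ?_⟩
    · refine h.outer.congr fun i hi => ?_
      have hI := (Finset.mem_sdiff.1 hi).2
      rw [if_neg hI, if_neg hI]; exact ⟨rfl, rfl⟩
    · rw [hseg]
      refine Finset.union_subset ((hg.cov_subset hK).trans h.sub) (hqI.trans ?_)
      exact Finset.Ico_subset_Ico h.le_left h.le_right
    · intro i hi
      rw [hseg] at hi ⊢
      rcases Finset.mem_union.1 hi with hi | hi
      · rw [seg_congr (hagree i hi).2]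
        exact (hg.seg_subset_cov hK hi).trans Finset.subset_union_left
      · have e : (fun i => if i ∈ Finset.Ico u (u + J) then p1 i else p i) i = p1 i :=
          if_pos (hqI hi)
        rw [seg_congr e]
        exact (hg2.seg_subset (Finset.mem_union_right _ (self_mem_seg p1 q)) hi).trans
          Finset.subset_union_right
    · rw [hseg, Finset.union_inter_distrib_right, h.cov_inter hK,
        Finset.inter_eq_left.2 hqI]
      refine h2.congr fun i hi => ?_
      have hI : i ∈ Finset.Ico u (u + J) := Finset.mem_Ico.2 (hg2.sub i hi)
      rw [if_pos hI, if_pos hI]; exact ⟨rfl, rfl⟩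
    · intro i hi
      have hI := (Finset.mem_sdiff.1 hi).2
      have e : (fun i => if i ∈ Finset.Ico u (u + J) then p1 i else p i) i = p i := if_neg hI
      rw [seg_congr e, if_neg hI]
      exact h.supp i hi
  · have hqo : q ∈ Finset.Ico a b \ Finset.Ico u (u + J) :=
      Finset.mem_sdiff.2 ⟨Finset.mem_Ico.2 ⟨haq, hqb⟩, hq⟩
    refine ⟨c, p, fun _ _ => ⟨rfl, rfl⟩, h.le_left, h.le_right, h.outer, ?_, ?_, ?_, h.mem,
      h.sep, h.card, h.supp⟩
    · refine Finset.union_subset ((hg.cov_subset hK).trans h.sub) fun j hj => ?_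
      exact (Finset.mem_sdiff.1 (h.outer.closed q hqo j hj).1).1
    · intro i hi
      rcases Finset.mem_union.1 hi with hi | hi
      · exact (hg.seg_subset_cov hK hi).trans Finset.subset_union_left
      · exact (h.outer.seg_subset hqo hi).trans Finset.subset_union_right
    · have e : seg p q ∩ Finset.Ico u (u + J) = ∅ := by
        rw [← Finset.disjoint_iff_inter_eq_empty, Finset.disjoint_left]
        exact fun j hj => h.seg_outer hqo hj
      rw [Finset.union_inter_distrib_right, e, Finset.union_empty, h.cov_inter hK]
      exact (h.inner.cov hKI).pred

theorem card_Ico_le {x y : ℤ} {E : Finset ℤ} (h : Finset.Ico x y ⊆ E) : y - x ≤ E.card := by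
  have := Finset.card_le_card h
  rw [Int.card_Ico] at this
  omega

/-- A stretch of determined positions meets at most one former active interval. -/
theorem Inv.core_unique (h : Inv a b k J L r t X c p u S E) {i x y s s' : ℤ} (hi : i ∈ X)
    (hs : s ∈ S) (hs' : s' ∈ S) (hx : x ∈ seg p i) (hy : y ∈ seg p i)
    (hxs : x ∈ Finset.Ico s (s + J)) (hys : y ∈ Finset.Ico s' (s' + J)) : ¬ s < s' := by
  intro hlt
  have hsep := h.sep s hs s' hs' hlt
  have hcard := h.card
  rw [Finset.mem_Ico] at hxs hys
  by_cases hI : i ∈ Finset.Ico u (u + J)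
  · have h1 := Finset.mem_Ico.1 (h.seg_inner hi hI hx)
    have h2 := Finset.mem_Ico.1 (h.seg_inner hi hI hy)
    rcases lt_trichotomy s u with h3 | h3 | h3
    · have := h.sep s hs u h.mem h3; omega
    · subst h3; omega
    · have := h.sep u h.mem s hs h3; omega
  · rcases h.supp i (h.mem_outer hi hI) with e | hsub
    · rw [mem_seg, e] at hx hy; omega
    · have hE : Finset.Ico (s + J) (s + J + L + 1) ⊆ E := by
        intro z hz
        rw [Finset.mem_Ico] at hz
        have hzs : z ∈ seg p i := by rw [mem_seg] at *; omega
        rcases Finset.mem_union.1 (hsub hzs) with hz' | hz'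
        · exact hz'
        obtain ⟨s2, hs2, hz2⟩ := Finset.mem_biUnion.1 hz'
        rw [Finset.mem_Ico] at hz2
        rcases lt_trichotomy s s2 with h3 | h3 | h3
        · have := h.sep s hs s2 hs2 h3; omega
        · subst h3; omega
        · omega
      have := card_Ico_le hE
      have : (0 : ℤ) ≤ 5 * k * r := by positivity
      omega

/-- The former active intervals that still contain determined positions. -/
noncomputable def usedCores (J : ℕ) (S X : Finset ℤ) : Finset ℤ :=
  S.filter fun s => (Finset.Ico s (s + J) ∩ X).Nonempty

theorem mem_usedCores {s x : ℤ} (hs : s ∈ S) (hx : x ∈ X) (hxs : x ∈ Finset.Ico s (s + J)) :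
    s ∈ usedCores J S X :=
  Finset.mem_filter.2 ⟨hs, x, Finset.mem_inter.2 ⟨hxs, hx⟩⟩

theorem Inv.card_usedCores (h : Inv a b k J L r t X c p u S E) {K : Finset ℤ} (hK : K ⊆ X) :
    (usedCores J S (cov p K)).card ≤ K.card := by
  refine Finset.card_le_card_of_forall_subsingleton
    (fun (s i : ℤ) => ∃ x ∈ seg p i, x ∈ Finset.Ico s (s + J)) ?_ ?_
  · intro s hs
    obtain ⟨x, hx⟩ := (Finset.mem_filter.1 hs).2
    rw [Finset.mem_inter] at hx
    obtain ⟨i, hi, hxi⟩ := mem_cov.1 hx.2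
    exact ⟨i, hi, x, hxi, hx.1⟩
  · rintro i hi s ⟨hs, x, hx, hxs⟩ s' ⟨hs', y, hy, hys⟩
    have hs := (Finset.mem_filter.1 hs).1
    have hs' := (Finset.mem_filter.1 hs').1
    exact le_antisymm (not_lt.1 (h.core_unique (hK hi) hs' hs hy hx hys hxs))
      (not_lt.1 (h.core_unique (hK hi) hs hs' hx hy hxs hys))

theorem Inv.cov_subset (h : Inv a b k J L r t X c p u S E) {K : Finset ℤ} (hK : K ⊆ X) :
    cov p K ⊆ E ∪ K ∪ (usedCores J S (cov p K)).biUnion fun s => Finset.Ico s (s + J) := by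
  intro x hx
  obtain ⟨i, hi, hxi⟩ := mem_cov.1 hx
  simp only [Finset.mem_union, Finset.mem_biUnion]
  by_cases hI : i ∈ Finset.Ico u (u + J)
  · have hxI := h.seg_inner (hK hi) hI hxi
    exact Or.inr ⟨u, mem_usedCores h.mem hx hxI, hxI⟩
  rcases h.supp i (h.mem_outer (hK hi) hI) with e | hsub
  · have e' : x = i := by rw [mem_seg, e] at hxi; omega
    exact Or.inl (Or.inr (e' ▸ hi))
  · rcases Finset.mem_union.1 (hsub hxi) with hz | hz
    · exact Or.inl (Or.inl hz)
    · obtain ⟨s, hs, hxs⟩ := Finset.mem_biUnion.1 hz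
      exact Or.inr ⟨s, mem_usedCores hs hx hxs, hxs⟩

theorem Inv.cov_near (h : Inv a b k J L r t X c p u S E) (hJ : 1 ≤ J) {K : Finset ℤ}
    (hK : K ⊆ X) {x : ℤ} (hx : x ∈ cov p K) :
    ∃ f ∈ usedCores J S (cov p K) ∪ K.image fun i => min i (p i), f - L ≤ x ∧ x < f + J + L := by
  obtain ⟨i, hi, hxi⟩ := mem_cov.1 hx
  have hcard := h.card
  have hnn : (0 : ℤ) ≤ 5 * k * r := by positivity
  simp only [Finset.mem_union, Finset.mem_image]
  by_cases hI : i ∈ Finset.Ico u (u + J)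
  · have hxI := h.seg_inner (hK hi) hI hxi
    refine ⟨u, Or.inl (mem_usedCores h.mem hx hxI), ?_⟩
    rw [Finset.mem_Ico] at hxI
    omega
  rcases h.supp i (h.mem_outer (hK hi) hI) with e | hsub
  · refine ⟨_, Or.inr ⟨i, hi, rfl⟩, ?_⟩
    rw [mem_seg] at hxi
    omega
  by_cases hcore : ∃ y ∈ seg p i, ∃ s ∈ S, y ∈ Finset.Ico s (s + J)
  · obtain ⟨y, hy, s, hs, hys⟩ := hcore
    have hE : ∀ z ∈ seg p i, z ∉ Finset.Ico s (s + J) → z ∈ E := by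
      intro z hz hzs
      rcases Finset.mem_union.1 (hsub hz) with hz' | hz'
      · exact hz'
      obtain ⟨s', hs', hzs'⟩ := Finset.mem_biUnion.1 hz'
      have : s = s' := le_antisymm
        (not_lt.1 (h.core_unique (hK hi) hs' hs hz hy hzs' hys))
        (not_lt.1 (h.core_unique (hK hi) hs hs' hy hz hys hzs'))
      subst this
      exact absurd hzs' hzs
    refine ⟨s, Or.inl (mem_usedCores hs (mem_cov.2 ⟨i, hi, hy⟩) hys), ?_⟩
    rw [Finset.mem_Ico] at hys
    constructor
    · by_contra hlt
      have : Finset.Ico x s ⊆ E := by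
        intro z hz
        rw [Finset.mem_Ico] at hz
        refine hE z ?_ (by rw [Finset.mem_Ico]; omega)
        rw [mem_seg] at *; omega
      have := card_Ico_le this
      omega
    · by_contra hlt
      have : Finset.Ico (s + J) (x + 1) ⊆ E := by
        intro z hz
        rw [Finset.mem_Ico] at hz
        refine hE z ?_ (by rw [Finset.mem_Ico]; omega)
        rw [mem_seg] at *; omega
      have := card_Ico_le this
      omega
  · refine ⟨_, Or.inr ⟨i, hi, rfl⟩, ?_⟩
    have : Finset.Ico (min i (p i)) (x + 1) ⊆ E := by
      intro z hz
      rw [Finset.mem_Ico] at hz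
      have hz' : z ∈ seg p i := by rw [mem_seg] at *; omega
      rcases Finset.mem_union.1 (hsub hz') with hz2 | hz2
      · exact hz2
      obtain ⟨s, hs, hzs⟩ := Finset.mem_biUnion.1 hz2
      exact absurd ⟨z, hz', s, hs, hzs⟩ hcore
    have := card_Ico_le this
    rw [mem_seg] at hxi
    omega

theorem exists_far (F : Finset ℤ) (a : ℤ) (m D : ℕ) (hF : F.card ≤ m) :
    ∃ u, a ≤ u ∧ u ≤ a + m * (2 * D + 1) ∧ ∀ f ∈ F, u + D < f ∨ f + D < u := by
  by_contra hcon
  push Not at hcon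
  have hle : (Finset.range (m + 1)).card ≤ F.card := by
    refine Finset.card_le_card_of_forall_subsingleton
      (fun (j : ℕ) f => f ≤ a + j * (2 * D + 1) + D ∧ a + j * (2 * D + 1) ≤ f + D) ?_ ?_
    · intro j hj
      rw [Finset.mem_range] at hj
      have h1 : (j : ℤ) * (2 * D + 1) ≤ m * (2 * D + 1) := by
        have : (j : ℤ) ≤ m := by omega
        gcongr
      have h2 : (0 : ℤ) ≤ j * (2 * D + 1) := by positivity
      obtain ⟨f, hf, h3⟩ := hcon (a + j * (2 * D + 1)) (by omega) (by omega)
      exact ⟨f, hf, h3⟩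
    · rintro f _ j ⟨_, h1, h2⟩ j' ⟨_, h3, h4⟩
      have key : ∀ x y : ℕ, f ≤ a + x * (2 * D + 1) + D → a + y * (2 * D + 1) ≤ f + D →
          y ≤ x := by
        intro x y hx hy
        by_contra hlt
        have h5 : ((x : ℤ) + 1) * (2 * D + 1) ≤ y * (2 * D + 1) := by
          have : (x : ℤ) + 1 ≤ y := by omega
          gcongr
        nlinarith
      exact le_antisymm (key j' j h3 h2) (key j j' h1 h4)
  rw [Finset.card_range] at hle
  omega

theorem Inv.shift {T : ℕ} (h : Inv a b k J L (r + 1) t X c p u S E) (hJ : 1 ≤ J)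
    (ih : ∀ u c p, Surv u (u + J) k T ∅ c p)
    (hab : a + (2 * k + 1) * (2 * (J + L + 2 * k) + 1) ≤ b) {K : Finset ℤ} (hK : K ⊆ X)
    (hk : K.card ≤ k) :
    ∃ (c' : ℤ → Bool) (p' : ℤ → ℤ) (u' : ℤ) (S' E' : Finset ℤ),
      (∀ i ∈ cov p K, c' i = c i ∧ p' i = p i) ∧
      Inv a b k J L r T (cov p K) c' p' u' S' E' := by
  have hg := h.good
  have hcK := hg.cov_subset hK
  have hcard := h.card
  set P := usedCores J S (cov p K) with hP
  obtain ⟨u', hu1, hu2, hu3⟩ := exists_far (P ∪ K.image fun i => min i (p i)) a (2 * k)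
    (J + L + 2 * k) (by
      have h1 := Finset.card_union_le P (K.image fun i => min i (p i))
      have h2 : P.card ≤ K.card := h.card_usedCores hK
      have h3 : (K.image fun i => min i (p i)).card ≤ K.card := Finset.card_image_le
      omega)
  push_cast at hu2 hu3
  have hub : u' + J ≤ b := by
    have : (2 * (k : ℤ) + 1) * (2 * (J + L + 2 * k) + 1) =
      2 * k * (2 * (J + L + 2 * k) + 1) + (2 * (J + L + 2 * k) + 1) := by ring
    omega
  have hfar : ∀ i ∈ cov p K, i < u' - 2 * k - 1 ∨ u' + J + 2 * k < i := by
    intro i hi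
    obtain ⟨f, hf, h1, h2⟩ := h.cov_near hJ hK hi
    have := hu3 f hf
    omega
  have hPS : ∀ s ∈ P, s ∈ S ∧ (u' + (J + L) < s ∨ s + (J + L) < u') := by
    intro s hs
    have := hu3 s (Finset.mem_union_left _ hs)
    exact ⟨(Finset.mem_filter.1 hs).1, by omega⟩
  obtain ⟨c', p', U, g1, g2, g3, g4⟩ := (hg.cov hK).fill (k := k) (u := u') (v := u' + J) hk hu1
    (by omega) hub hfar
  have hcs : cov p K ⊆ (E ∪ K ∪ U) ∪ (insert u' P).biUnion fun s => Finset.Ico s (s + J) := by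
    intro x hx
    have := h.cov_subset hK hx
    simp only [Finset.mem_union, Finset.mem_biUnion, Finset.mem_insert] at this ⊢
    rcases this with h1 | ⟨s, hs, h1⟩
    · tauto
    · exact Or.inr ⟨s, Or.inr hs, h1⟩
  refine ⟨c', p', u', insert u' P, E ∪ K ∪ U, g1, hu1, hub, g2, hcK.trans h.sub, ?_, ?_,
    Finset.mem_insert_self _ _, ?_, ?_, ?_⟩
  · intro i hi
    rw [seg_congr (g1 i hi).2]
    exact hg.seg_subset_cov hK hi
  · have e : cov p K ∩ Finset.Ico u' (u' + J) = ∅ := by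
      rw [← Finset.disjoint_iff_inter_eq_empty, Finset.disjoint_left]
      intro j hj hj'
      have := hfar j hj
      rw [Finset.mem_Ico] at hj'
      omega
    rw [e]
    exact ih _ _ _
  · intro s hs s' hs' hlt
    rcases Finset.mem_insert.1 hs with e | hsP
    · rcases Finset.mem_insert.1 hs' with e' | hsP'
      · omega
      · have := hPS s' hsP'; omega
    · rcases Finset.mem_insert.1 hs' with e' | hsP'
      · have := hPS s hsP; omega
      · exact h.sep s (hPS s hsP).1 s' (hPS s' hsP').1 hlt
  · have h1 := Finset.card_union_le (E ∪ K) U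
    have h2 := Finset.card_union_le E K
    have h3 : 5 * k * (r + 1) = 5 * k * r + 5 * k := by ring
    omega
  · intro i hi
    by_cases hc : i ∈ cov p K
    · right
      rw [seg_congr (g1 i hc).2]
      exact (hg.seg_subset_cov hK hc).trans hcs
    · rcases g4 i hi hc with h1 | h1
      · exact Or.inl h1
      · right
        refine h1.trans (Finset.union_subset hcs ?_)
        exact Finset.subset_union_right.trans Finset.subset_union_left

theorem Inv.surv {T : ℕ} (hJ : 1 ≤ J) (hT : 1 ≤ T) (ih : ∀ u c p, Surv u (u + J) k T ∅ c p)
    (hab : a + (2 * k + 1) * (2 * (J + L + 2 * k) + 1) ≤ b) (τ : ℕ) :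
    ∀ {r t X c p u S E}, τ ≤ r * T + t → Inv a b k J L r t X c p u S E →
      Surv a b k τ X c p := by
  induction τ with
  | zero => exact fun _ h => h.good
  | succ τ hτ =>
    intro r t X c p u S E hle h
    refine ⟨h.good, fun K hK hk q hq1 hq2 => ?_⟩
    cases t with
    | succ t =>
      obtain ⟨c', p', h1, h2⟩ := h.answer hK hk hq1 hq2
      exact ⟨c', p', h1, hτ (by omega) h2⟩
    | zero =>
      cases r with
      | zero => omega
      | succ r =>
        obtain ⟨T, rfl⟩ : ∃ T', T = T' + 1 := ⟨T - 1, by omega⟩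
        obtain ⟨c1, p1, u1, S1, E1, h1, h2⟩ := h.shift hJ ih hab hK hk
        have e : cov p1 K = cov p K := cov_congr fun i hi => (h1 i (subset_cov p K hi)).2
        obtain ⟨c', p', h3, h4⟩ := h2.answer (subset_cov p K) hk hq1 hq2
        rw [e] at h3 h4
        refine ⟨c', p', fun i hi => ?_, hτ ?_ h4⟩
        · rw [(h3 i hi).1, (h3 i hi).2]
          exact h1 i hi
        · rw [add_mul] at hle
          omega

end

theorem surv_step {a b : ℤ} {k J T : ℕ} (N : ℕ) (hJ : 1 ≤ J) (hT : 1 ≤ T)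
    (ih : ∀ u c p, Surv u (u + J) k T ∅ c p)
    (hab : a + (2 * k + 1) * (2 * (J + 5 * k * N + 2 * k) + 1) ≤ b) (c : ℤ → Bool) (p : ℤ → ℤ) :
    Surv a b k (N * T) ∅ c p := by
  have hJb : a + J ≤ b := by
    have h1 : (0 : ℤ) ≤ 2 * k * (2 * (J + 5 * k * N + 2 * k) + 1) := by positivity
    have h2 : (0 : ℤ) ≤ 5 * k * N := by positivity
    have h3 : (2 * (k : ℤ) + 1) * (2 * (J + 5 * k * N + 2 * k) + 1) =
      2 * k * (2 * (J + 5 * k * N + 2 * k) + 1) + (2 * (J + 5 * k * N + 2 * k) + 1) := by ring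
    omega
  have h0 : Inv a b k J (5 * k * N) N T ∅ (fun _ => false) (fun i => i) a {a} ∅ := by
    refine ⟨le_rfl, hJb, ⟨?_, ?_, ?_, ?_, ?_, ?_, ?_⟩, by simp, by simp, ?_, by simp, ?_, by simp,
      fun i _ => Or.inl rfl⟩
    · intro i hi
      simp only [Finset.mem_sdiff, Finset.mem_Ico] at hi
      exact hi.1
    · exact fun _ _ => rfl
    · exact fun _ _ => rfl
    · intro i hi j hj
      have e : j = i := by rw [mem_seg] at hj; omega
      subst e
      exact ⟨hi, hj⟩
    · simp
    · intro ha
      simp only [Finset.mem_sdiff, Finset.mem_Ico] at ha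
      omega
    · exact fun _ => rfl
    · rw [Finset.empty_inter]; exact ih _ _ _
    · intro s hs s' hs' hlt
      rw [Finset.mem_singleton] at hs hs'
      omega
  exact (Inv.surv hJ hT ih (by push_cast; exact hab) (N * T) (by omega) h0).congr (by simp)

theorem surv_one {a b : ℤ} {k : ℕ} (hab : a + 2 ≤ b) (c : ℤ → Bool) (p : ℤ → ℤ) :
    Surv a b k 1 ∅ c p := by
  refine ⟨⟨?_, ?_, ?_, ?_, ?_, ?_, ?_⟩, fun K hK _ q hq1 hq2 => ?_⟩
  iterate 7 simp
  refine ⟨fun i => decide (i = a), fun i => i, ?_, ?_⟩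
  · have e : K = ∅ := Finset.subset_empty.1 hK
    simp [e, cov]
  · have e : K = ∅ := Finset.subset_empty.1 hK
    have e' : cov p K ∪ seg (fun i => i) q = {q} := by
      simp [e, cov, seg]
    rw [e']
    refine ⟨?_, ?_, ?_, ?_, ?_, ?_, ?_⟩
    · simp [hq1, hq2]
    · simp
    · simp
    · intro i hi j hj
      have e : j = i := by rw [mem_seg] at hj; omega
      subst e
      exact ⟨hi, hj⟩
    · intro i hi hi'
      simp only [Finset.mem_singleton] at hi hi'
      omega
    · simp
    · intro _
      simp only [decide_eq_false_iff_not]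
      omega

theorem surv_levels (k N : ℕ) (hN : 1 ≤ N) (H : ℕ) : ∀ (a b : ℤ),
    a + ((8 * k + 4) ^ H * (5 * k * N + 2 * k + 2) : ℕ) ≤ b → ∀ (c : ℤ → Bool) (p : ℤ → ℤ),
    Surv a b k (N ^ H) ∅ c p := by
  induction H with
  | zero =>
    intro a b hab c p
    refine surv_one ?_ c p
    rw [pow_zero, one_mul] at hab
    push_cast at hab
    have h2 : (0 : ℤ) ≤ 5 * k * N := by positivity
    omega
  | succ H ih =>
    intro a b hab c p
    rw [pow_succ' N]
    set J := (8 * k + 4) ^ H * (5 * k * N + 2 * k + 2) with hJ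
    have hJ1 : 5 * k * N + 2 * k + 2 ≤ J := Nat.le_mul_of_pos_left _ (by positivity)
    refine surv_step N (by omega) (Nat.one_le_pow _ _ hN) (fun u => ih u _ le_rfl) ?_ c p
    have h1 : (8 * k + 4) ^ (H + 1) * (5 * k * N + 2 * k + 2) = (2 * k + 1) * (4 * J) := by
      rw [hJ]; ring
    rw [h1] at hab
    have h2 : (2 * k + 1) * (2 * (J + 5 * k * N + 2 * k) + 1) ≤ (2 * k + 1) * (4 * J) :=
      Nat.mul_le_mul_left _ (by omega)
    have h3 : ((2 * k + 1) * (2 * (J + 5 * k * N + 2 * k) + 1) : ℕ) ≤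
      (((2 * k + 1) * (4 * J) : ℕ) : ℤ) := by exact_mod_cast h2
    push_cast at h3 hab ⊢
    linarith

/-! ### From the game to resolution -/

theorem Surv.queries {a b : ℤ} {k : ℕ} (Q : Finset ℤ) : ∀ {t : ℕ} {X K : Finset ℤ} {c p},
    Surv a b k (t + Q.card) X c p → K ⊆ X → K.card + Q.card ≤ k → (∀ q ∈ Q, a ≤ q ∧ q < b) →
    ∃ (X' : Finset ℤ) (c' : ℤ → Bool) (p' : ℤ → ℤ), (∀ i ∈ K, c' i = c i ∧ p' i = p i) ∧
      K ⊆ X' ∧ Q ⊆ X' ∧ Surv a b k t X' c' p' := by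
  induction Q using Finset.induction_on with
  | empty =>
    intro t X K c p h hK _ _
    exact ⟨X, c, p, fun _ _ => ⟨rfl, rfl⟩, hK, by simp, h⟩
  | insert q Q hq ih =>
    intro t X K c p h hK hk hQ
    rw [Finset.card_insert_of_notMem hq] at h hk
    obtain ⟨c1, p1, h1, h2⟩ := h.2 K hK (by omega) q (hQ q (by simp)).1 (hQ q (by simp)).2
    have hK1 : insert q K ⊆ Paper.cov p K ∪ seg p1 q := by
      refine Finset.insert_subset (Finset.mem_union_right _ (self_mem_seg p1 q)) ?_
      exact (subset_cov p K).trans Finset.subset_union_left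
    have hc := Finset.card_insert_le q K
    obtain ⟨X', c', p', h3, h4, h5, h6⟩ := ih h2 hK1 (by omega)
      fun x hx => hQ x (Finset.mem_insert_of_mem hx)
    refine ⟨X', c', p', fun i hi => ?_, (Finset.subset_insert q K).trans h4,
      Finset.insert_subset (h4 (Finset.mem_insert_self q K)) h5, h6⟩
    rw [(h3 i (Finset.mem_insert_of_mem hi)).1, (h3 i (Finset.mem_insert_of_mem hi)).2]
    exact h1 i (subset_cov p K hi)

/-- The bracket symbol at position `i` described by the colouring `c` and the partner map `p`. -/
def symOf {n : ℕ} (c : ℤ → Bool) (p : ℤ → ℤ) (i : Fin n) : Sym n where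
  b := if p (i : ℕ) = (i : ℕ) then (if c (i : ℕ) = true then BType.trivR else BType.trivB)
    else if ((i : ℕ) : ℤ) < p (i : ℕ) then
      (if c (i : ℕ) = true then BType.openR else BType.openB)
    else (if c (i : ℕ) = true then BType.closeR else BType.closeB)
  p := if h : (p (i : ℕ)).toNat < n then ⟨(p (i : ℕ)).toNat, h⟩ else i

theorem symOf_p {n : ℕ} {c : ℤ → Bool} {p : ℤ → ℤ} {i : Fin n} (h0 : 0 ≤ p (i : ℕ))
    (h1 : p (i : ℕ) < n) (j : Fin n) : (symOf c p i).p = j ↔ p (i : ℕ) = (j : ℕ) := by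
  have h : (p (i : ℕ)).toNat < n := by omega
  simp only [symOf, dif_pos h, Fin.ext_iff]
  omega

theorem symOf_b_triv {n : ℕ} {c : ℤ → Bool} {p : ℤ → ℤ} {i : Fin n} (h : p (i : ℕ) = (i : ℕ)) :
    (symOf c p i).b = if c (i : ℕ) = true then BType.trivR else BType.trivB := by
  simp only [symOf, if_pos h]

theorem symOf_b_open {n : ℕ} {c : ℤ → Bool} {p : ℤ → ℤ} {i : Fin n}
    (h : ((i : ℕ) : ℤ) < p (i : ℕ)) :
    (symOf c p i).b = if c (i : ℕ) = true then BType.openR else BType.openB := by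
  simp only [symOf, if_neg h.ne', if_pos h]

theorem symOf_b_close {n : ℕ} {c : ℤ → Bool} {p : ℤ → ℤ} {i : Fin n}
    (h : p (i : ℕ) < ((i : ℕ) : ℤ)) :
    (symOf c p i).b = if c (i : ℕ) = true then BType.closeR else BType.closeB := by
  simp only [symOf, if_neg h.ne, if_neg h.not_gt]

theorem partialOn_eq_some {n : ℕ} {S : Finset (Fin n)} {s : Fin n → Sym n} {i : Fin n} {σ : Sym n} :
    partialOn S s i = some σ ↔ i ∈ S ∧ s i = σ := by
  unfold partialOn
  split_ifs with h <;> simp [h]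

theorem Good.consistent {n : ℕ} {X c p} (h : Good 0 n X c p) {S : Finset (Fin n)}
    (hS : ∀ i ∈ S, ((i : ℕ) : ℤ) ∈ X) : ConsistentPS (partialOn S (symOf c p)) := by
  have hr : ∀ i ∈ S, 0 ≤ p (i : ℕ) ∧ p (i : ℕ) < n := fun i hi =>
    h.sub _ (h.partner_mem (hS i hi))
  have hp : ∀ i ∈ S, ∀ j, (symOf c p i).p = j ↔ p (i : ℕ) = (j : ℕ) := fun i hi j =>
    symOf_p (hr i hi).1 (hr i hi).2 j
  rintro (hv | hv | hv | hv)
  · rcases hv with ⟨i, hi0, σ, hσ, hb⟩ | ⟨i, hi0, σ, hσ, hb⟩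
    · rw [partialOn_eq_some] at hσ
      obtain ⟨hi, rfl⟩ := hσ
      have h1 := hr i hi
      have h2 := hS i hi
      have e : ((i : ℕ) : ℤ) = 0 := by omega
      have h3 : c (i : ℕ) = true := by rw [e] at h2 ⊢; exact h.left h2
      apply hb
      rcases eq_or_lt_of_le (show ((i : ℕ) : ℤ) ≤ p (i : ℕ) by omega) with h4 | h4
      · simp [symOf_b_triv h4.symm, h3]
      · simp [symOf_b_open h4, h3]
    · rw [partialOn_eq_some] at hσ
      obtain ⟨hi, rfl⟩ := hσ
      have h1 := hr i hi
      have h2 := hS i hi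
      have e : ((i : ℕ) : ℤ) = n - 1 := by omega
      have h3 : c (i : ℕ) = false := by rw [e] at h2 ⊢; exact h.right h2
      apply hb
      rcases eq_or_lt_of_le (show p (i : ℕ) ≤ (i : ℕ) by omega) with h4 | h4
      · simp [symOf_b_triv h4, h3]
      · simp [symOf_b_close h4, h3]
  · rcases hv with ⟨i, j, σ, τ, hσ, hτ, hij, hji⟩ | ⟨i, σ, hσ, hii, hb⟩ |
      ⟨i, j, σ, τ, hlt, hσ, hτ, hij, hji, hb⟩
    · rw [partialOn_eq_some] at hσ hτ
      obtain ⟨hi, rfl⟩ := hσ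
      obtain ⟨hj, rfl⟩ := hτ
      rw [hp i hi] at hij
      apply hji
      rw [hp j hj, ← hij]
      exact h.inv _ (hS i hi)
    · rw [partialOn_eq_some] at hσ
      obtain ⟨hi, rfl⟩ := hσ
      rw [hp i hi] at hii
      apply hb
      rw [symOf_b_triv hii]
      split_ifs <;> simp
    · rw [partialOn_eq_some] at hσ hτ
      obtain ⟨hi, rfl⟩ := hσ
      obtain ⟨hj, rfl⟩ := hτ
      rw [hp i hi] at hij
      rw [hp j hj] at hji
      have hcol := h.col _ (hS i hi)
      rw [hij] at hcol
      have hlt' : (i : ℕ) < (j : ℕ) := hlt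
      apply hb
      rw [symOf_b_open (by omega), symOf_b_close (by omega), hcol]
      split_ifs <;> simp
  · obtain ⟨i, i', j, j', ⟨σ, τ, hσ, hτ, h1, h2⟩, ⟨σ', τ', hσ', hτ', h1', h2'⟩, hlt1, hlt2, hlt3⟩ := hv
    rw [partialOn_eq_some] at hσ hσ'
    obtain ⟨hi, rfl⟩ := hσ
    obtain ⟨hi', rfl⟩ := hσ'
    rw [hp i hi] at h1
    rw [hp i' hi'] at h1'
    have hlt1' : (i : ℕ) < (i' : ℕ) := hlt1
    have hlt2' : (i' : ℕ) < (j : ℕ) := hlt2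
    have hlt3' : (j : ℕ) < (j' : ℕ) := hlt3
    have h3 := (h.closed _ (hS i hi) ((i' : ℕ) : ℤ) (by rw [mem_seg]; omega)).2
    rw [mem_seg] at h3
    omega
  · obtain ⟨i, j, hij, σ, τ, hσ, hτ, hb1, hb2⟩ := hv
    rw [partialOn_eq_some] at hσ hτ
    obtain ⟨hi, rfl⟩ := hσ
    obtain ⟨hj, rfl⟩ := hτ
    have e : ((j : ℕ) : ℤ) = (i : ℕ) + 1 := by omega
    have hj' := hS j hj
    refine h.trans _ (hS i hi) (e ▸ hj') ?_
    rw [← e]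
    have h1 : c (i : ℕ) = true ∧ p (i : ℕ) ≤ (i : ℕ) := by
      simp only [symOf] at hb1
      split_ifs at hb1 with a1 a2 a3 a4 <;> simp_all
    have h2 : c (j : ℕ) = false ∧ ((j : ℕ) : ℤ) ≤ p (j : ℕ) := by
      simp only [symOf] at hb2
      split_ifs at hb2 with a1 a2 a3 a4 <;> simp_all
      omega
    exact ⟨h1.1, h1.2, h2.1, h2.2⟩

/-- The blocks mentioned by a clause. -/
def blocks {n m : ℕ} (D : Clause (Fin n × Fin m)) : Finset ℤ :=
  D.image fun l => ((l.1.1 : ℕ) : ℤ)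

theorem card_blocks {n m : ℕ} (D : Clause (Fin n × Fin m)) :
    (blocks D).card ≤ iw (Prod.fst : Fin n × Fin m → Fin n) D := by
  have : blocks D = (D.image fun l => l.1.1).image fun i : Fin n => ((i : ℕ) : ℤ) := by
    rw [Finset.image_image]; rfl
  rw [this]
  exact Finset.card_image_le

theorem mem_blocks_range {n m : ℕ} {D : Clause (Fin n × Fin m)} {x : ℤ} (hx : x ∈ blocks D) :
    0 ≤ x ∧ x < n := by
  obtain ⟨l, _, rfl⟩ := Finset.mem_image.1 hx
  have := l.1.1.2
  omega

/-- The blocks mentioned by the variables `y_D` of a clause. -/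
def extBlocks {n m k : ℕ} (C : Clause (ExtVar (Prod.fst : Fin n × Fin m → Fin n) k)) :
    Finset ℤ :=
  C.biUnion fun l => blocks l.1.1

theorem card_extBlocks {n m k : ℕ} (C : Clause (ExtVar (Prod.fst : Fin n × Fin m → Fin n) k)) :
    (extBlocks C).card ≤ C.card * k :=
  Finset.card_biUnion_le_card_mul _ _ _ fun l _ => (card_blocks l.1.1).trans l.1.2

theorem blocks_subset_extBlocks {n m k : ℕ}
    {C : Clause (ExtVar (Prod.fst : Fin n × Fin m → Fin n) k)} {l} (hl : l ∈ C) :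
    blocks l.1.1 ⊆ extBlocks C :=
  Finset.subset_biUnion_of_mem (fun l => blocks l.1.1) hl

/-- The Boolean assignment encoding the string described by `c` and `p`. -/
def asg {n : ℕ} (π : Sym n → Fin (mBits n) → Bool) (c : ℤ → Bool) (p : ℤ → ℤ) : BVar n → Bool :=
  fun x => π (symOf c p x.1) x.2

theorem symOf_congr {n : ℕ} {c c' : ℤ → Bool} {p p' : ℤ → ℤ} {i : Fin n}
    (h : c' (i : ℕ) = c (i : ℕ) ∧ p' (i : ℕ) = p (i : ℕ)) : symOf c' p' i = symOf c p i := by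
  simp only [symOf, h.1, h.2]

theorem satC_asg_congr {n : ℕ} {π : Sym n → Fin (mBits n) → Bool} {c c' : ℤ → Bool}
    {p p' : ℤ → ℤ} {D : Clause (BVar n)}
    (h : ∀ i ∈ blocks D, c' i = c i ∧ p' i = p i) :
    SatC (asg π c' p') D ↔ SatC (asg π c p) D := by
  refine exists_congr fun l => and_congr_right fun hl => ?_
  simp only [asg]
  rw [symOf_congr (h _ (Finset.mem_image.2 ⟨l, hl, rfl⟩))]

theorem satC_singleton {V : Type} {α : V → Bool} {x : V} {v : Bool} :
    SatC α {(x, v)} ↔ α x = v := by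
  simp [SatC]

theorem satC_union {V : Type} [DecidableEq V] {α : V → Bool} {A B : Clause V} :
    SatC α (A ∪ B) ↔ SatC α A ∨ SatC α B := by
  simp only [SatC, Finset.mem_union]
  constructor
  · rintro ⟨l, h1 | h1, h2⟩
    · exact Or.inl ⟨l, h1, h2⟩
    · exact Or.inr ⟨l, h1, h2⟩
  · rintro (⟨l, h1, h2⟩ | ⟨l, h1, h2⟩)
    · exact ⟨l, Or.inl h1, h2⟩
    · exact ⟨l, Or.inr h1, h2⟩

/-- An assignment to the original variables, extended to the variables `y_D` in the intended
way, can falsify only the unit clauses `y_D`. -/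
theorem extEnc_falsified {V : Type} {nB : ℕ} [DecidableEq V] {blk : V → Fin nB} {k : ℕ}
    {F : Set (Clause V)} {C : Clause (ExtVar blk k)} (hC : C ∈ ExtEnc blk k F) (α : V → Bool)
    (h : ∀ l ∈ C, ¬ (SatC α l.1.1 ↔ l.2 = true)) :
    ∃ D ∈ F, ∃ hD : iw blk D ≤ k, C = {(⟨D, hD⟩, true)} := by
  rcases hC with hC | ⟨x, hp, hn, hC⟩ | ⟨A, B, hA, hB, hD, hC⟩
  · exact hC
  · exfalso
    rcases hC with rfl | rfl <;>
    · simp only [Finset.mem_insert, Finset.mem_singleton, forall_eq_or_imp, forall_eq,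
        satC_singleton] at h
      cases hx : α x <;> simp [hx] at h
  · exfalso
    rcases hC with rfl | rfl | rfl <;>
    · simp only [Finset.mem_insert, Finset.mem_singleton, forall_eq_or_imp, forall_eq,
        satC_union, Bool.false_eq_true, iff_true, iff_false] at h
      tauto

theorem refutation_initial_clause {n : ℕ} {π : Sym n → Fin (mBits n) → Bool}
    {C : Clause (ExtVar (Prod.fst : BVar n → Fin n) 4)} (hC : C ∈ ExBracketCNF n π) {k t : ℕ}
    (hk : C.card * 4 + 4 ≤ k) {X : Finset ℤ} {c : ℤ → Bool} {p : ℤ → ℤ}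
    (hS : Surv 0 n k (t + 4) X c p) (hX : extBlocks C ⊆ X) :
    ¬ ∀ l ∈ C, ¬ (SatC (asg π c p) l.1.1 ↔ l.2 = true) := by
  intro hf
  obtain ⟨D, ⟨S, hS4, _, hD⟩, hDk, rfl⟩ := extEnc_falsified hC (asg π c p) hf
  have hQ : (S.image fun i : Fin n => ((i : ℕ) : ℤ)).card ≤ 4 := Finset.card_image_le.trans hS4
  have hE := card_extBlocks ({(⟨D, hDk⟩, true)} : Clause (ExtVar (Prod.fst : BVar n → Fin n) 4))
  obtain ⟨X', c', p', h1, _, h3, h4⟩ :=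
    Surv.queries (S.image fun i : Fin n => ((i : ℕ) : ℤ)) (t := t) (hS.mono (by omega)) hX
      (by omega) (by
        intro q hq
        obtain ⟨i, _, rfl⟩ := Finset.mem_image.1 hq
        have := i.2
        omega)
  have hsat := hD (asg π c' p') ⟨symOf c' p', fun _ _ _ => rfl,
    h4.good.consistent fun i hi => h3 (Finset.mem_image_of_mem _ hi)⟩
  have hmem := Finset.mem_singleton_self
    (((⟨D, hDk⟩ : ExtVar (Prod.fst : BVar n → Fin n) 4), true))
  rw [satC_asg_congr (D := D) fun i hi => h1 i (blocks_subset_extBlocks hmem hi)] at hsat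
  simpa [hsat] using hf _ hmem

theorem refutation_walk {n : ℕ} {π : Sym n → Fin (mBits n) → Bool}
    (R : Refutation (ExtVar (Prod.fst : BVar n → Fin n) 4) (ExBracketCNF n π)) {w d k : ℕ}
    (hw : WidthLE R w) (hk : 4 * min w d + 4 ≤ k) {h : Fin R.size → ℕ}
    (hh : ∀ i j k x, R.prem i = some (j, k, x) → h j < h i ∧ h k < h i) (e : ℕ) :
    ∀ i (X : Finset ℤ) (c : ℤ → Bool) (p : ℤ → ℤ), h i ≤ e → (R.clause i).card + e ≤ d →
      Surv 0 n k (4 * e + 4) X c p → extBlocks (R.clause i) ⊆ X →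
      ¬ ∀ l ∈ R.clause i, ¬ (SatC (asg π c p) l.1.1 ↔ l.2 = true) := by
  induction e with
  | zero =>
    intro i X c p hi hd hS hX
    have hwi := hw i
    have hok := R.ok i
    cases hprem : R.prem i with
    | none =>
      rw [hprem] at hok
      exact refutation_initial_clause hok (by omega) hS hX
    | some q =>
      obtain ⟨j, l, x⟩ := q
      have := hh i j l x hprem
      omega
  | succ e ih =>
    intro i X c p hi hd hS hX
    have hwi := hw i
    have hok := R.ok i
    cases hprem : R.prem i with
    | none =>
      rw [hprem] at hok
      exact refutation_initial_clause hok (by omega) hS hX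
    | some q =>
      obtain ⟨j, l, x⟩ := q
      intro hf
      rw [hprem] at hok
      obtain ⟨_, _, hxj, hxl, hcl⟩ := hok
      have hlt := hh i j l x hprem
      have hE := card_extBlocks (R.clause i)
      have hB := (card_blocks x.1).trans x.2
      obtain ⟨X', c', p', h1, h2, h3, h4⟩ :=
        Surv.queries (blocks x.1) (t := 4 * e + 4) (hS.mono (by omega)) hX (by omega)
          fun q hq => mem_blocks_range hq
      have hf' : ∀ y ∈ R.clause i, ¬ (SatC (asg π c' p') y.1.1 ↔ y.2 = true) := by
        intro y hy
        rw [satC_asg_congr fun z hz => h1 z (blocks_subset_extBlocks hy hz)]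
        exact hf y hy
      have key : ∀ (j : Fin R.size) (v : Bool), h j < h i →
          R.clause j ⊆ insert (x, v) (R.clause i) → ¬ (SatC (asg π c' p') x.1 ↔ v = true) →
          False := by
        intro j v hj hsub hv
        have hcard := (Finset.card_le_card hsub).trans (Finset.card_insert_le _ _)
        refine ih j X' c' p' (by omega) (by omega) h4 ?_ ?_
        · refine Finset.biUnion_subset.2 fun y hy => ?_
          rcases Finset.mem_insert.1 (hsub hy) with rfl | hy'
          · exact h3
          · exact (blocks_subset_extBlocks hy').trans h2
        · intro y hy
          rcases Finset.mem_insert.1 (hsub hy) with rfl | hy'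
          · exact hv
          · exact hf' y hy'
      by_cases hsat : SatC (asg π c' p') x.1
      · refine key l false hlt.2 (fun y hy => ?_) (by simp [hsat])
        by_cases hy' : y = (x, false)
        · exact Finset.mem_insert.2 (Or.inl hy')
        · rw [hcl]
          exact Finset.mem_insert_of_mem
            (Finset.mem_union_right _ (Finset.mem_erase.2 ⟨hy', hy⟩))
      · refine key j true hlt.1 (fun y hy => ?_) (by simp [hsat])
        by_cases hy' : y = (x, true)
        · exact Finset.mem_insert.2 (Or.inl hy')
        · rw [hcl]
          exact Finset.mem_insert_of_mem
            (Finset.mem_union_left _ (Finset.mem_erase.2 ⟨hy', hy⟩))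

theorem depth_bound {n : ℕ} {π : Sym n → Fin (mBits n) → Bool}
    (R : Refutation (ExtVar (Prod.fst : BVar n → Fin n) 4) (ExBracketCNF n π)) {w d k N H : ℕ}
    (hw : WidthLE R w) (hd : DepthLE R d) (hk : 4 * min w d + 4 ≤ k) (hN : 1 ≤ N)
    (hn : (8 * k + 4) ^ H * (5 * k * N + 2 * k + 2) ≤ n) : N ^ H < 4 * d + 4 := by
  obtain ⟨h, hle, hh⟩ := hd
  by_contra hlt
  have hS : Surv 0 n k (4 * d + 4) ∅ (fun _ => false) (fun i => i) :=
    (surv_levels k N hN H 0 n (by rw [zero_add]; exact_mod_cast hn) _ _).mono (not_lt.1 hlt)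
  refine refutation_walk R hw hk hh d ⟨R.size - 1, Nat.sub_lt R.size_pos Nat.one_pos⟩ ∅ _ _
    (hle _) ?_ hS ?_ ?_ <;> rw [R.last_empty]
  · simp
  · simp [extBlocks]
  · simp

/-! ### The depth lower bound -/

theorem params_bound {W N H n : ℕ} (hW : 2 ≤ W) (hN : 1 ≤ N) (hH : 1 ≤ H)
    (hn : W ^ (14 * H) * N ≤ n) :
    (8 * (4 * W + 4) + 4) ^ H * (5 * (4 * W + 4) * N + 2 * (4 * W + 4) + 2) ≤ n := by
  have h64 : W * 64 ≤ W ^ 7 := by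
    calc W * 64 = W * 2 ^ 6 := by norm_num
      _ ≤ W * W ^ 6 := by gcongr
      _ = W ^ 7 := by ring
  have h1 : (8 * (4 * W + 4) + 4) ^ H ≤ W ^ (7 * H) := by
    rw [pow_mul]
    exact Nat.pow_le_pow_left (by omega) H
  have h2 : 5 * (4 * W + 4) * N + 2 * (4 * W + 4) + 2 ≤ W ^ (7 * H) * N := by
    calc 5 * (4 * W + 4) * N + 2 * (4 * W + 4) + 2
        ≤ 5 * (4 * W + 4) * N + (2 * (4 * W + 4) + 2) * N := by nlinarith
      _ = (28 * W + 30) * N := by ring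
      _ ≤ (W * 64) * N := by gcongr; omega
      _ ≤ W ^ 7 * N := by gcongr
      _ ≤ W ^ (7 * H) * N := by gcongr <;> omega
  calc _ ≤ W ^ (7 * H) * (W ^ (7 * H) * N) := Nat.mul_le_mul h1 h2
    _ = W ^ (14 * H) * N := by ring
    _ ≤ n := hn

theorem rpow_le_depth {n : ℕ} (hn : 2 ^ 28 ≤ n) {π : Sym n → Fin (mBits n) → Bool}
    (R : Refutation (ExtVar (Prod.fst : BVar n → Fin n) 4) (ExBracketCNF n π)) {w d W H : ℕ}
    (hw : WidthLE R w) (hd : DepthLE R d) (hW : 2 ≤ W) (hwd : min w d ≤ W) (hH : 1 ≤ H)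
    (hWn : W ^ (28 * H) ≤ n) : (n : ℝ) ^ ((H : ℝ) / 4) ≤ d := by
  have hs : W ^ (14 * H) ≤ Nat.sqrt n := by
    rw [Nat.le_sqrt', ← pow_mul]
    convert hWn using 2
    ring
  have hN : 1 ≤ Nat.sqrt n := by rw [Nat.le_sqrt']; omega
  have hlt : Nat.sqrt n ^ H < 4 * d + 4 := depth_bound R hw hd (k := 4 * W + 4) (by omega) hN
    (params_bound hW hN hH ((Nat.mul_le_mul_right _ hs).trans (Nat.sqrt_le n)))
  set x : ℝ := (n : ℝ) ^ ((1 : ℝ) / 4) with hx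
  have hx4 : x ^ 4 = n := by
    rw [hx, ← Real.rpow_natCast, ← Real.rpow_mul (by positivity)]
    norm_num
  have hx0 : 0 ≤ x := by positivity
  have hnR : (2 : ℝ) ^ 28 ≤ n := by exact_mod_cast hn
  have hx17 : 17 ≤ x := by
    by_contra hcon
    have : x ^ 4 ≤ 17 ^ 4 := by gcongr; linarith
    rw [hx4] at this
    exact absurd (hnR.trans this) (by norm_num)
  have hsq : x ^ 2 < Nat.sqrt n + 1 := by
    have h1 : (n : ℝ) < (Nat.sqrt n + 1) ^ 2 := by exact_mod_cast Nat.lt_succ_sqrt' n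
    rw [← hx4, show x ^ 4 = (x ^ 2) ^ 2 by ring] at h1
    exact lt_of_pow_lt_pow_left₀ 2 (by positivity) h1
  have h16 : 16 * x ≤ Nat.sqrt n := by nlinarith
  have hpow : 16 * x ^ H ≤ (Nat.sqrt n : ℝ) ^ H := by
    calc 16 * x ^ H ≤ 16 ^ H * x ^ H := by
          gcongr
          exact le_self_pow₀ (by norm_num) (by omega)
      _ = (16 * x) ^ H := by rw [mul_pow]
      _ ≤ _ := by gcongr
  have hlt' : (Nat.sqrt n : ℝ) ^ H < 4 * d + 4 := by exact_mod_cast hlt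
  have h1 : 1 ≤ x ^ H := one_le_pow₀ (by linarith)
  have he : (n : ℝ) ^ ((H : ℝ) / 4) = x ^ H := by
    rw [hx, ← Real.rpow_natCast, ← Real.rpow_mul (by positivity)]
    congr 1
    ring
  rw [he]
  linarith

/-- Every width-`w` resolution refutation of `ExBracket_n` has depth
at least `n^{ε log n / log w}`. -/
theorem exbracket_depth_lower_bound :
    ∃ ε : ℝ, 0 < ε ∧ ∃ N : ℕ, ∀ n ≥ N, ∀ w : ℕ, 2 ≤ w →
      ∀ π : Sym n → Fin (mBits n) → Bool, Function.Injective π →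
        ∀ R : Refutation (ExtVar (Prod.fst : BVar n → Fin n) 4) (ExBracketCNF n π),
          WidthLE R w → ∀ d : ℕ, DepthLE R d →
            (n : ℝ) ^ (ε * Real.log n / Real.log w) ≤ (d : ℝ) := by
  refine ⟨1 / 784, by norm_num, 2 ^ 28, fun n hn w hw2 π _ R hw d hd => ?_⟩
  have hnR : (2 : ℝ) ^ 28 ≤ n := by exact_mod_cast hn
  have hn1 : (1 : ℝ) ≤ n := le_trans (by norm_num) hnR
  have hwR : (2 : ℝ) ≤ w := by exact_mod_cast hw2
  have hlogw : 0 < Real.log w := Real.log_pos (by linarith)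
  have hlogn : 0 ≤ Real.log n := Real.log_nonneg hn1
  set ℓ : ℝ := Real.log n / Real.log w with hℓ
  have hexp : 1 / 784 * Real.log n / Real.log w = ℓ / 784 := by rw [hℓ]; ring
  rw [hexp]
  by_cases hcase : 28 ≤ ℓ
  · have hH1 : 1 ≤ ⌊ℓ / 28⌋₊ := by
      rw [Nat.one_le_floor_iff]
      linarith
    have hHle : (⌊ℓ / 28⌋₊ : ℝ) ≤ ℓ / 28 := Nat.floor_le (by linarith)
    have hHlt : ℓ / 28 < ⌊ℓ / 28⌋₊ + 1 := Nat.lt_floor_add_one _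
    have hH1R : (1 : ℝ) ≤ ⌊ℓ / 28⌋₊ := by exact_mod_cast hH1
    have hWn : w ^ (28 * ⌊ℓ / 28⌋₊) ≤ n := by
      have hlog : Real.log ((w : ℝ) ^ (28 * ⌊ℓ / 28⌋₊)) ≤ Real.log n := by
        rw [Real.log_pow]
        push_cast
        calc 28 * (⌊ℓ / 28⌋₊ : ℝ) * Real.log w ≤ ℓ * Real.log w := by gcongr; linarith
          _ = Real.log n := div_mul_cancel₀ _ hlogw.ne'
      have := (Real.log_le_log_iff (by positivity) (by linarith)).1 hlog
      exact_mod_cast this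
    refine le_trans ?_ (rpow_le_depth hn R hw hd hw2 (min_le_left w d) hH1 hWn)
    exact Real.rpow_le_rpow_of_exponent_le hn1 (by linarith)
  · have hle : (n : ℝ) ^ (ℓ / 784) ≤ (n : ℝ) ^ ((1 : ℝ) / 28) :=
      Real.rpow_le_rpow_of_exponent_le hn1 (by linarith)
    refine hle.trans ?_
    by_cases hdn : d ^ 28 ≤ n
    · have hWn : max 2 d ^ (28 * 1) ≤ n := by
        rcases max_choice 2 d with h | h <;> rw [h]
        · exact hn
        · exact hdn
      refine le_trans ?_ (rpow_le_depth hn R hw hd (le_max_left 2 d)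
        ((min_le_right w d).trans (le_max_right 2 d)) le_rfl hWn)
      exact Real.rpow_le_rpow_of_exponent_le hn1 (by norm_num)
    · have hdR : (n : ℝ) ≤ (d : ℝ) ^ 28 := by exact_mod_cast (not_le.1 hdn).le
      calc (n : ℝ) ^ ((1 : ℝ) / 28) ≤ ((d : ℝ) ^ 28) ^ ((1 : ℝ) / 28) := by gcongr
        _ = d := by
          rw [← Real.rpow_natCast, ← Real.rpow_mul (by positivity)]
          norm_num

end Paper
end

section
/- There exists ε > 0 such that for all sufficiently large n and every integer w ≥ 2, there is an adversary strategy for the prover–adversary game for the bracket axioms on strings of length n with the following property: against every prover whose state always has memory size at most w, the game state does not falsify any of the axioms (A1)–(A4) during the first n^{ε·(log n)/(log w)} rounds of the game. -/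
namespace Paper


/-! ### The prover-adversary game for the bracket axioms -/

inductive PMove (n : ℕ) : Type
  | query (i : Fin n)
  | forget (S : Finset (Fin n))

/-- A history of the game: each round records the prover's move and,
for a query, the adversary's answer. -/
abbrev Hist (n : ℕ) := List (PMove n × Option (Sym n))

def stepState {n : ℕ} (ρ : PState n) : PMove n × Option (Sym n) → PState n
  | (PMove.query i, some σ) => Function.update ρ i (some σ)
  | (PMove.query _, none) => ρ
  | (PMove.forget S, _) => fun j => if j ∈ S then none else ρ j

/-- The game state after a given history (initially everything is `*`). -/
def stateOf {n : ℕ} (h : Hist n) : PState n := h.foldl stepState (fun _ => none)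

/-- A (history-dependent) prover strategy. -/
abbrev ProverStrat (n : ℕ) := Hist n → PMove n

/-- A (history-dependent) adversary strategy: answers queried indices with symbols. -/
abbrev AdvStrat (n : ℕ) := Hist n → Fin n → Sym n

/-- The history of the play between a prover and an adversary after `t` rounds. -/
def play {n : ℕ} (P : ProverStrat n) (A : AdvStrat n) : ℕ → Hist n
  | 0 => []
  | t + 1 =>
    let h := play P A t
    match P h with
    | PMove.query i => h ++ [(PMove.query i, some (A h i))]
    | PMove.forget S => h ++ [(PMove.forget S, none)]

/-- Memory size of a state: the number of assigned (non-`*`) entries. -/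
noncomputable def memSize {n : ℕ} (ρ : PState n) : ℕ := {i : Fin n | ρ i ≠ none}.ncard


/-! ### The abstract line game -/

/-- The cell `x` lies in no block of `B`. -/
def Free (B : Finset (ℤ × ℤ)) (x : ℤ) : Prop := ∀ b ∈ B, ¬(b.1 ≤ x ∧ x ≤ b.2)

/-- The blocks are nonempty, pairwise disjoint intervals. -/
def WF (B : Finset (ℤ × ℤ)) : Prop :=
  (∀ b ∈ B, b.1 ≤ b.2) ∧ ∀ b ∈ B, ∀ c ∈ B, b ≠ c → b.2 < c.1 ∨ c.2 < b.1

/-- Add the block `[a, c]`, absorbing all blocks inside it. -/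
def merge (B : Finset (ℤ × ℤ)) (a c : ℤ) : Finset (ℤ × ℤ) :=
  insert (a, c) (B.filter fun b => ¬(a ≤ b.1 ∧ b.2 ≤ c))

/-- The adversary survives `t` rounds of the line game from blocks `B` and hot cell `h`, with at
most `w` blocks on the line `[0, n)`. -/
def AGood (n : ℤ) (w : ℕ) : ℕ → Finset (ℤ × ℤ) → ℤ → Prop
  | 0, _, _ => True
  | t + 1, B, h =>
    (∀ B' ⊆ B, AGood n w t B' h) ∧
    (∀ q, q ≠ h → Free B q → B.card < w → AGood n w t (insert (q, q) B) h) ∧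
    (B.card < w → ∃ e h', Free B e ∧ Free B h' ∧ 0 ≤ h' ∧ h' < n ∧
      ((h < e ∧ h' = e + 1) ∨ (e < h ∧ h' = e - 1)) ∧
      AGood n w t (merge B (min h e) (max h e)) h')

theorem AGood.of_succ {n : ℤ} {w : ℕ} : ∀ {t : ℕ} {B : Finset (ℤ × ℤ)} {h : ℤ},
    AGood n w (t + 1) B h → AGood n w t B h
  | 0, _, _, _ => trivial
  | t + 1, B, h, H => by
    obtain ⟨H1, H2, H3⟩ := H
    refine ⟨fun B' hB' => (H1 B' hB').of_succ, fun q hq hf hc => (H2 q hq hf hc).of_succ,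
      fun hc => ?_⟩
    obtain ⟨e, h', he, hh', h0, hn, hor, hg⟩ := H3 hc
    exact ⟨e, h', he, hh', h0, hn, hor, hg.of_succ⟩

theorem AGood.mono {n : ℤ} {w s t : ℕ} {B : Finset (ℤ × ℤ)} {h : ℤ} (hst : s ≤ t)
    (H : AGood n w t B h) : AGood n w s B h := by
  induction t, hst using Nat.le_induction with
  | base => exact H
  | succ t _ ih => exact ih H.of_succ

theorem Free.subset {B B' : Finset (ℤ × ℤ)} {x : ℤ} (H : Free B x) (hB : B' ⊆ B) : Free B' x :=
  fun b hb => H b (hB hb)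

theorem Free.insert {B : Finset (ℤ × ℤ)} {x : ℤ} (H : Free B x) {b : ℤ × ℤ}
    (hb : ¬(b.1 ≤ x ∧ x ≤ b.2)) : Free (insert b B) x := by
  intro c hc
  rcases Finset.mem_insert.1 hc with rfl | hc
  · exact hb
  · exact H c hc

theorem Free.merge {B : Finset (ℤ × ℤ)} {x a c : ℤ} (H : Free B x) (hx : ¬(a ≤ x ∧ x ≤ c)) :
    Free (merge B a c) x :=
  (H.subset (Finset.filter_subset _ _)).insert hx

theorem WF.subset {B B' : Finset (ℤ × ℤ)} (H : WF B) (hB : B' ⊆ B) : WF B' :=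
  ⟨fun b hb => H.1 b (hB hb), fun b hb c hc => H.2 b (hB hb) c (hB hc)⟩

theorem WF.insert {B : Finset (ℤ × ℤ)} (H : WF B) {b : ℤ × ℤ} (hb : b.1 ≤ b.2)
    (hd : ∀ c ∈ B, b.2 < c.1 ∨ c.2 < b.1) : WF (insert b B) := by
  refine ⟨fun c hc => ?_, fun c hc d hd' hne => ?_⟩
  · rcases Finset.mem_insert.1 hc with rfl | hc
    · exact hb
    · exact H.1 c hc
  · rcases Finset.mem_insert.1 hc with h1 | h1 <;> rcases Finset.mem_insert.1 hd' with h2 | h2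
    · exact absurd (h1.trans h2.symm) hne
    · exact h1 ▸ hd d h2
    · exact h2 ▸ (hd c h1).symm
    · exact H.2 c h1 d h2 hne

theorem WF.insert_dot {B : Finset (ℤ × ℤ)} (H : WF B) {q : ℤ} (hq : Free B q) :
    WF (Insert.insert (q, q) B) := by
  refine H.insert le_rfl fun c hc => ?_
  have := hq c hc
  simp only
  omega

theorem WF.merge {B : Finset (ℤ × ℤ)} (H : WF B) {a c : ℤ} (hac : a ≤ c) (ha : Free B a)
    (hc : Free B c) : WF (merge B a c) := by
  refine (H.subset (Finset.filter_subset _ _)).insert hac fun b hb => ?_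
  obtain ⟨hb, hn⟩ := Finset.mem_filter.1 hb
  have h1 := ha b hb
  have h2 := hc b hb
  have h3 := H.1 b hb
  simp only
  omega

theorem mem_merge {B : Finset (ℤ × ℤ)} {a c : ℤ} {b : ℤ × ℤ} (hb : b ∈ merge B a c) :
    b = (a, c) ∨ (b ∈ B ∧ ¬(a ≤ b.1 ∧ b.2 ≤ c)) := by
  rcases Finset.mem_insert.1 hb with h | h
  · exact Or.inl h
  · exact Or.inr (Finset.mem_filter.1 h)

theorem card_merge_le {B : Finset (ℤ × ℤ)} {a c : ℤ} {w : ℕ} (hw : B.card < w) :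
    (merge B a c).card ≤ w :=
  (Finset.card_insert_le _ _).trans
    ((Nat.succ_le_succ (Finset.card_le_card (Finset.filter_subset _ _))).trans hw)

/-! ### Mirror symmetry -/

/-- Reflection of an interval of `[0, n)`. -/
def mir (n : ℤ) (b : ℤ × ℤ) : ℤ × ℤ := (n - 1 - b.2, n - 1 - b.1)

theorem mir_mir (n : ℤ) (b : ℤ × ℤ) : mir n (mir n b) = b := by
  simp [mir]

theorem mir_injective (n : ℤ) : Function.Injective (mir n) :=
  (show Function.Involutive (mir n) from mir_mir n).injective

/-- Reflection of a family of blocks. -/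
def mirB (n : ℤ) (B : Finset (ℤ × ℤ)) : Finset (ℤ × ℤ) := B.image (mir n)

theorem mirB_mirB (n : ℤ) (B : Finset (ℤ × ℤ)) : mirB n (mirB n B) = B := by
  rw [mirB, mirB, Finset.image_image]
  simp [Function.comp_def, mir_mir]

theorem mem_mirB {n : ℤ} {B : Finset (ℤ × ℤ)} {b : ℤ × ℤ} : b ∈ mirB n B ↔ mir n b ∈ B := by
  rw [mirB, Finset.mem_image]
  constructor
  · rintro ⟨c, hc, rfl⟩
    rwa [mir_mir]
  · exact fun h => ⟨_, h, mir_mir n b⟩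

theorem card_mirB (n : ℤ) (B : Finset (ℤ × ℤ)) : (mirB n B).card = B.card :=
  Finset.card_image_of_injective _ (mir_injective n)

theorem free_mirB {n : ℤ} {B : Finset (ℤ × ℤ)} {x : ℤ} :
    Free (mirB n B) x ↔ Free B (n - 1 - x) := by
  constructor
  · intro H b hb
    have := H (mir n b) (mem_mirB.2 (by rwa [mir_mir]))
    simp only [mir] at this
    omega
  · intro H b hb
    have := H _ (mem_mirB.1 hb)
    simp only [mir] at this
    omega

theorem WF.mirB {n : ℤ} {B : Finset (ℤ × ℤ)} (H : WF B) : WF (mirB n B) := by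
  refine ⟨fun b hb => ?_, fun b hb c hc hne => ?_⟩
  · have := H.1 _ (mem_mirB.1 hb)
    simp only [mir] at this
    omega
  · have := H.2 _ (mem_mirB.1 hb) _ (mem_mirB.1 hc) ((mir_injective n).ne hne)
    simp only [mir] at this
    omega

theorem mirB_insert (n : ℤ) (B : Finset (ℤ × ℤ)) (b : ℤ × ℤ) :
    mirB n (insert b B) = insert (mir n b) (mirB n B) :=
  Finset.image_insert _ _ _

theorem mirB_merge (n : ℤ) (B : Finset (ℤ × ℤ)) (a c : ℤ) :
    mirB n (merge B a c) = merge (mirB n B) (n - 1 - c) (n - 1 - a) := by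
  rw [merge, mirB_insert, merge]
  congr 1
  ext b
  rw [mem_mirB, Finset.mem_filter, Finset.mem_filter, mem_mirB]
  simp only [mir]
  refine and_congr_right fun _ => not_congr ?_
  omega

theorem AGood.mirror {n : ℤ} {w : ℕ} : ∀ {t : ℕ} {B : Finset (ℤ × ℤ)} {h : ℤ},
    AGood n w t B h → AGood n w t (mirB n B) (n - 1 - h)
  | 0, _, _, _ => trivial
  | t + 1, B, h, H => by
    obtain ⟨H1, H2, H3⟩ := H
    refine ⟨fun B' hB' => ?_, fun q hq hf hc => ?_, fun hc => ?_⟩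
    · have := (H1 (mirB n B') fun b hb => ?_).mirror
      · rwa [mirB_mirB] at this
      · have := hB' (mem_mirB.1 hb)
        rwa [mem_mirB, mir_mir] at this
    · have := (H2 (n - 1 - q) (by omega) (free_mirB.1 hf) (by rwa [card_mirB] at hc)).mirror
      rw [mirB_insert] at this
      simpa [mir] using this
    · obtain ⟨e, h', he, hh', h0, hn, hor, hg⟩ := H3 (by rwa [card_mirB] at hc)
      refine ⟨n - 1 - e, n - 1 - h', ?_, ?_, by omega, by omega, by omega, ?_⟩
      · rw [free_mirB]; simpa using he
      · rw [free_mirB]; simpa using hh'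
      · have := hg.mirror
        rw [mirB_merge] at this
        convert this using 2 <;> omega

theorem AGood.of_mirror {n : ℤ} {w t : ℕ} {B : Finset (ℤ × ℤ)} {h : ℤ}
    (H : AGood n w t (mirB n B) (n - 1 - h)) : AGood n w t B h := by
  have := H.mirror
  rwa [mirB_mirB, sub_sub_cancel] at this

/-! ### Free windows and sweeps -/

/-- The number of cells of the block `b` outside `Z`. -/
noncomputable def cnt (Z : Finset ℤ) (b : ℤ × ℤ) : ℕ := (Finset.Icc b.1 b.2 \ Z).card

theorem cnt_anti {Z Z' : Finset ℤ} (h : Z ⊆ Z') (b : ℤ × ℤ) : cnt Z' b ≤ cnt Z b :=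
  Finset.card_le_card (Finset.sdiff_subset_sdiff le_rfl h)

theorem cnt_dot_le (Z : Finset ℤ) (q : ℤ) : cnt Z (q, q) ≤ 1 := by
  refine (Finset.card_le_card Finset.sdiff_subset).trans ?_
  simp

theorem exists_free_window {w ℓ : ℕ} {B : Finset (ℤ × ℤ)} (hB : B.card ≤ w) {j : ℤ}
    (hb : ∀ b ∈ B, (Finset.Icc b.1 b.2 ∩ Finset.Ico j (j + 2 * ℓ * (w + 1))).card ≤ ℓ) :
    ∃ v, j ≤ v ∧ v + ℓ ≤ j + 2 * ℓ * (w + 1) ∧ ∀ x, v ≤ x → x < v + ℓ → Free B x := by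
  by_contra! H
  have key : ∀ i : ℕ, i ∈ Finset.range (w + 1) → ∃ b ∈ B, ∃ x, j + 2 * ℓ * i ≤ x ∧
      x < j + 2 * ℓ * i + ℓ ∧ b.1 ≤ x ∧ x ≤ b.2 := by
    intro i hi
    have hi' : (i : ℤ) + 1 ≤ w + 1 := by
      have := Finset.mem_range.1 hi
      omega
    have h0 : (0 : ℤ) ≤ 2 * ℓ * i := by positivity
    obtain ⟨x, h1, h2, h3⟩ := H (j + 2 * ℓ * i) (by omega) (by nlinarith)
    rw [Free] at h3
    push Not at h3
    obtain ⟨b, hb1, hb2, hb3⟩ := h3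
    exact ⟨b, hb1, x, h1, h2, hb2, hb3⟩
  choose! f hf x hx1 hx2 hx3 hx4 using key
  obtain ⟨i, hi, k, hk, hne, heq⟩ := Finset.exists_ne_map_eq_of_card_lt_of_maps_to
    (s := Finset.range (w + 1)) (t := B) (f := f) (by simpa using hB) hf
  wlog hlt : i < k generalizing i k
  · exact this k hk i hi hne.symm heq.symm (by omega)
  have hik : (i : ℤ) + 1 ≤ k := by exact_mod_cast hlt
  have hkw : (k : ℤ) + 1 ≤ w + 1 := by
    have := Finset.mem_range.1 hk
    omega
  have hsub : Finset.Icc (j + 2 * ℓ * i + ℓ - 1) (j + 2 * ℓ * i + 2 * ℓ) ⊆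
      Finset.Icc (f i).1 (f i).2 ∩ Finset.Ico j (j + 2 * ℓ * (w + 1)) := by
    intro y hy
    rw [Finset.mem_Icc] at hy
    have a1 := hx2 i hi
    have a2 := hx3 i hi
    have a3 := hx1 k hk
    have a4 := hx4 k hk
    have a5 := hx1 i hi
    have a6 := hx2 k hk
    rw [← heq] at a4
    have e1 : (2 * ℓ * i + 2 * ℓ : ℤ) ≤ 2 * ℓ * k := by nlinarith
    have e2 : (2 * ℓ * k + 2 * ℓ : ℤ) ≤ 2 * ℓ * (w + 1) := by nlinarith
    have e3 : (0 : ℤ) ≤ 2 * ℓ * i := by positivity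
    rw [Finset.mem_inter, Finset.mem_Icc, Finset.mem_Ico]
    refine ⟨⟨by omega, by omega⟩, by omega, by omega⟩
  have h1 := (Finset.card_le_card hsub).trans (hb _ (hf i hi))
  rw [Int.card_Icc] at h1
  omega

theorem card_inter_le_of_cnt {Z J : Finset ℤ} {b : ℤ × ℤ} {c m : ℕ} (hb : cnt Z b ≤ c)
    (hZ : (Z ∩ J).card + c ≤ m) : (Finset.Icc b.1 b.2 ∩ J).card ≤ m := by
  have : Finset.Icc b.1 b.2 ∩ J ⊆ (Finset.Icc b.1 b.2 \ Z) ∪ (Z ∩ J) := by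
    intro x
    simp only [Finset.mem_inter, Finset.mem_union, Finset.mem_sdiff]
    tauto
  have h := (Finset.card_le_card this).trans (Finset.card_union_le _ _)
  simp only [cnt] at hb
  omega

/-- A jump to the nearest pair of adjacent free cells creates a block with few cells off `Z`. -/
theorem cnt_jump_le {B : Finset (ℤ × ℤ)} {Z : Finset ℤ} {w : ℕ} {h e : ℤ} (hB : B.card < w)
    (hh : Free B h) (hmin : ∀ x, h < x → x < e → Free B x → ¬Free B (x + 1))
    (hcnt : ∀ b ∈ B, h < b.1 → cnt Z b ≤ 1) : cnt Z (h, e) ≤ 2 * w := by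
  classical
  have hsub : Finset.Icc h e \ Z ⊆ {h, e} ∪ B.biUnion fun b =>
      if h < b.1 then insert (b.1 - 1) (Finset.Icc b.1 b.2 \ Z) else ∅ := by
    intro x hx
    rw [Finset.mem_sdiff, Finset.mem_Icc] at hx
    rw [Finset.mem_union, Finset.mem_biUnion]
    by_cases h1 : x = h
    · simp [h1]
    by_cases h2 : x = e
    · simp [h2]
    right
    by_cases hf : Free B x
    · have := hmin x (by omega) (by omega) hf
      rw [Free] at this
      push Not at this
      obtain ⟨b, hb, hb1, hb2⟩ := this
      have h3 := hf b hb
      refine ⟨b, hb, ?_⟩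
      rw [if_pos (by omega)]
      exact Finset.mem_insert.2 (Or.inl (by omega))
    · rw [Free] at hf
      push Not at hf
      obtain ⟨b, hb, hb1, hb2⟩ := hf
      have h3 := hh b hb
      refine ⟨b, hb, ?_⟩
      rw [if_pos (by omega)]
      exact Finset.mem_insert_of_mem (Finset.mem_sdiff.2 ⟨Finset.mem_Icc.2 ⟨hb1, hb2⟩, hx.2⟩)
  have h1 := (Finset.card_le_card hsub).trans (Finset.card_union_le _ _)
  have h2 : (B.biUnion fun b =>
      if h < b.1 then insert (b.1 - 1) (Finset.Icc b.1 b.2 \ Z) else ∅).card ≤ B.card * 2 := by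
    refine Finset.card_biUnion_le_card_mul _ _ _ fun b hb => ?_
    split_ifs with hlt
    · have := hcnt b hb hlt
      exact (Finset.card_insert_le _ _).trans (Nat.succ_le_succ this)
    · simp
  have h3 : ({h, e} : Finset ℤ).card ≤ 2 := Finset.card_le_two
  simp only [cnt]
  omega

theorem exists_least_free_pair {B : Finset (ℤ × ℤ)} {h v : ℤ} (hv : h < v) (h1 : Free B v)
    (h2 : Free B (v + 1)) : ∃ e, h < e ∧ e ≤ v ∧ Free B e ∧ Free B (e + 1) ∧
      ∀ x, h < x → x < e → Free B x → ¬Free B (x + 1) := by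
  classical
  have hex : ∃ k : ℕ, Free B (h + 1 + k) ∧ Free B (h + 1 + k + 1) := by
    refine ⟨(v - (h + 1)).toNat, ?_⟩
    rw [Int.toNat_of_nonneg (by omega), add_sub_cancel]
    exact ⟨h1, h2⟩
  refine ⟨h + 1 + Nat.find hex, by omega, ?_, (Nat.find_spec hex).1, (Nat.find_spec hex).2, ?_⟩
  · have : Nat.find hex ≤ (v - (h + 1)).toNat := Nat.find_le (by
      rw [Int.toNat_of_nonneg (by omega), add_sub_cancel]
      exact ⟨h1, h2⟩)
    omega
  · intro x hx hxe hf hf'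
    refine Nat.find_min hex (m := (x - (h + 1)).toNat) (by omega) ?_
    rw [Int.toNat_of_nonneg (by omega), add_sub_cancel]
    exact ⟨hf, hf'⟩

/-- The region length used when moving the hot cell into a free window of length `L`. -/
def regionLen (L w : ℕ) : ℤ := 4 * (L + 2) * (w + 1)

/-- The hot cell has reached a free window `[u, u + L)` inside the region starting at `j`. -/
structure MacroStart (w L : ℕ) (P : ℤ × ℤ → Prop) (Z : Finset ℤ) (j : ℤ) (B : Finset (ℤ × ℤ))
    (h u : ℤ) : Prop where
  wf : WF B
  card_le : B.card ≤ w
  prop : ∀ b ∈ B, P b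
  free : ∀ x, u ≤ x → x < u + L → Free B x
  le_hot : u ≤ h
  hot_lt : h < u + L
  le_left : j ≤ u
  right_le : u + L ≤ j + regionLen L w
  cnt_le : ∀ b ∈ B, cnt (Z ∪ Finset.Ico j (j + regionLen L w)) b ≤ 2 * w

theorem AGood.sweep_right {n : ℤ} {w L : ℕ} {P : ℤ × ℤ → Prop} {Z : Finset ℤ} {α β j : ℤ} {T : ℕ}
    (hL : 1 ≤ L) (hα : 0 ≤ α) (hj : α ≤ j) (hjβ : j + regionLen L w ≤ β) (hβ : β ≤ n)
    (hPdot : ∀ q, P (q, q)) (hPblock : ∀ a c, α ≤ a → a ≤ c → c < β → P (a, c))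
    (hZ : (Z ∩ Finset.Ico j (j + regionLen L w)).card + 2 * w ≤ L + 2)
    (hT : ∀ B h u, MacroStart w L P Z j B h u → AGood n w T B h) :
    ∀ s ≤ T + 1, ∀ B h, WF B → B.card ≤ w → Free B h → α ≤ h →
      h < j + 2 * (L + 2) * (w + 1) → (∀ b ∈ B, P b) → (∀ b ∈ B, cnt Z b ≤ 2 * w) →
      (∀ b ∈ B, h < b.1 → cnt Z b ≤ 1) → AGood n w s B h := by
  have hreg : regionLen L w = 2 * (L + 2) * (w + 1) + 2 * (L + 2) * (w + 1) := by
    rw [regionLen]; ring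
  have hpos : (0 : ℤ) < 2 * (L + 2) * (w + 1) := by positivity
  set X : ℤ := 2 * (L + 2) * (w + 1) with hX
  intro s
  induction s with
  | zero => intros; trivial
  | succ s ih =>
    intro hs B h hwf hcard hh hαh hhj hP hcnt hahead
    refine ⟨fun B' hB' => ?_, fun q hq hf hc => ?_, fun hc => ?_⟩
    · exact ih (by omega) B' h (hwf.subset hB') ((Finset.card_le_card hB').trans hcard)
        (hh.subset hB') hαh hhj (fun b hb => hP b (hB' hb)) (fun b hb => hcnt b (hB' hb))
        fun b hb => hahead b (hB' hb)
    · refine ih (by omega) _ h (hwf.insert_dot hf) ((Finset.card_insert_le _ _).trans hc)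
        (hh.insert (by simp only; omega)) hαh hhj ?_ ?_ ?_
      · intro b hb
        rcases Finset.mem_insert.1 hb with rfl | hb
        · exact hPdot q
        · exact hP b hb
      · intro b hb
        rcases Finset.mem_insert.1 hb with rfl | hb
        · have := cnt_dot_le Z q
          omega
        · exact hcnt b hb
      · intro b hb
        rcases Finset.mem_insert.1 hb with rfl | hb
        · exact fun _ => cnt_dot_le Z q
        · exact hahead b hb
    · have hwin : ∀ j', j ≤ j' → j' + X ≤ j + regionLen L w → ∃ v, j' ≤ v ∧
          v + (L + 2 : ℕ) ≤ j' + X ∧ ∀ x, v ≤ x → x < v + (L + 2 : ℕ) → Free B x := by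
        intro j' h1 h2
        have := exists_free_window (w := w) (ℓ := L + 2) hcard (j := j') fun b hb => ?_
        · simpa [hX] using this
        · refine (Finset.card_le_card (Finset.inter_subset_inter_left ?_)).trans
            (card_inter_le_of_cnt (hcnt b hb) hZ)
          refine Finset.Ico_subset_Ico h1 ?_
          simpa [hX] using h2
      rcases lt_or_ge h j with hlt | hge
      · obtain ⟨v, hv1, hv2, hv3⟩ := hwin j le_rfl (by omega)
        push_cast at hv2 hv3
        obtain ⟨e, he1, he2, he3, he4, he5⟩ := exists_least_free_pair (h := h) (v := v) (by omega)
          (hv3 v le_rfl (by omega)) (hv3 (v + 1) (by omega) (by omega))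
        refine ⟨e, e + 1, he3, he4, by omega, by omega, Or.inl ⟨he1, rfl⟩, ?_⟩
        rw [min_eq_left he1.le, max_eq_right he1.le]
        refine ih (by omega) _ _ (hwf.merge he1.le hh he3) (card_merge_le hc)
          (he4.merge (by omega)) (by omega) (by omega) ?_ ?_ ?_
        · intro b hb
          rcases mem_merge hb with rfl | ⟨hb, -⟩
          · exact hPblock _ _ hαh he1.le (by omega)
          · exact hP b hb
        · intro b hb
          rcases mem_merge hb with rfl | ⟨hb, -⟩
          · exact cnt_jump_le hc hh he5 hahead
          · exact hcnt b hb
        · intro b hb hlt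
          rcases mem_merge hb with rfl | ⟨hb, -⟩
          · simp only at hlt
            omega
          · exact hahead b hb (by omega)
      · obtain ⟨v, hv1, hv2, hv3⟩ := hwin (j + X) (by omega) (by omega)
        push_cast at hv2 hv3
        have hhv : h < v := by omega
        have hv : Free B v := hv3 v le_rfl (by omega)
        refine ⟨v, v + 1, hv, hv3 _ (by omega) (by omega), by omega, by omega,
          Or.inl ⟨hhv, rfl⟩, ?_⟩
        rw [min_eq_left hhv.le, max_eq_right hhv.le]
        refine (hT _ _ (v + 1) ⟨hwf.merge hhv.le hh hv, card_merge_le hc, ?_, ?_, le_rfl,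
          by omega, by omega, by omega, ?_⟩).mono (by omega)
        · intro b hb
          rcases mem_merge hb with rfl | ⟨hb, -⟩
          · exact hPblock _ _ hαh hhv.le (by omega)
          · exact hP b hb
        · exact fun x hx1 hx2 => (hv3 x (by omega) (by omega)).merge (by omega)
        · intro b hb
          rcases mem_merge hb with rfl | ⟨hb, -⟩
          · rw [cnt, Finset.sdiff_eq_empty_iff_subset.2]
            · simp
            · refine fun x hx => Finset.mem_union_right _ ?_
              rw [Finset.mem_Icc] at hx
              rw [Finset.mem_Ico]
              simp only at hx
              omega
          · exact (cnt_anti Finset.subset_union_left b).trans (hcnt b hb)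

theorem cnt_mir (n : ℤ) (Z : Finset ℤ) (b : ℤ × ℤ) :
    cnt (Z.image fun x => n - 1 - x) (mir n b) = cnt Z b := by
  have hinj : Function.Injective fun x : ℤ => n - 1 - x := fun x y h => by
    simp only at h
    omega
  refine Eq.trans ?_ (Finset.card_image_of_injective (Finset.Icc b.1 b.2 \ Z) hinj)
  rw [cnt]
  congr 1
  ext x
  simp only [Finset.mem_sdiff, Finset.mem_Icc, Finset.mem_image, mir]
  constructor
  · rintro ⟨h1, h2⟩
    exact ⟨n - 1 - x, ⟨by omega, fun h => h2 ⟨_, h, by omega⟩⟩, by omega⟩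
  · rintro ⟨y, ⟨h1, h2⟩, rfl⟩
    refine ⟨by omega, ?_⟩
    rintro ⟨z, hz, hzy⟩
    obtain rfl : z = y := by omega
    exact h2 hz

theorem image_reflect_Ico (n a c : ℤ) :
    (Finset.Ico a c).image (fun x => n - 1 - x) = Finset.Ico (n - c) (n - a) := by
  ext x
  simp only [Finset.mem_image, Finset.mem_Ico]
  constructor
  · rintro ⟨y, hy, rfl⟩
    omega
  · exact fun h => ⟨n - 1 - x, by omega, by omega⟩

theorem AGood.sweep_left {n : ℤ} {w L : ℕ} {P : ℤ × ℤ → Prop} {Z : Finset ℤ} {α β j : ℤ} {T : ℕ}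
    (hL : 1 ≤ L) (hα : 0 ≤ α) (hj : α ≤ j) (hjβ : j + regionLen L w ≤ β) (hβ : β ≤ n)
    (hPdot : ∀ q, P (q, q)) (hPblock : ∀ a c, α ≤ a → a ≤ c → c < β → P (a, c))
    (hZ : (Z ∩ Finset.Ico j (j + regionLen L w)).card + 2 * w ≤ L + 2)
    (hT : ∀ B h u, MacroStart w L P Z j B h u → AGood n w T B h)
    {B : Finset (ℤ × ℤ)} {h : ℤ} (hwf : WF B) (hcard : B.card ≤ w) (hh : Free B h)
    (hhβ : h < β) (hjh : j + regionLen L w ≤ h) (hP : ∀ b ∈ B, P b)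
    (hcnt : ∀ b ∈ B, cnt Z b ≤ 2 * w) (hahead : ∀ b ∈ B, b.2 < h → cnt Z b ≤ 1) :
    AGood n w (T + 1) B h := by
  have hinj : Function.Injective fun x : ℤ => n - 1 - x := fun x y h => by
    simp only at h
    omega
  have hpos : (0 : ℤ) < 2 * (L + 2) * (w + 1) := by positivity
  have hinv : (Z.image fun x => n - 1 - x).image (fun x => n - 1 - x) = Z := by
    rw [Finset.image_image]
    simp
  have hregion : (Finset.Ico j (j + regionLen L w)).image (fun x => n - 1 - x) =
      Finset.Ico (n - (j + regionLen L w)) (n - (j + regionLen L w) + regionLen L w) := by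
    rw [image_reflect_Ico]
    congr 1
    ring
  apply AGood.of_mirror
  refine AGood.sweep_right (P := fun b => P (mir n b)) (Z := Z.image fun x => n - 1 - x)
    (α := n - β) (β := n - α) (j := n - (j + regionLen L w)) (T := T) hL (by omega) (by omega)
    (by omega) (by omega) (fun q => hPdot _)
    (fun a c h1 h2 h3 => hPblock _ _ (by omega) (by omega) (by omega)) ?_ ?_ _ le_rfl _ _
    hwf.mirB (by rwa [card_mirB]) (by rw [free_mirB, sub_sub_cancel]; exact hh) (by omega)
    (by omega) ?_ ?_ ?_
  · rw [← hregion, ← Finset.image_inter _ _ hinj, Finset.card_image_of_injective _ hinj]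
    exact hZ
  · intro B' h' u hM
    apply AGood.of_mirror
    refine hT _ _ (n - (u + L)) ⟨hM.wf.mirB, by rw [card_mirB]; exact hM.card_le, ?_, ?_, ?_, ?_,
      ?_, ?_, ?_⟩
    · intro b hb
      simpa only [mir_mir] using hM.prop _ (mem_mirB.1 hb)
    · intro x h1 h2
      rw [free_mirB]
      exact hM.free _ (by omega) (by omega)
    · have := hM.hot_lt
      omega
    · have := hM.le_hot
      omega
    · have := hM.right_le
      omega
    · have := hM.le_left
      omega
    · intro b hb
      have := hM.cnt_le _ (mem_mirB.1 hb)
      rwa [← hregion, ← Finset.image_union, cnt_mir] at this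
  · intro b hb
    exact hP _ (mem_mirB.1 hb)
  · intro b hb
    have := hcnt _ (mem_mirB.1 hb)
    rwa [← cnt_mir n, mir_mir] at this
  · intro b hb hlt
    have := hahead _ (mem_mirB.1 hb) (by simp only [mir]; omega)
    rwa [← cnt_mir n, mir_mir] at this

/-! ### Amplification -/

/-- Starting from a free window of length `L` around the hot cell, the adversary gains `F` rounds
while all new blocks other than single cells stay inside the window. -/
def WindowGain (n : ℤ) (w L F : ℕ) : Prop :=
  ∀ (B₀ : Finset (ℤ × ℤ)) (h α : ℤ), WF B₀ → B₀.card ≤ w →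
    (∀ x, α ≤ x → x < α + L → Free B₀ x) → α ≤ h → h < α + L → 0 ≤ α → α + L ≤ n →
    ∀ t : ℕ, (∀ B h', WF B → B.card ≤ w → Free B h' → α ≤ h' → h' < α + L →
      (∀ b ∈ B, b ∈ B₀ ∨ b.1 = b.2 ∨ (α ≤ b.1 ∧ b.2 < α + L)) → AGood n w t B h') →
    AGood n w (t + F) B₀ h

/-- The union of the regions of length `X` with left ends in `Y`. -/
noncomputable def regions (X : ℤ) (Y : Finset ℤ) : Finset ℤ := Y.biUnion fun y => Finset.Ico y (y + X)

theorem mem_regions {X x : ℤ} {Y : Finset ℤ} :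
    x ∈ regions X Y ↔ ∃ y ∈ Y, y ≤ x ∧ x < y + X := by
  simp [regions]

/-- Separated regions touched by blocks that are mostly covered by the regions number at most as
many as the blocks. -/
theorem card_touched_le {X α β : ℤ} {B : Finset (ℤ × ℤ)} {Y Y' O E : Finset ℤ}
    (hE : ∀ x ∈ E, ¬(α ≤ x ∧ x < β)) (hY : ∀ y ∈ Y, α ≤ y ∧ y + X ≤ β)
    (hsep : ∀ y ∈ Y, ∀ z ∈ Y, y ≠ z → 2 * X ≤ |y - z|) (hX : (O.card : ℤ) + 1 < X)
    (hcnt : ∀ b ∈ B, cnt (O ∪ regions X Y ∪ E) b ≤ 1) (hY' : Y' ⊆ Y)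
    (htouch : ∀ y ∈ Y', ∃ b ∈ B, ∃ x, y ≤ x ∧ x < y + X ∧ b.1 ≤ x ∧ x ≤ b.2) :
    Y'.card ≤ B.card := by
  choose! f hf x hx1 hx2 hx3 hx4 using htouch
  refine Finset.card_le_card_of_injOn f hf fun y hy z hz heq => ?_
  rw [Finset.mem_coe] at hy hz
  by_contra hne
  wlog hlt : y < z generalizing y z
  · exact this z hz y hy heq.symm (Ne.symm hne) (by omega)
  have hyz := hsep y (hY' hy) z (hY' hz) hne
  rw [abs_of_neg (by omega)] at hyz
  have hsub : Finset.Ico (y + X) (y + 2 * X) ⊆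
      O ∪ (Finset.Icc (f y).1 (f y).2 \ (O ∪ regions X Y ∪ E)) := by
    intro p hp
    rw [Finset.mem_Ico] at hp
    have hpE : p ∉ E := fun h => hE p h (by
      have := hY y (hY' hy)
      have := hY z (hY' hz)
      omega)
    have hpR : p ∉ regions X Y := by
      rw [mem_regions]
      rintro ⟨v, hv, hv1, hv2⟩
      rcases eq_or_ne y v with rfl | hyv
      · omega
      · have := hsep y (hY' hy) v hv hyv
        rcases abs_cases (y - v) with ⟨h1, h2⟩ | ⟨h1, h2⟩ <;> omega
    have hpb : p ∈ Finset.Icc (f y).1 (f y).2 := by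
      have a1 := hx2 y hy
      have a2 := hx3 y hy
      have a3 := hx1 z hz
      have a4 := hx4 z hz
      rw [← heq] at a4
      rw [Finset.mem_Icc]
      omega
    rw [Finset.mem_union, Finset.mem_sdiff, Finset.mem_union, Finset.mem_union]
    tauto
  have h1 := (Finset.card_le_card hsub).trans (Finset.card_union_le _ _)
  have h2 := hcnt _ (hf y hy)
  rw [cnt] at h2
  rw [Int.card_Ico] at h1
  omega

theorem exists_far_point {X α : ℤ} {w : ℕ} {Y : Finset ℤ} (hX : 0 < X) (hY : Y.card ≤ w) :
    ∃ j, α ≤ j ∧ j ≤ α + 4 * X * w ∧ ∀ y ∈ Y, 2 * X ≤ |j - y| := by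
  by_contra! H
  have key : ∀ i ∈ Finset.range (w + 1), ∃ y ∈ Y, |α + 4 * X * i - y| < 2 * X := by
    intro i hi
    have hi' : (i : ℤ) ≤ w := by
      have := Finset.mem_range.1 hi
      omega
    have h0 : 0 ≤ 4 * X * i := by positivity
    exact H _ (by omega) (by nlinarith)
  choose! f hf hlt using key
  obtain ⟨i, hi, k, hk, hne, heq⟩ := Finset.exists_ne_map_eq_of_card_lt_of_maps_to
    (s := Finset.range (w + 1)) (t := Y) (f := f) (by simp; omega) hf
  wlog hik : i < k generalizing i k
  · exact this k hk i hi hne.symm heq.symm (by omega)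
  have h1 := abs_lt.1 (hlt i hi)
  have h2 := abs_lt.1 (hlt k hk)
  rw [heq] at h1
  have h3 : (i : ℤ) + 1 ≤ k := by exact_mod_cast hik
  nlinarith

theorem WindowGain.amplify {n : ℤ} {w L F R : ℕ} (hL : 1 ≤ L)
    (hR : R * (2 * w ^ 2) + 2 * w ≤ L + 2) (hK : WindowGain n w L F) :
    WindowGain n w (16 * (L + 2) * (w + 1) * (w + 2)) (R * (F + 1)) := by
  classical
  intro B₀ h₀ α hwf₀ hcard₀ hfree₀ hαh₀ hh₀ hα hαn t hpost
  obtain ⟨β, hβ⟩ : ∃ β, β = α + (16 * (L + 2) * (w + 1) * (w + 2) : ℕ) := ⟨_, rfl⟩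
  rw [← hβ] at hfree₀ hh₀ hαn hpost
  obtain ⟨X, hX⟩ : ∃ X, X = regionLen L w := ⟨_, rfl⟩
  have hXL : 4 * ((L : ℤ) + 2) ≤ X := by
    rw [hX, regionLen]
    nlinarith
  have hβX : β = α + 4 * X * (w + 1) + 4 * X := by
    rw [hβ, hX, regionLen]
    push_cast
    ring
  obtain ⟨P, hP⟩ : ∃ P : ℤ × ℤ → Prop,
    P = fun b => b ∈ B₀ ∨ b.1 = b.2 ∨ (α ≤ b.1 ∧ b.2 < β) := ⟨_, rfl⟩
  obtain ⟨E, hEdef⟩ : ∃ E : Finset ℤ, E = B₀.biUnion fun b => Finset.Icc b.1 b.2 := ⟨_, rfl⟩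
  have hE : ∀ x ∈ E, ¬(α ≤ x ∧ x < β) := by
    intro x hx hx'
    rw [hEdef, Finset.mem_biUnion] at hx
    obtain ⟨b, hb, hxb⟩ := hx
    exact hfree₀ x hx'.1 hx'.2 b hb (Finset.mem_Icc.1 hxb)
  have ready : ∀ m ≤ R, ∀ (B : Finset (ℤ × ℤ)) (h : ℤ) (Y O : Finset ℤ), WF B → B.card ≤ w →
      Free B h → α ≤ h → h < β → (∀ b ∈ B, P b) → (∀ y ∈ Y, α ≤ y ∧ y + X ≤ β) →
      (∀ y ∈ Y, ∀ z ∈ Y, y ≠ z → 2 * X ≤ |y - z|) → O.card ≤ (R - m) * (2 * w ^ 2) →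
      (∀ b ∈ B, cnt (O ∪ regions X Y ∪ E) b ≤ 1) → AGood n w (t + m * (F + 1)) B h := by
    intro m
    induction m with
    | zero =>
      intro _ B h Y O hwf hcard hh hαh hhβ hPB _ _ _ _
      rw [Nat.zero_mul, Nat.add_zero]
      subst hP
      exact hpost B h hwf hcard hh hαh hhβ hPB
    | succ m ih =>
      intro hm B h Y O hwf hcard hh hαh hhβ hPB hY hsep hO hcnt
      have hOR : O.card + 2 * w ≤ L + 2 := by
        have := hO.trans (Nat.mul_le_mul_right (2 * w ^ 2) (Nat.sub_le R (m + 1)))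
        omega
      obtain ⟨Y₁, hY₁⟩ : ∃ Y₁ : Finset ℤ, Y₁ = Y.filter fun y =>
        ∃ b ∈ B, ∃ x, y ≤ x ∧ x < y + X ∧ b.1 ≤ x ∧ x ≤ b.2 := ⟨_, rfl⟩
      have hsub : Y₁ ⊆ Y := by rw [hY₁]; exact Finset.filter_subset _ _
      have hY₁card : Y₁.card ≤ w := by
        refine (card_touched_le hE hY hsep (by omega) hcnt hsub fun y hy => ?_).trans hcard
        rw [hY₁] at hy
        exact (Finset.mem_filter.1 hy).2
      obtain ⟨Z, hZdef⟩ : ∃ Z, Z = O ∪ regions X Y₁ ∪ E := ⟨_, rfl⟩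
      have hcnt₁ : ∀ b ∈ B, cnt Z b ≤ 1 := by
        intro b hb
        refine le_trans (Finset.card_le_card fun x hx => ?_) (hcnt b hb)
        simp only [hZdef, Finset.mem_sdiff, Finset.mem_union, mem_regions, Finset.mem_Icc]
          at hx ⊢
        refine ⟨hx.1, fun h => hx.2 ?_⟩
        rcases h with (h | ⟨y, hy, h1, h2⟩) | h
        · exact Or.inl (Or.inl h)
        · refine Or.inl (Or.inr ⟨y, ?_, h1, h2⟩)
          rw [hY₁]
          exact Finset.mem_filter.2 ⟨hy, b, hb, x, h1, h2, hx.1⟩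
        · exact Or.inr h
      obtain ⟨j, hj1, hj2, hj3⟩ := exists_far_point (X := X) (α := α) (w := w + 1)
        (Y := insert h Y₁) (by omega)
        ((Finset.card_insert_le _ _).trans (Nat.succ_le_succ hY₁card))
      push_cast at hj2
      have hjβ : j + X ≤ β := by omega
      have hZ : (Z ∩ Finset.Ico j (j + X)).card + 2 * w ≤ L + 2 := by
        refine le_trans (Nat.add_le_add_right (Finset.card_le_card fun x hx => ?_) _) hOR
        simp only [hZdef, Finset.mem_inter, Finset.mem_union, mem_regions, Finset.mem_Ico] at hx
        obtain ⟨(h1 | ⟨y, hy, h1, h2⟩) | h1, h3, h4⟩ := hx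
        · exact h1
        · have := hj3 y (Finset.mem_insert_of_mem hy)
          rcases abs_cases (j - y) with ⟨h5, h6⟩ | ⟨h5, h6⟩ <;> omega
        · exact absurd ⟨by omega, by omega⟩ (hE x h1)
      have hT : ∀ B' h' u, MacroStart w L P Z j B' h' u →
          AGood n w (t + m * (F + 1) + F) B' h' := by
        intro B' h' u hM
        have hu1 := hM.le_left
        have hu2 := hM.right_le
        rw [← hX] at hu2
        refine hK B' h' u hM.wf hM.card_le hM.free hM.le_hot hM.hot_lt (by omega) (by omega) _ ?_
        intro B'' h'' hwf'' hcard'' hh'' h1 h2 hloc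
        refine ih (by omega) B'' h'' (insert j Y₁)
          (O ∪ B'.biUnion fun b => Finset.Icc b.1 b.2 \ (Z ∪ Finset.Ico j (j + X))) hwf'' hcard''
          hh'' (by omega) (by omega) ?_ ?_ ?_ ?_ ?_
        · intro b hb
          rcases hloc b hb with h | h | h
          · exact hM.prop b h
          · rw [hP]
            exact Or.inr (Or.inl h)
          · rw [hP]
            exact Or.inr (Or.inr ⟨by omega, by omega⟩)
        · intro y hy
          rcases Finset.mem_insert.1 hy with rfl | hy
          · exact ⟨hj1, hjβ⟩
          · exact hY y (hsub hy)
        · intro y hy z hz hyz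
          rcases Finset.mem_insert.1 hy with h3 | h3 <;> rcases Finset.mem_insert.1 hz with h4 | h4
          · exact absurd (h3.trans h4.symm) hyz
          · rw [h3]
            exact hj3 z (Finset.mem_insert_of_mem h4)
          · rw [h4, abs_sub_comm]
            exact hj3 y (Finset.mem_insert_of_mem h3)
          · exact hsep y (hsub h3) z (hsub h4) hyz
        · have h3 := Finset.card_biUnion_le_card_mul B'
            (fun b => Finset.Icc b.1 b.2 \ (Z ∪ Finset.Ico j (j + X))) (2 * w)
            (fun b hb => by
              have := hM.cnt_le b hb
              rwa [← hX] at this)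
          have h4 : B'.card * (2 * w) ≤ 2 * w ^ 2 := by
            have := Nat.mul_le_mul_right (2 * w) hM.card_le
            nlinarith
          have h5 : (R - m) * (2 * w ^ 2) = (R - (m + 1)) * (2 * w ^ 2) + 2 * w ^ 2 := by
            obtain ⟨k, rfl⟩ := Nat.exists_eq_add_of_le hm
            rw [show m + 1 + k - m = k + 1 by omega, show m + 1 + k - (m + 1) = k by omega]
            ring
          rw [h5]
          refine (Finset.card_union_le _ _).trans ?_
          omega
        · intro b hb
          have hzero : (∀ x, b.1 ≤ x → x ≤ b.2 → x ∈ O ∪ (B'.biUnion fun b =>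
              Finset.Icc b.1 b.2 \ (Z ∪ Finset.Ico j (j + X))) ∪ regions X (insert j Y₁) ∪ E) →
              cnt (O ∪ (B'.biUnion fun b => Finset.Icc b.1 b.2 \ (Z ∪ Finset.Ico j (j + X))) ∪
                regions X (insert j Y₁) ∪ E) b ≤ 1 := by
            intro hall
            rw [cnt, Finset.sdiff_eq_empty_iff_subset.2 fun x hx =>
              hall x (Finset.mem_Icc.1 hx).1 (Finset.mem_Icc.1 hx).2]
            simp
          rcases hloc b hb with h3 | h3 | h3
          · refine hzero fun x hx1 hx2 => ?_
            by_cases hxZ : x ∈ Z ∪ Finset.Ico j (j + X)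
            · simp only [hZdef, Finset.mem_union, mem_regions, Finset.mem_Ico,
                Finset.mem_insert] at hxZ ⊢
              rcases hxZ with ((h4 | ⟨y, hy, h4⟩) | h4) | h4
              · exact Or.inl (Or.inl (Or.inl h4))
              · exact Or.inl (Or.inr ⟨y, Or.inr hy, h4⟩)
              · exact Or.inr h4
              · exact Or.inl (Or.inr ⟨j, Or.inl rfl, h4⟩)
            · refine Finset.mem_union_left _ (Finset.mem_union_left _ (Finset.mem_union_right _
                (Finset.mem_biUnion.2 ⟨b, h3, Finset.mem_sdiff.2 ⟨?_, hxZ⟩⟩)))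
              exact Finset.mem_Icc.2 ⟨hx1, hx2⟩
          · obtain ⟨b1, b2⟩ := b
            simp only at h3
            rw [h3]
            exact cnt_dot_le _ _
          · refine hzero fun x hx1 hx2 => Finset.mem_union_left _ (Finset.mem_union_right _ ?_)
            exact mem_regions.2 ⟨j, Finset.mem_insert_self _ _, by omega, by omega⟩
      have hPdot : ∀ q, P (q, q) := by
        intro q
        rw [hP]
        exact Or.inr (Or.inl rfl)
      have hPblock : ∀ a c, α ≤ a → a ≤ c → c < β → P (a, c) := by
        intro a c h1 _ h3
        rw [hP]
        exact Or.inr (Or.inr ⟨h1, h3⟩)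
      have hw : ∀ b ∈ B, cnt Z b ≤ 2 * w := fun b hb => by
        have h1 := hcnt₁ b hb
        have h2 : 0 < B.card := Finset.card_pos.2 ⟨b, hb⟩
        omega
      rw [show t + (m + 1) * (F + 1) = t + m * (F + 1) + F + 1 by ring]
      have hpos : (0 : ℤ) < 2 * (L + 2) * (w + 1) := by positivity
      have hjh := hj3 h (Finset.mem_insert_self _ _)
      rw [hX] at hjβ hZ
      rcases abs_cases (j - h) with ⟨h5, h6⟩ | ⟨h5, h6⟩
      · exact AGood.sweep_right hL hα hj1 hjβ hαn hPdot hPblock hZ hT _ le_rfl B h hwf hcard hh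
          hαh (by omega) hPB hw fun b hb _ => hcnt₁ b hb
      · exact AGood.sweep_left hL hα hj1 hjβ hαn hPdot hPblock hZ hT hwf hcard hh hhβ (by omega)
          hPB hw fun b hb _ => hcnt₁ b hb
  refine ready R le_rfl B₀ h₀ ∅ ∅ hwf₀ hcard₀ (hfree₀ _ hαh₀ hh₀) hαh₀ hh₀ ?_ (by simp) (by simp)
    (by simp) ?_
  · intro b hb
    rw [hP]
    exact Or.inl hb
  · intro b hb
    rw [cnt, Finset.sdiff_eq_empty_iff_subset.2]
    · simp
    · intro x hx
      rw [hEdef]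
      exact Finset.mem_union_right _ (Finset.mem_biUnion.2 ⟨b, hb, hx⟩)

/-- Window lengths under iterated amplification. -/
def winLen (w L₀ : ℕ) : ℕ → ℕ
  | 0 => L₀
  | k + 1 => 16 * (winLen w L₀ k + 2) * (w + 1) * (w + 2)

/-- Rounds gained under iterated amplification. -/
def winGain (R : ℕ) : ℕ → ℕ
  | 0 => 0
  | k + 1 => R * (winGain R k + 1)

theorem le_winLen (w L₀ : ℕ) : ∀ k, L₀ ≤ winLen w L₀ k
  | 0 => le_rfl
  | k + 1 => by
    have := le_winLen w L₀ k
    rw [winLen]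
    nlinarith [Nat.zero_le (winLen w L₀ k * w), Nat.zero_le (winLen w L₀ k * w ^ 2)]

theorem winLen_le {w L₀ : ℕ} (hw : 2 ≤ w) (hL : 1 ≤ L₀) : ∀ k, winLen w L₀ k ≤ w ^ (10 * k) * L₀
  | 0 => by simp [winLen]
  | k + 1 => by
    have ih := winLen_le hw hL k
    have h1 : 1 ≤ winLen w L₀ k := hL.trans (le_winLen w L₀ k)
    have h2 : (w + 1) * (w + 2) ≤ 3 * w ^ 2 := by nlinarith
    have h3 : 2 ^ 8 ≤ w ^ 8 := Nat.pow_le_pow_left hw 8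
    calc winLen w L₀ (k + 1) = 16 * (winLen w L₀ k + 2) * ((w + 1) * (w + 2)) := by
          rw [winLen]; ring
      _ ≤ 16 * (3 * winLen w L₀ k) * (3 * w ^ 2) := by gcongr; omega
      _ = 144 * w ^ 2 * winLen w L₀ k := by ring
      _ ≤ w ^ 8 * w ^ 2 * winLen w L₀ k := by gcongr; omega
      _ ≤ w ^ 8 * w ^ 2 * (w ^ (10 * k) * L₀) := by gcongr
      _ = w ^ (10 * (k + 1)) * L₀ := by ring

theorem pow_le_winGain (R : ℕ) : ∀ k, R ^ (k + 1) ≤ winGain R (k + 1)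
  | 0 => by simp [winGain]
  | k + 1 => by
    have := pow_le_winGain R k
    rw [winGain, pow_succ']
    exact Nat.mul_le_mul_left R (this.trans (Nat.le_succ _))

theorem windowGain_winLen (n : ℤ) {w L₀ R : ℕ} (hL : 1 ≤ L₀)
    (hR : R * (2 * w ^ 2) + 2 * w ≤ L₀ + 2) :
    ∀ k, WindowGain n w (winLen w L₀ k) (winGain R k)
  | 0 => fun _ _ _ hwf hcard hfree h1 h2 _ _ _ hpost =>
    hpost _ _ hwf hcard (hfree _ h1 h2) h1 h2 fun _ hb => Or.inl hb
  | k + 1 => by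
    have := le_winLen w L₀ k
    exact (windowGain_winLen n hL hR k).amplify (by omega) (by omega)

theorem agood_empty {n w L₀ R k : ℕ} (hw : 2 ≤ w) (hL : 1 ≤ L₀)
    (hR : R * (2 * w ^ 2) + 2 * w ≤ L₀ + 2) (hn : w ^ (10 * (k + 1)) * L₀ ≤ n) :
    AGood n w (R ^ (k + 1)) ∅ 0 := by
  have h1 := (winLen_le hw hL (k + 1)).trans hn
  have h2 := hL.trans (le_winLen w L₀ (k + 1))
  have := windowGain_winLen n hL hR (k + 1) ∅ 0 0 ⟨by simp, by simp⟩ (by simp)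
    (fun x _ _ b hb => by simp at hb) le_rfl (by omega) le_rfl (by omega) 0
    (fun _ _ _ _ _ _ _ _ => trivial)
  exact this.mono (by have := pow_le_winGain R k; omega)

/-! ### Simulating the bracket game -/

/-- The bracket type of cell `i` paired with cell `p`. -/
def bracketAt (i p : ℤ) (red : Bool) : BType :=
  if p = i then bif red then BType.trivR else BType.trivB
  else if i < p then bif red then BType.openR else BType.openB
  else bif red then BType.closeR else BType.closeB

/-- The pairing `π` and colouring `col` (`true` for red) form a bracket string that is correct away
from the hot cell `h`, is trivial off the blocks `B`, and extends the state `ρ`. -/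
structure Models {n : ℕ} (ρ : PState n) (B : Finset (ℤ × ℤ)) (h : ℤ) (π : ℤ → ℤ) (col : ℤ → Bool) :
    Prop where
  hot_nonneg : 0 ≤ h
  hot_lt : h < n
  hot_free : Free B h
  wf : WF B
  range : ∀ b ∈ B, 0 ≤ b.1 ∧ b.2 < n
  invol : ∀ i, π (π i) = i
  ends : ∀ b ∈ B, π b.1 = b.2
  closed : ∀ b ∈ B, ∀ i, b.1 ≤ i → i ≤ b.2 → b.1 ≤ π i ∧ π i ≤ b.2
  fixed : ∀ i, Free B i → π i = i
  nocross : ∀ i j, i < j → j < π i → ¬π i < π j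
  col_pair : ∀ i, col (π i) = col i
  adj : ∀ i, i ≠ h → i + 1 ≠ h → π i ≤ i → i + 1 ≤ π (i + 1) → col i = true → col (i + 1) = true
  first : 0 ≠ h → col 0 = true
  last : (n : ℤ) - 1 ≠ h → col (n - 1) = false
  agree : ∀ i σ, ρ i = some σ → ((σ.p : ℕ) : ℤ) = π (i : ℕ) ∧
    σ.b = bracketAt (i : ℕ) (π (i : ℕ)) (col (i : ℕ))
  covered : ∀ i : Fin n, ρ i ≠ none → ¬Free B (i : ℕ)

/-- Every block contains a remembered cell. -/
def Anchored {n : ℕ} (ρ : PState n) (B : Finset (ℤ × ℤ)) : Prop :=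
  ∀ b ∈ B, ∃ i : Fin n, b.1 ≤ (i : ℕ) ∧ ((i : ℕ) : ℤ) ≤ b.2 ∧ ρ i ≠ none

namespace Models

variable {n : ℕ} {ρ : PState n} {B : Finset (ℤ × ℤ)} {h : ℤ} {π : ℤ → ℤ} {col : ℤ → Bool}

theorem ne_hot (M : Models ρ B h π col) {i : Fin n} {σ : Sym n} (hi : ρ i = some σ) :
    ((i : ℕ) : ℤ) ≠ h := by
  intro heq
  have := M.covered i (by simp [hi])
  rw [heq] at this
  exact this M.hot_free

theorem not_falsifies (M : Models ρ B h π col) : ¬Falsifies ρ := by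
  rintro ((⟨i, hi0, σ, hσ, hb⟩ | ⟨i, hi0, σ, hσ, hb⟩) | (⟨i, j, σ, τ, hσ, hτ, hp, hq⟩ |
    ⟨i, σ, hσ, hp, hb⟩ | ⟨i, j, σ, τ, hlt, hσ, hτ, hp, hq, hb⟩) |
    ⟨i, i', j, j', ⟨σ, τ, hσ, hτ, hp, hq⟩, ⟨σ', τ', hσ', hτ', hp', hq'⟩, h1, h2, h3⟩ |
    ⟨i, j, hij, σ, τ, hσ, hτ, hσb, hτb⟩)
  · obtain ⟨h1, h2⟩ := M.agree i σ hσ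
    have h3 := M.ne_hot hσ
    rw [hi0] at h1 h2 h3
    have h4 := M.first (by simpa using h3)
    simp only [Nat.cast_zero] at h1 h2
    rw [h4, ← h1] at h2
    apply hb
    rw [h2, bracketAt]
    split_ifs <;> first | omega | simp
  · obtain ⟨h1, h2⟩ := M.agree i σ hσ
    have h3 := M.ne_hot hσ
    have hi : ((i : ℕ) : ℤ) = n - 1 := by omega
    rw [hi] at h1 h2 h3
    have h4 := M.last h3
    rw [h4, ← h1] at h2
    apply hb
    rw [h2, bracketAt]
    split_ifs <;> first | omega | simp
  · have h1 := (M.agree i σ hσ).1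
    have h2 := (M.agree j τ hτ).1
    rw [hp] at h1
    rw [h1, M.invol] at h2
    exact hq (Fin.ext (by exact_mod_cast h2))
  · obtain ⟨h1, h2⟩ := M.agree i σ hσ
    rw [← h1, hp, bracketAt, if_pos rfl] at h2
    apply hb
    rw [h2]
    cases col (i : ℕ) <;> simp
  · obtain ⟨h1, h2⟩ := M.agree i σ hσ
    obtain ⟨h3, h4⟩ := M.agree j τ hτ
    have hlt' : ((i : ℕ) : ℤ) < (j : ℕ) := by exact_mod_cast hlt
    have hc := M.col_pair (i : ℕ)
    rw [← h1, hp] at h2 hc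
    rw [← h3, hq, hc] at h4
    rw [bracketAt, if_neg (by omega), if_pos hlt'] at h2
    rw [bracketAt, if_neg (by omega), if_neg (by omega)] at h4
    apply hb
    rw [h2, h4]
    cases col (i : ℕ) <;> simp
  · have a1 := (M.agree i σ hσ).1
    have a2 := (M.agree i' σ' hσ').1
    rw [hp] at a1
    rw [hp'] at a2
    have e1 : ((i : ℕ) : ℤ) < (i' : ℕ) := by exact_mod_cast h1
    have e2 : ((i' : ℕ) : ℤ) < (j : ℕ) := by exact_mod_cast h2
    have e3 : ((j : ℕ) : ℤ) < (j' : ℕ) := by exact_mod_cast h3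
    exact M.nocross _ _ e1 (a1 ▸ e2) (a1 ▸ a2 ▸ e3)
  · have h1 := (M.agree i σ hσ).2
    have h2 := (M.agree j τ hτ).2
    have h3 := M.ne_hot hσ
    have h4 := M.ne_hot hτ
    have hj : ((j : ℕ) : ℤ) = (i : ℕ) + 1 := by omega
    rw [hj] at h2 h4
    have hi : π (i : ℕ) ≤ (i : ℕ) ∧ col (i : ℕ) = true := by
      rw [h1, bracketAt] at hσb
      split_ifs at hσb with c1 c2 <;> cases hc : col (i : ℕ) <;> simp [hc] at hσb ⊢ <;> omega
    have hi' : ((i : ℕ) : ℤ) + 1 ≤ π ((i : ℕ) + 1) ∧ col ((i : ℕ) + 1) = false := by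
      rw [h2, bracketAt] at hτb
      split_ifs at hτb with c1 c2 <;> cases hc : col ((i : ℕ) + 1) <;> simp [hc] at hτb ⊢ <;> omega
    have := M.adj _ h3 h4 hi.1 hi'.1 hi.2
    rw [hi'.2] at this
    exact Bool.false_ne_true this

theorem shrink (M : Models ρ B h π col) {ρ' : PState n} (hρ : ∀ i, ρ' i = none ∨ ρ' i = ρ i) :
    Models ρ' B h π col where
  __ := M
  agree i σ hσ := by
    rcases hρ i with h1 | h1
    · simp [h1] at hσ
    · exact M.agree i σ (h1 ▸ hσ)
  covered i hi := by
    rcases hρ i with h1 | h1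
    · exact absurd h1 hi
    · exact M.covered i (h1 ▸ hi)

theorem erase (M : Models ρ B h π col) {b : ℤ × ℤ} (hb : b ∈ B)
    (hρ : ∀ i : Fin n, b.1 ≤ (i : ℕ) → ((i : ℕ) : ℤ) ≤ b.2 → ρ i = none) :
    Models ρ (B.erase b) h (fun i => if b.1 ≤ i ∧ i ≤ b.2 then i else π i)
      (fun i => if b.1 ≤ i ∧ i ≤ b.2 then col b.1 else col i) := by
  have hle := M.wf.1 b hb
  have hend := M.ends b hb
  have hend' : π b.2 = b.1 := by rw [← hend, M.invol]
  have hhot := M.hot_free b hb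
  have hout : ∀ i, ¬(b.1 ≤ i ∧ i ≤ b.2) → ¬(b.1 ≤ π i ∧ π i ≤ b.2) := by
    intro i hi hi'
    have := M.closed b hb _ hi'.1 hi'.2
    rw [M.invol] at this
    exact hi this
  have hcol : col b.2 = col b.1 := by rw [← hend, M.col_pair]
  have hdisj : ∀ c ∈ B.erase b, ∀ i, c.1 ≤ i → i ≤ c.2 → ¬(b.1 ≤ i ∧ i ≤ b.2) := by
    intro c hc i h1 h2
    rw [Finset.mem_erase] at hc
    have := M.wf.2 c hc.2 b hb hc.1
    omega
  refine ⟨M.hot_nonneg, M.hot_lt, M.hot_free.subset (Finset.erase_subset _ _),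
    M.wf.subset (Finset.erase_subset _ _), fun c hc => M.range c (Finset.mem_of_mem_erase hc),
    ?_, ?_, ?_, ?_, ?_, ?_, ?_, ?_, ?_, ?_, ?_⟩
  · intro i
    by_cases hi : b.1 ≤ i ∧ i ≤ b.2
    · simp only [if_pos hi]
    · simp only [if_neg hi, if_neg (hout i hi), M.invol]
  · intro c hc
    have h1 := M.wf.1 c (Finset.mem_of_mem_erase hc)
    simp only [if_neg (hdisj c hc c.1 le_rfl h1)]
    exact M.ends c (Finset.mem_of_mem_erase hc)
  · intro c hc i h1 h2
    simp only [if_neg (hdisj c hc i h1 h2)]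
    exact M.closed c (Finset.mem_of_mem_erase hc) i h1 h2
  · intro i hi
    by_cases hib : b.1 ≤ i ∧ i ≤ b.2
    · simp only [if_pos hib]
    · simp only [if_neg hib]
      refine M.fixed i fun c hc => ?_
      rcases eq_or_ne c b with rfl | hne
      · exact hib
      · exact hi c (Finset.mem_erase.2 ⟨hne, hc⟩)
  · intro i j hij
    by_cases hi : b.1 ≤ i ∧ i ≤ b.2
    · simp only [if_pos hi]
      omega
    by_cases hj : b.1 ≤ j ∧ j ≤ b.2
    · simp only [if_neg hi, if_pos hj]
      omega
    simp only [if_neg hi, if_neg hj]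
    exact M.nocross i j hij
  · intro i
    by_cases hi : b.1 ≤ i ∧ i ≤ b.2
    · simp only [if_pos hi]
    · simp only [if_neg hi, if_neg (hout i hi), M.col_pair]
  · intro i h1 h2
    by_cases hi : b.1 ≤ i ∧ i ≤ b.2 <;> by_cases hi' : b.1 ≤ i + 1 ∧ i + 1 ≤ b.2
    · simp only [if_pos hi, if_pos hi']
      tauto
    · simp only [if_pos hi, if_neg hi']
      obtain rfl : i = b.2 := by omega
      intro _ h3 h4
      exact M.adj _ h1 h2 (by omega) h3 (hcol.trans h4)
    · simp only [if_neg hi, if_pos hi']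
      have hib : i + 1 = b.1 := by omega
      intro h3 _ h4
      rw [← hib]
      exact M.adj i h1 h2 h3 (by rw [hib, hend]; exact hle) h4
    · simp only [if_neg hi, if_neg hi']
      exact M.adj i h1 h2
  · intro h1
    by_cases hi : b.1 ≤ 0 ∧ (0 : ℤ) ≤ b.2
    · simp only [if_pos hi]
      have := (M.range b hb).1
      rw [show b.1 = 0 by omega]
      exact M.first h1
    · simp only [if_neg hi]
      exact M.first h1
  · intro h1
    by_cases hi : b.1 ≤ (n : ℤ) - 1 ∧ (n : ℤ) - 1 ≤ b.2
    · simp only [if_pos hi]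
      have := (M.range b hb).2
      rw [← hcol, show b.2 = (n : ℤ) - 1 by omega]
      exact M.last h1
    · simp only [if_neg hi]
      exact M.last h1
  · intro i σ hσ
    have hi : ¬(b.1 ≤ (i : ℕ) ∧ ((i : ℕ) : ℤ) ≤ b.2) := fun hi => by
      simp [hρ i hi.1 hi.2] at hσ
    simp only [if_neg hi]
    exact M.agree i σ hσ
  · intro i hi hfree
    have hib : ¬(b.1 ≤ (i : ℕ) ∧ ((i : ℕ) : ℤ) ≤ b.2) := fun hib => hi (hρ i hib.1 hib.2)
    refine M.covered i hi fun c hc => ?_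
    rcases eq_or_ne c b with rfl | hne
    · exact hib
    · exact hfree c (Finset.mem_erase.2 ⟨hne, hc⟩)

theorem exists_anchored {ρ : PState n} {h : ℤ} (B : Finset (ℤ × ℤ)) :
    ∀ {π : ℤ → ℤ} {col : ℤ → Bool}, Models ρ B h π col →
      ∃ B' ⊆ B, ∃ π' col', Models ρ B' h π' col' ∧ Anchored ρ B' := by
  induction B using Finset.strongInduction with
  | H B ih =>
    intro π col M
    by_cases hA : Anchored ρ B
    · exact ⟨B, subset_rfl, π, col, M, hA⟩
    · rw [Anchored] at hA
      push Not at hA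
      obtain ⟨b, hb, hρ⟩ := hA
      obtain ⟨B', hB', H⟩ := ih _ (Finset.erase_ssubset hb) (M.erase hb hρ)
      exact ⟨B', hB'.trans (Finset.erase_subset _ _), H⟩

theorem exists_update (M : Models ρ B h π col) {i : Fin n} (hi : ¬Free B (i : ℕ)) :
    ∃ σ, Models (Function.update ρ i (some σ)) B h π col := by
  have hfree := hi
  rw [Free] at hi
  push Not at hi
  obtain ⟨b, hb, h1, h2⟩ := hi
  have h3 := M.closed b hb _ h1 h2
  have h4 := M.range b hb
  refine ⟨⟨bracketAt (i : ℕ) (π (i : ℕ)) (col (i : ℕ)), ⟨(π (i : ℕ)).toNat, by omega⟩⟩, ?_⟩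
  refine { M with agree := fun k τ hk => ?_, covered := fun k hk => ?_ }
  · rcases eq_or_ne k i with rfl | hne
    · rw [Function.update_self, Option.some_inj] at hk
      subst hk
      exact ⟨Int.toNat_of_nonneg (by omega), rfl⟩
    · rw [Function.update_of_ne hne] at hk
      exact M.agree k τ hk
  · rcases eq_or_ne k i with rfl | hne
    · exact hfree
    · rw [Function.update_of_ne hne] at hk
      exact M.covered k hk

theorem insert_dot (M : Models ρ B h π col) {q : ℤ} (h0 : 0 ≤ q) (hn : q < n) (hq : Free B q)
    (hqh : q ≠ h) : Models ρ (insert (q, q) B) h π col := by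
  refine { M with
    hot_free := M.hot_free.insert (by simp only; omega)
    wf := M.wf.insert_dot hq
    range := fun b hb => ?_
    ends := fun b hb => ?_
    closed := fun b hb i h1 h2 => ?_
    fixed := fun i hi => M.fixed i (hi.subset (Finset.subset_insert _ _))
    covered := fun i hi hf => M.covered i hi (hf.subset (Finset.subset_insert _ _)) }
  all_goals rcases Finset.mem_insert.1 hb with rfl | hb
  · exact ⟨h0, hn⟩
  · exact M.range b hb
  · exact M.fixed q hq
  · exact M.ends b hb
  · obtain rfl : i = q := by
      simp only at h1 h2
      omega
    rw [M.fixed i hq]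
    exact ⟨le_rfl, le_rfl⟩
  · exact M.closed b hb i h1 h2

theorem jump (M : Models ρ B h π col) {e h' : ℤ} (he : Free B e) (hh' : Free B h') (h0 : 0 ≤ h')
    (hn : h' < n) (hor : (h < e ∧ h' = e + 1) ∨ (e < h ∧ h' = e - 1)) :
    Models ρ (merge B (min h e) (max h e)) h'
      (fun i => if i = h then e else if i = e then h else π i)
      (fun i => if i = h ∨ i = e then decide (h < e) else col i) := by
  have hh0 := M.hot_nonneg
  have hhn := M.hot_lt
  have hπh := M.fixed h M.hot_free
  have hπe := M.fixed e he
  have hne : h ≠ e := by omega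
  obtain ⟨lo, hlo⟩ : ∃ lo, lo = min h e := ⟨_, rfl⟩
  obtain ⟨hi, hhi⟩ : ∃ hi, hi = max h e := ⟨_, rfl⟩
  rw [← hlo, ← hhi]
  have hlohi : lo < hi ∧ ((lo = h ∧ hi = e) ∨ (lo = e ∧ hi = h)) := by omega
  obtain ⟨hlt, hcase⟩ := hlohi
  have hflo : Free B lo := by
    rcases hcase with ⟨h1, -⟩ | ⟨h1, -⟩ <;> rw [h1]
    exacts [M.hot_free, he]
  have hfhi : Free B hi := by
    rcases hcase with ⟨-, h1⟩ | ⟨-, h1⟩ <;> rw [h1]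
    exacts [he, M.hot_free]
  have hmoved : ∀ i, i ≠ h → i ≠ e → π i ≠ h ∧ π i ≠ e := by
    intro i h1 h2
    refine ⟨fun h3 => h1 ?_, fun h3 => h2 ?_⟩
    · rw [← M.invol i, h3, hπh]
    · rw [← M.invol i, h3, hπe]
  have hinside : ∀ i, lo ≤ i → i ≤ hi → lo ≤ π i ∧ π i ≤ hi := by
    intro i h1 h2
    by_cases hf : Free B i
    · rw [M.fixed i hf]
      exact ⟨h1, h2⟩
    · rw [Free] at hf
      push Not at hf
      obtain ⟨b, hb, h3, h4⟩ := hf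
      have h5 := hflo b hb
      have h6 := hfhi b hb
      have h7 := M.closed b hb i h3 h4
      omega
  have hblock : ∀ b ∈ B, ∀ i, b.1 ≤ i → i ≤ b.2 → i ≠ h ∧ i ≠ e := by
    intro b hb i h1 h2
    have h3 := M.hot_free b hb
    have h4 := he b hb
    refine ⟨?_, ?_⟩ <;> rintro rfl
    · exact h3 ⟨h1, h2⟩
    · exact h4 ⟨h1, h2⟩
  have hfree : ∀ i, Free (merge B lo hi) i → Free B i ∧ ¬(lo ≤ i ∧ i ≤ hi) := by
    intro i hi'
    have hout := hi' (lo, hi) (Finset.mem_insert_self _ _)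
    refine ⟨fun b hb hib => ?_, hout⟩
    by_cases hin : lo ≤ b.1 ∧ b.2 ≤ hi
    · exact hout ⟨by simp only; omega, by simp only; omega⟩
    · exact hi' b (Finset.mem_insert_of_mem (Finset.mem_filter.2 ⟨hb, hin⟩)) hib
  refine ⟨h0, hn, hh'.merge (by omega), M.wf.merge hlt.le hflo hfhi, ?_, ?_, ?_, ?_, ?_, ?_, ?_,
    ?_, ?_, ?_, ?_, ?_⟩
  · intro b hb
    rcases mem_merge hb with rfl | ⟨hb, -⟩
    · constructor <;> simp only <;> omega
    · exact M.range b hb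
  · intro i
    by_cases h1 : i = h
    · simp [h1, hne.symm]
    by_cases h2 : i = e
    · simp [h2, hne.symm]
    have h3 := hmoved i h1 h2
    simp only [if_neg h1, if_neg h2, if_neg h3.1, if_neg h3.2, M.invol]
  · intro b hb
    rcases mem_merge hb with rfl | ⟨hb, -⟩
    · rcases hcase with ⟨rfl, rfl⟩ | ⟨rfl, rfl⟩
      · simp
      · simp [hne.symm]
    · have h1 := hblock b hb b.1 le_rfl (M.wf.1 b hb)
      simp only [if_neg h1.1, if_neg h1.2]
      exact M.ends b hb
  · intro b hb i h1 h2
    rcases mem_merge hb with rfl | ⟨hb, -⟩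
    · simp only at h1 h2 ⊢
      have h3 := hinside i h1 h2
      split_ifs <;> omega
    · have h3 := hblock b hb i h1 h2
      simp only [if_neg h3.1, if_neg h3.2]
      exact M.closed b hb i h1 h2
  · intro i hf
    obtain ⟨h1, h2⟩ := hfree i hf
    rw [if_neg (by omega), if_neg (by omega)]
    exact M.fixed i h1
  · intro i j hij h1 h2
    have a1 := hinside j
    have a2 := hinside (π i)
    rw [M.invol] at a2
    have a3 := M.nocross i j hij
    split_ifs at h1 h2 <;> omega
  · intro i
    by_cases h1 : i = h
    · simp [h1]
    by_cases h2 : i = e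
    · simp [h2, hne.symm]
    have h3 := hmoved i h1 h2
    simp only [h1, h2, h3.1, h3.2, or_self, if_false, M.col_pair]
  · intro i h1 h2 h3 h4 h5
    have hadj := M.adj i
    rcases hor with ⟨h6, h7⟩ | ⟨h6, h7⟩
    · by_cases c1 : i + 1 = h
      · simp [c1, h6]
      by_cases c2 : i = h
      · simp only [if_pos c2] at h3
        omega
      by_cases c3 : i + 1 = e
      · simp only [if_neg c1, if_pos c3] at h4
        omega
      have c4 : i ≠ e := by omega
      simp only [c1, c2, c3, c4, or_self, if_false] at h3 h4 h5 ⊢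
      exact hadj c2 c1 h3 h4 h5
    · by_cases c1 : i = h
      · simp only [c1, true_or, if_true, decide_eq_true_eq] at h5
        omega
      by_cases c2 : i + 1 = h
      · simp only [if_pos c2] at h4
        omega
      by_cases c3 : i = e
      · simp only [if_neg c1, if_pos c3] at h3
        omega
      have c4 : i + 1 ≠ e := by omega
      simp only [c1, c2, c3, c4, or_self, if_false] at h3 h4 h5 ⊢
      exact hadj c1 c2 h3 h4 h5
  · intro h1
    by_cases c1 : 0 = h ∨ 0 = e
    · simp only [if_pos c1, decide_eq_true_eq]
      omega
    · simp only [if_neg c1]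
      exact M.first (by tauto)
  · intro h1
    by_cases c1 : (n : ℤ) - 1 = h ∨ (n : ℤ) - 1 = e
    · simp only [if_pos c1, decide_eq_false_iff_not]
      omega
    · simp only [if_neg c1]
      exact M.last (by tauto)
  · intro i σ hσ
    have h1 := M.covered i (by simp [hσ])
    have h2 : ((i : ℕ) : ℤ) ≠ h := fun h2 => h1 (h2 ▸ M.hot_free)
    have h3 : ((i : ℕ) : ℤ) ≠ e := fun h3 => h1 (h3 ▸ he)
    simp only [h2, h3, or_self, if_false]
    exact M.agree i σ hσ
  · exact fun i hi' hf => M.covered i hi' (hfree _ hf).1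

end Models

theorem memSize_update {n : ℕ} {ρ : PState n} {i : Fin n} (hi : ρ i = none) (σ : Sym n) :
    memSize (Function.update ρ i (some σ)) = memSize ρ + 1 := by
  have : {k : Fin n | Function.update ρ i (some σ) k ≠ none} = insert i {k | ρ k ≠ none} := by
    ext k
    rcases eq_or_ne k i with rfl | hne
    · simp
    · simp [hne]
  rw [memSize, memSize, this, Set.ncard_insert_of_notMem (by simp [hi])]

theorem Anchored.card_le_memSize {n : ℕ} {ρ : PState n} {B : Finset (ℤ × ℤ)} (H : Anchored ρ B)
    (hwf : WF B) : B.card ≤ memSize ρ := by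
  classical
  rcases Finset.eq_empty_or_nonempty B with rfl | ⟨b₀, hb₀⟩
  · simp
  have : Nonempty (Fin n) := ⟨(H b₀ hb₀).choose⟩
  choose! f h1 h2 h3 using H
  rw [memSize, Set.ncard_eq_toFinset_card']
  refine Finset.card_le_card_of_injOn f (fun b hb => by simpa using h3 b hb) ?_
  intro b hb c hc heq
  by_contra hne
  have a1 := h1 b hb
  have a2 := h2 b hb
  have a3 := h1 c hc
  have a4 := h2 c hc
  rw [← heq] at a3 a4
  have := hwf.2 b hb c hc hne
  omega

theorem Anchored.update {n : ℕ} {ρ : PState n} {B : Finset (ℤ × ℤ)} (H : Anchored ρ B) (i : Fin n)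
    (σ : Sym n) : Anchored (Function.update ρ i (some σ)) B := by
  intro b hb
  obtain ⟨k, h1, h2, h3⟩ := H b hb
  refine ⟨k, h1, h2, ?_⟩
  rcases eq_or_ne k i with rfl | hne
  · simp
  · rwa [Function.update_of_ne hne]

/-- The adversary survives `t` rounds of the bracket game from the state `ρ` against provers of
memory `w`. -/
def Survives {n : ℕ} (w : ℕ) : ℕ → PState n → Prop
  | 0, ρ => ¬Falsifies ρ
  | t + 1, ρ => ¬Falsifies ρ ∧
    (∀ S : Finset (Fin n), Survives w t (stepState ρ (PMove.forget S, none))) ∧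
    ∀ i, ∃ σ, memSize (Function.update ρ i (some σ)) ≤ w →
      Survives w t (Function.update ρ i (some σ))

theorem Survives.not_falsifies {n w : ℕ} : ∀ {t : ℕ} {ρ : PState n}, Survives w t ρ → ¬Falsifies ρ
  | 0, _, H => H
  | _ + 1, _, H => H.1

theorem Models.survives {n w : ℕ} : ∀ {t : ℕ} {ρ : PState n} {B : Finset (ℤ × ℤ)} {h : ℤ}
    {π : ℤ → ℤ} {col : ℤ → Bool}, Models ρ B h π col → Anchored ρ B → AGood n w t B h →
      Survives w t ρ
  | 0, _, _, _, _, _, M, _, _ => M.not_falsifies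
  | t + 1, ρ, B, h, π, col, M, hA, H => by
    refine ⟨M.not_falsifies, fun S => ?_, fun i => ?_⟩
    · obtain ⟨B', hB', π', col', M', hA'⟩ := (M.shrink (ρ' := stepState ρ (PMove.forget S, none))
        fun i => by
          simp only [stepState]
          split_ifs <;> simp).exists_anchored
      exact M'.survives hA' (H.1 B' hB')
    · rcases hρ : ρ i with _ | τ
      swap
      · refine ⟨τ, fun _ => ?_⟩
        rw [← hρ, Function.update_eq_self]
        exact M.survives hA H.of_succ
      rcases lt_or_ge (memSize ρ) w with hlt | hge
      swap
      · refine ⟨⟨BType.trivR, i⟩, fun hle => ?_⟩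
        rw [memSize_update hρ] at hle
        omega
      have hcard := (hA.card_le_memSize M.wf).trans_lt hlt
      by_cases hf : Free B (i : ℕ)
      swap
      · obtain ⟨σ, M'⟩ := M.exists_update hf
        exact ⟨σ, fun _ => M'.survives (hA.update i σ) (H.1 B subset_rfl)⟩
      by_cases hi : ((i : ℕ) : ℤ) = h
      · obtain ⟨e, h', he, hh', h0, hn, hor, hg⟩ := H.2.2 hcard
        have M₁ := M.jump he hh' h0 hn hor
        obtain ⟨σ, M'⟩ := M₁.exists_update (i := i)
          (fun hf' => hf' _ (Finset.mem_insert_self _ _) (by simp only; omega))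
        refine ⟨σ, fun _ => M'.survives ?_ hg⟩
        intro b hb
        rcases mem_merge hb with rfl | ⟨hb, -⟩
        · exact ⟨i, by simp only; omega, by simp only; omega, by simp⟩
        · exact hA.update i σ b hb
      · have M₁ := M.insert_dot (by omega) (by omega) hf hi
        obtain ⟨σ, M'⟩ := M₁.exists_update (i := i)
          (fun hf' => hf' _ (Finset.mem_insert_self _ _) ⟨le_rfl, le_rfl⟩)
        refine ⟨σ, fun _ => M'.survives ?_ (H.2.1 _ hi hf hcard)⟩
        intro b hb
        rcases Finset.mem_insert.1 hb with rfl | hb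
        · exact ⟨i, le_rfl, le_rfl, by simp⟩
        · exact hA.update i σ b hb

theorem survives_of_agood {n w t : ℕ} (hn : 0 < n) (H : AGood n w t ∅ 0) :
    Survives (n := n) w t fun _ => none := by
  refine Models.survives (B := ∅) (h := 0) (π := id) (col := fun _ => false) ?_
    (fun b hb => by simp at hb) H
  refine ⟨le_rfl, by exact_mod_cast hn, fun b hb => by simp at hb, ⟨by simp, by simp⟩, by simp,
    by simp, by simp, by simp, by simp, ?_, by simp, by simp, by simp, by simp, by simp, by simp⟩
  intro i j h1 h2
  simp only [id] at h2
  omega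

/-! ### From survival to strategies -/

theorem stateOf_append {n : ℕ} (hist : Hist n) (m : PMove n × Option (Sym n)) :
    stateOf (hist ++ [m]) = stepState (stateOf hist) m := by
  simp [stateOf]

theorem length_play {n : ℕ} (P : ProverStrat n) (A : AdvStrat n) : ∀ t, (play P A t).length = t
  | 0 => rfl
  | t + 1 => by
    have ih := length_play P A t
    rw [play]
    rcases P (play P A t) with i | S <;> simp [ih]

theorem memSize_stateOf_le {n : ℕ} (hist : Hist n) : memSize (stateOf hist) ≤ hist.length := by
  induction hist using List.reverseRecOn with
  | nil => simp [stateOf, memSize]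
  | append_singleton hist m ih =>
    rw [stateOf_append, List.length_append, List.length_singleton]
    rcases m with ⟨i | S, _ | σ⟩
    · exact ih.trans (Nat.le_succ _)
    · by_cases hi : stateOf hist i = none
      · rw [stepState, memSize_update hi]
        omega
      · refine le_trans (Set.ncard_le_ncard (fun k hk => ?_) (Set.toFinite _))
          (ih.trans (Nat.le_succ _))
        rcases eq_or_ne k i with rfl | hne
        · exact hi
        · simpa [stepState, Function.update_of_ne hne] using hk
    all_goals
      refine le_trans (Set.ncard_le_ncard (fun k hk => ?_) (Set.toFinite _))
          (ih.trans (Nat.le_succ _))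
      simp only [stepState, Set.mem_ofPred_eq] at hk ⊢
      split_ifs at hk <;> tauto

theorem Survives.exists_strategy {n w T : ℕ} (H : Survives (n := n) w T fun _ => none) :
    ∃ A : AdvStrat n, ∀ P : ProverStrat n, (∀ t ≤ T, memSize (stateOf (play P A t)) ≤ w) →
      ∀ t ≤ T, ¬Falsifies (stateOf (play P A t)) := by
  classical
  let good (hist : Hist n) (i : Fin n) (σ : Sym n) : Prop :=
    memSize (Function.update (stateOf hist) i (some σ)) ≤ w →
      Survives w (T - hist.length - 1) (Function.update (stateOf hist) i (some σ))
  let A : AdvStrat n := fun hist i =>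
    if h : ∃ σ, good hist i σ then h.choose else ⟨BType.trivR, i⟩
  have hA : ∀ hist i, (∃ σ, good hist i σ) → good hist i (A hist i) := by
    intro hist i h
    simp only [A, dif_pos h]
    exact h.choose_spec
  refine ⟨A, fun P hmem => ?_⟩
  have key : ∀ t ≤ T, Survives w (T - t) (stateOf (play P A t)) := by
    intro t
    induction t with
    | zero => exact fun _ => H
    | succ t ih =>
      intro ht
      have ih := ih (by omega)
      have hm := hmem (t + 1) ht
      rw [show T - t = T - (t + 1) + 1 by omega] at ih
      rw [play] at hm ⊢
      rcases hP : P (play P A t) with i | S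
      · simp only [hP, stateOf_append, stepState] at hm ⊢
        have := hA (play P A t) i ?_ hm
        · rwa [length_play, Nat.sub_sub] at this
        · obtain ⟨σ, hσ⟩ := ih.2.2 i
          refine ⟨σ, ?_⟩
          simp only [good]
          rwa [length_play, Nat.sub_sub]
      · simp only [stateOf_append]
        exact ih.2.1 S
  exact fun t ht => (key t ht).not_falsifies

/-! ### Choice of parameters -/

theorem agood_empty_of_le_exp {n v : ℕ} {x : ℝ} (hx : 2 ≤ x) (hxn : x ^ 80 = n) (hv : 2 ≤ v)
    (hvx : (v : ℝ) ≤ x ^ 2) {T : ℕ} (hT : (T : ℝ) ≤ Real.exp (40 * Real.log x ^ 2 / Real.log v)) :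
    AGood n v T ∅ 0 := by
  have hx0 : 0 < x := by linarith
  have hx1 : 1 ≤ x := by linarith
  have hv2 : (2 : ℝ) ≤ v := by exact_mod_cast hv
  have hv0 : (0 : ℝ) < v := by linarith
  have hlv : 0 < Real.log v := Real.log_pos (by linarith)
  have hlx : 0 < Real.log x := Real.log_pos (by linarith)
  have hlvx : Real.log v ≤ 2 * Real.log x := by
    have := Real.log_le_log hv0 hvx
    rwa [Real.log_pow, Nat.cast_ofNat] at this
  obtain ⟨r, hr⟩ : ∃ r, r = Real.log x / Real.log v := ⟨_, rfl⟩
  have hrv : r * Real.log v = Real.log x := by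
    rw [hr]
    field_simp
  have hr2 : 1 / 2 ≤ r := by
    rw [hr, le_div_iff₀ hlv]
    linarith
  have hK0 : 1 ≤ ⌊4 * r⌋₊ := Nat.le_floor (by push_cast; linarith)
  obtain ⟨k, hk⟩ : ∃ k, ⌊4 * r⌋₊ = k + 1 := ⟨⌊4 * r⌋₊ - 1, by omega⟩
  have hk1 : ((k + 1 : ℕ) : ℝ) ≤ 4 * r := hk ▸ Nat.floor_le (by linarith)
  have hk2 : 2 * r ≤ ((k + 1 : ℕ) : ℝ) := by
    have := Nat.lt_floor_add_one (4 * r)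
    rw [hk] at this
    linarith
  have hsqrt : Real.sqrt n = x ^ 40 := by
    rw [← hxn, show x ^ 80 = (x ^ 40) ^ 2 by ring, Real.sqrt_sq (by positivity)]
  have hL1 : x ^ 40 < (Nat.sqrt n : ℝ) + 1 := by
    rw [← hsqrt]
    rw [Real.sqrt_lt' (by positivity)]
    exact_mod_cast Nat.lt_succ_sqrt' n
  have hL2 : (Nat.sqrt n : ℝ) ≤ x ^ 40 := by
    rw [← hsqrt]
    exact Real.nat_sqrt_le_real_sqrt
  have hL : 1 ≤ Nat.sqrt n := by
    have : 1 ≤ x ^ 40 := one_le_pow₀ hx1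
    have : (0 : ℝ) < Nat.sqrt n := by linarith
    exact_mod_cast this
  have hceil : (⌈x ^ 20⌉₊ : ℝ) ≤ 2 * x ^ 20 := by
    have h1 := Nat.ceil_lt_add_one (show 0 ≤ x ^ 20 by positivity)
    have h2 : 1 ≤ x ^ 20 := one_le_pow₀ hx1
    linarith
  have hmain := agood_empty (n := n) (w := v) (L₀ := Nat.sqrt n) (R := ⌈x ^ 20⌉₊) (k := k) hv hL
    ?_ ?_
  · refine hmain.mono ?_
    have h1 : Real.exp (40 * Real.log x ^ 2 / Real.log v) ≤ (x ^ 20) ^ (k + 1) := by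
      rw [← Real.log_le_log_iff (Real.exp_pos _) (by positivity), Real.log_exp, Real.log_pow,
        Real.log_pow]
      calc 40 * Real.log x ^ 2 / Real.log v = 20 * Real.log x * (2 * r) := by rw [hr]; ring
        _ ≤ 20 * Real.log x * ((k + 1 : ℕ) : ℝ) := by gcongr
        _ = ((k + 1 : ℕ) : ℝ) * ((20 : ℕ) * Real.log x) := by push_cast; ring
    have h2 : (x ^ 20) ^ (k + 1) ≤ (⌈x ^ 20⌉₊ : ℝ) ^ (k + 1) := by
      gcongr
      exact Nat.le_ceil _
    exact_mod_cast hT.trans (h1.trans h2)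
  · have h1 : (⌈x ^ 20⌉₊ : ℝ) * (2 * v ^ 2) + 2 * v ≤ Nat.sqrt n + 2 := by
      have h2 : (⌈x ^ 20⌉₊ : ℝ) * (2 * v ^ 2) ≤ 2 * x ^ 20 * (2 * (x ^ 2) ^ 2) := by gcongr
      have h3 : x ^ 2 ≤ x ^ 24 := pow_le_pow_right₀ hx1 (by norm_num)
      have h4 : (2 : ℝ) ^ 16 ≤ x ^ 16 := by gcongr
      have h5 : x ^ 40 = x ^ 16 * x ^ 24 := by ring
      have h6 : 0 < x ^ 24 := by positivity
      nlinarith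
    exact_mod_cast h1
  · have h1 : (v : ℝ) ^ (10 * (k + 1)) ≤ x ^ 40 := by
      rw [← Real.log_le_log_iff (by positivity) (by positivity), Real.log_pow, Real.log_pow]
      calc ((10 * (k + 1) : ℕ) : ℝ) * Real.log v = 10 * ((k + 1 : ℕ) : ℝ) * Real.log v := by
            push_cast; ring
        _ ≤ 10 * (4 * r) * Real.log v := by gcongr
        _ = (40 : ℕ) * Real.log x := by rw [← hrv]; push_cast; ring
    have h2 : (v : ℝ) ^ (10 * (k + 1)) * Nat.sqrt n ≤ x ^ 40 * x ^ 40 := by gcongr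
    rw [← pow_add, hxn] at h2
    exact_mod_cast h2

/-- There is an adversary strategy surviving, against every
memory-`w` prover, for the first `n^{ε log n / log w}` rounds. -/
theorem adversary_survives_many_rounds :
    ∃ ε : ℝ, 0 < ε ∧ ∃ N : ℕ, ∀ n ≥ N, ∀ w : ℕ, 2 ≤ w →
      ∃ A : AdvStrat n, ∀ P : ProverStrat n,
        (∀ t : ℕ, memSize (stateOf (play P A t)) ≤ w) →
        ∀ t : ℕ, (t : ℝ) ≤ (n : ℝ) ^ (ε * Real.log n / Real.log w) →
          ¬ Falsifies (stateOf (play P A t)) := by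
  refine ⟨1 / 3200, by norm_num, 2 ^ 80, fun n hn w hw => ?_⟩
  have hnR : (2 : ℝ) ^ 80 ≤ n := by exact_mod_cast hn
  have hn0 : (0 : ℝ) < n := lt_of_lt_of_le (by positivity) hnR
  have hn0' : 0 < n := by exact_mod_cast hn0
  obtain ⟨x, hx0, hxn⟩ : ∃ x : ℝ, 0 ≤ x ∧ x ^ 80 = n :=
    ⟨(n : ℝ) ^ ((80 : ℕ) : ℝ)⁻¹, by positivity, Real.rpow_inv_natCast_pow hn0.le (by norm_num)⟩
  have hx : 2 ≤ x := by
    rw [← hxn] at hnR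
    exact le_of_pow_le_pow_left₀ (by norm_num) hx0 hnR
  have hlx : 0 < Real.log x := Real.log_pos (by linarith)
  have hlog : Real.log n = 80 * Real.log x := by
    rw [← hxn, Real.log_pow, Nat.cast_ofNat]
  have hw2 : (2 : ℝ) ≤ w := by exact_mod_cast hw
  have hlw : 0 < Real.log w := Real.log_pos (by linarith)
  have hbound : (n : ℝ) ^ (1 / 3200 * Real.log n / Real.log w) =
      Real.exp (2 * Real.log x ^ 2 / Real.log w) := by
    rw [Real.rpow_def_of_pos hn0, hlog]
    congr 1
    ring
  obtain ⟨T, hTdef⟩ : ∃ T, T = ⌊(n : ℝ) ^ (1 / 3200 * Real.log n / Real.log w)⌋₊ := ⟨_, rfl⟩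
  have hT : (T : ℝ) ≤ Real.exp (2 * Real.log x ^ 2 / Real.log w) := by
    rw [← hbound, hTdef]
    exact Nat.floor_le (by positivity)
  rcases le_or_gt (w : ℝ) (x ^ 2) with hwx | hwx
  · obtain ⟨A, hA⟩ := (survives_of_agood hn0' (agood_empty_of_le_exp hx hxn hw hwx
      (hT.trans (Real.exp_le_exp.2 (by gcongr; norm_num))))).exists_strategy
    exact ⟨A, fun P hmem t ht => hA P (fun s _ => hmem s) t (hTdef ▸ Nat.le_floor ht)⟩
  · have hTx : (T : ℝ) ≤ x := by
      refine hT.trans ?_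
      have h1 : 2 * Real.log x ≤ Real.log w := by
        have := Real.log_le_log (by positivity) hwx.le
        rwa [Real.log_pow, Nat.cast_ofNat] at this
      rw [← Real.le_log_iff_exp_le (by linarith), div_le_iff₀ hlw]
      nlinarith
    have hv2 : 2 ≤ ⌊x ^ 2⌋₊ := Nat.le_floor (by push_cast; nlinarith)
    have hvx : (⌊x ^ 2⌋₊ : ℝ) ≤ x ^ 2 := Nat.floor_le (by positivity)
    have hlv : 0 < Real.log ⌊x ^ 2⌋₊ := Real.log_pos (by
      have : (2 : ℝ) ≤ ⌊x ^ 2⌋₊ := by exact_mod_cast hv2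
      linarith)
    obtain ⟨A, hA⟩ := (survives_of_agood hn0' (agood_empty_of_le_exp (T := T) hx hxn hv2 hvx (by
      refine hTx.trans ?_
      have h1 : Real.log ⌊x ^ 2⌋₊ ≤ 2 * Real.log x := by
        have := Real.log_le_log (by
          have : (2 : ℝ) ≤ ⌊x ^ 2⌋₊ := by exact_mod_cast hv2
          linarith) hvx
        rwa [Real.log_pow, Nat.cast_ofNat] at this
      rw [← Real.log_le_iff_le_exp (by linarith), le_div_iff₀ hlv]
      nlinarith))).exists_strategy
    refine ⟨A, fun P _ t ht => hA P (fun s hs => ?_) t (hTdef ▸ Nat.le_floor ht)⟩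
    have h1 := memSize_stateOf_le (play P A s)
    rw [length_play] at h1
    have h2 : T ≤ ⌊x ^ 2⌋₊ := Nat.le_floor (by nlinarith)
    omega

end Paper
end
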